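/- Let p and q be distinct odd primes and let S be a finite nonabelian simple group admitting a (p,q)-Frattini triple (S, P, Q). Assume that no proper subgroup of S is isomorphic to a finite nonabelian simple group admitting a (p,q)-Frattini triple. Then there exist elements x and y in S such that: (1) the cyclic subgroup ⟨x⟩ is a Sylow p-subgroup of S; (2) the cyclic subgroup ⟨y⟩ is a Sylow q-subgroup of S; and (3) {x, y} invariably generates S, i.e., for all s, t ∈ S the conjugates x^s and y^t generate S. -/

import Mathlib

/-- A `(p,q)`-Frattini triple on a finite group `S`: a faithful irreducible
`𝔽_p`-module `P` and a faithful irreducible `𝔽_q`-module `Q` for `S`, both finite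
(hence of `p`-power resp. `q`-power order), such that
(1) no element of `S` has order divisible by `p·q`;
(2) `H²(S, P) ≠ 0`;  (3) `H²(S, Q) ≠ 0`;
(4) `C_P(s) = 0` for every nontrivial `s ∈ S` of `q`-power order;
(5) `C_Q(s) = 0` for every nontrivial `s ∈ S` of `p`-power order. -/
structure FrattiniTriple (p q : ℕ) (S : Type) [Group S] where
  P : Type
  [addP : AddCommGroup P]
  [modP : Module (ZMod p) P]
  [finP : Finite P]
  [nontrivP : Nontrivial P]
  ρP : Representation (ZMod p) S P
  Q : Type
  [addQ : AddCommGroup Q]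
  [modQ : Module (ZMod q) Q]
  [finQ : Finite Q]
  [nontrivQ : Nontrivial Q]
  ρQ : Representation (ZMod q) S Q
  faithfulP : ∀ s : S, (∀ v : P, ρP s v = v) → s = 1
  faithfulQ : ∀ s : S, (∀ v : Q, ρQ s v = v) → s = 1
  irredP : ∀ W : Submodule (ZMod p) P, (∀ (s : S), ∀ v ∈ W, ρP s v ∈ W) → W = ⊥ ∨ W = ⊤
  irredQ : ∀ W : Submodule (ZMod q) Q, (∀ (s : S), ∀ v ∈ W, ρQ s v ∈ W) → W = ⊥ ∨ W = ⊤
  no_pq : ∀ s : S, ¬ p * q ∣ orderOf s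
  h2P : Nontrivial (groupCohomology.H2 (Rep.of ρP))
  h2Q : Nontrivial (groupCohomology.H2 (Rep.of ρQ))
  fixP : ∀ s : S, s ≠ 1 → (∃ b : ℕ, orderOf s = q ^ b) → ∀ v : P, ρP s v = v → v = 0
  fixQ : ∀ s : S, s ≠ 1 → (∃ a : ℕ, orderOf s = p ^ a) → ∀ v : Q, ρQ s v = v → v = 0

/-- `S` admits a `(p,q)`-Frattini triple, i.e. `S ∈ 𝒮_{p,q}`. -/
def AdmitsFrattiniTriple (p q : ℕ) (S : Type) [Group S] : Prop :=
  Nonempty (FrattiniTriple p q S)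

section H2

variable {k G V : Type*} [CommRing k] [Group G] [AddCommGroup V] [Module k V]

/-- The inhomogeneous 2-cocycle identity. -/
def IsTwoCocycle (ρ : Representation k G V) (f : G → G → V) : Prop :=
  ∀ a b c, ρ a (f b c) + f a (b * c) = f (a * b) c + f a b

/-- `f` is the inhomogeneous coboundary of a function `G → V`. -/
def IsTwoCoboundary (ρ : Representation k G V) (f : G → G → V) : Prop :=
  ∃ h : G → V, ∀ a b, f a b = ρ a (h b) - h (a * b) + h a

/-- Every 2-cocycle is a 2-coboundary. -/
def H2Trivial (ρ : Representation k G V) : Prop :=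
  ∀ f : G → G → V, IsTwoCocycle ρ f → IsTwoCoboundary ρ f

theorem IsTwoCoboundary.add {ρ : Representation k G V} {f f' : G → G → V}
    (hf : IsTwoCoboundary ρ f) (hf' : IsTwoCoboundary ρ f') :
    IsTwoCoboundary ρ (fun a b => f a b + f' a b) := by
  obtain ⟨h, hh⟩ := hf
  obtain ⟨h', hh'⟩ := hf'
  refine ⟨fun a => h a + h' a, fun a b => ?_⟩
  simp only [hh, hh', map_add]
  abel

theorem IsTwoCoboundary.of_sub {ρ : Representation k G V} {f : G → G → V} (h : G → V)
    (hf : IsTwoCoboundary ρ (fun a b => f a b - (ρ a (h b) - h (a * b) + h a))) :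
    IsTwoCoboundary ρ f := by
  have := hf.add ⟨h, fun a b => rfl⟩
  simpa using this

theorem IsTwoCocycle.sub_coboundary {ρ : Representation k G V} {f : G → G → V}
    (hf : IsTwoCocycle ρ f) (h : G → V) :
    IsTwoCocycle ρ (fun a b => f a b - (ρ a (h b) - h (a * b) + h a)) := by
  intro a b c
  have := hf a b c
  simp only [map_sub, map_add, map_mul, Module.End.mul_apply, mul_assoc]
  linear_combination (norm := abel) this

/-- If the identity of `V` is a trace from the trivial subgroup, then `H²` vanishes. -/
theorem h2Trivial_of_trace [Fintype G] (ρ : Representation k G V) (φ : Module.End k V)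
    (hφ : ∑ g : G, ρ g * φ * ρ g⁻¹ = 1) : H2Trivial ρ := by
  intro f hf
  set T : G → Module.End k V := fun g => ρ g * φ * ρ g⁻¹ with hT
  have hTa : ∀ a g v, ρ a (T g v) = T (a * g) (ρ a v) := by
    intro a g v
    simp only [hT, mul_inv_rev, map_mul, Module.End.mul_apply]
    rw [← Module.End.mul_apply (ρ a⁻¹), ← map_mul]; simp
  refine ⟨fun a => ∑ g, T (a * g) (f a g), fun a b => ?_⟩
  have e1 : ∑ g, T (a * g) (f a g) = ∑ g, T (a * (b * g)) (f a (b * g)) :=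
    (Fintype.sum_equiv (Equiv.mulLeft b) _ _ (fun g => rfl)).symm
  have e2 : f a b = ∑ g, T (a * (b * g)) (f a b) := by
    rw [← LinearMap.sum_apply]
    have : ∑ g, T (a * (b * g)) = 1 := by
      rw [← hφ]
      exact Fintype.sum_equiv ((Equiv.mulLeft b).trans (Equiv.mulLeft a)) _ _ (fun g => rfl)
    rw [this]; rfl
  dsimp only
  rw [e1, map_sum]
  conv_lhs => rw [e2]
  rw [← Finset.sum_sub_distrib, ← Finset.sum_add_distrib]
  refine Finset.sum_congr rfl fun g _ => ?_
  rw [hTa, mul_assoc a b g, ← map_sub, ← map_add]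
  congr 1
  have := hf a b g
  linear_combination (norm := abel) -this

/-- A class function acts on 2-cocycles as its augmentation, up to coboundaries. -/
theorem center_smul_cocycle [Fintype G] (ρ : Representation k G V) (c : G → k)
    (hc : ∀ a g, c (a * g * a⁻¹) = c g) (f : G → G → V) (hf : IsTwoCocycle ρ f) :
    IsTwoCoboundary ρ (fun a b => ∑ g, c g • ρ g (f a b) - (∑ g, c g) • f a b) := by
  refine ⟨fun a => ∑ g, c g • (f g a - f a g), fun a b => ?_⟩
  have e1 : ∑ g, c g • f a (g * b) = ∑ g, c g • f a (b * g) := by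
    refine (Fintype.sum_equiv ((MulAut.conj b).toEquiv) _ _ (fun g => ?_)).symm
    simp [hc]
  have e2 : ∑ g, c g • f (g * a) b = ∑ g, c g • f (a * g) b := by
    refine (Fintype.sum_equiv ((MulAut.conj a).toEquiv) _ _ (fun g => ?_)).symm
    simp [hc]
  have key : ∀ g, ρ a (f g b) - ρ a (f b g) - (f g (a * b) - f (a * b) g) + (f g a - f a g)
      = ρ g (f a b) - f a b + (f (a * g) b - f (g * a) b) - (f a (g * b) - f a (b * g)) := by
    intro g
    have h1 := hf g a b
    have h2 := hf a g b
    have h3 := hf a b g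
    linear_combination (norm := abel) -h1 + h2 - h3
  calc _ = ∑ g, c g • (ρ g (f a b) - f a b) := by
        simp only [smul_sub, Finset.sum_sub_distrib, Finset.sum_smul]
    _ = ∑ g, c g • (ρ g (f a b) - f a b + (f (a * g) b - f (g * a) b)
          - (f a (g * b) - f a (b * g))) := by
        simp only [smul_sub, smul_add, Finset.sum_sub_distrib, Finset.sum_add_distrib, e1, e2]
        abel
    _ = _ := by
        simp only [← key]
        simp only [smul_sub, smul_add, Finset.sum_sub_distrib, Finset.sum_add_distrib, map_sum,
          map_smul, map_sub]

theorem IsTwoCoboundary.map {ρ : Representation k G V} {f : G → G → V}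
    (u : Module.End k V) (hu : ∀ g v, u (ρ g v) = ρ g (u v))
    (hf : IsTwoCoboundary ρ f) : IsTwoCoboundary ρ (fun a b => u (f a b)) := by
  obtain ⟨h, hh⟩ := hf
  exact ⟨fun a => u (h a), fun a b => by simp [hh, hu]⟩

/-- If a class function of invertible augmentation annihilates `V`, then `H²` vanishes. -/
theorem h2Trivial_of_center_eq_zero [Fintype G] (ρ : Representation k G V) (c : G → k)
    (hc : ∀ a g, c (a * g * a⁻¹) = c g) (hu : IsUnit (∑ g, c g))
    (h0 : ∀ v, ∑ g, c g • ρ g v = 0) : H2Trivial ρ := by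
  intro f hf
  obtain ⟨u, hu⟩ := hu
  have h1 := (center_smul_cocycle ρ c hc f hf).map (LinearMap.lsmul k V (-(↑u⁻¹ : k)))
    (fun g v => by simp)
  convert h1 using 3 with a b
  simp only [h0, ← hu]
  simp [smul_smul]

/-- On an irreducible finite module with nonvanishing `H²`, a class function acts as its
augmentation. -/
theorem center_acts_as_augmentation [Fintype G] [Finite V] (ρ : Representation k G V)
    (hirr : ∀ W : Submodule k V, (∀ (s : G), ∀ v ∈ W, ρ s v ∈ W) → W = ⊥ ∨ W = ⊤)
    (hH : ¬ H2Trivial ρ) (c : G → k)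
    (hc : ∀ a g, c (a * g * a⁻¹) = c g) (v : V) :
    ∑ g, c g • ρ g v = (∑ g, c g) • v := by
  set u : Module.End k V := ∑ g, c g • ρ g - (∑ g, c g) • 1 with hu
  have huv : ∀ w, u w = ∑ g, c g • ρ g w - (∑ g, c g) • w := by
    intro w; simp [hu]
  have hcomm : ∀ a w, u (ρ a w) = ρ a (u w) := by
    intro a w
    rw [huv, huv, map_sub, map_smul, map_sum]
    congr 1
    refine (Fintype.sum_equiv ((MulAut.conj a).toEquiv) _ _ (fun g => ?_)).symm
    simp only [MulEquiv.toEquiv_eq_coe, MulEquiv.coe_toEquiv, MulAut.conj_apply, hc, map_smul]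
    rw [← Module.End.mul_apply, ← Module.End.mul_apply, ← map_mul, ← map_mul]
    simp
  rcases hirr (LinearMap.ker u) (fun s w hw => by
    simp only [LinearMap.mem_ker] at hw ⊢; rw [hcomm, hw, map_zero]) with h | h
  · exfalso
    apply hH
    have hinj : Function.Injective u := LinearMap.ker_eq_bot.mp h
    have hbij : Function.Bijective u := Finite.injective_iff_bijective.mp hinj
    intro f hf
    let e := LinearEquiv.ofBijective u hbij
    have he : ∀ w, e w = u w := fun w => rfl
    have hf' : IsTwoCocycle ρ (fun a b => e.symm (f a b)) := by
      intro a b c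
      apply e.injective
      have : ∀ g w, e (ρ g w) = ρ g (e w) := hcomm
      simp [map_add, this, hf a b c]
    have h1 := center_smul_cocycle ρ c hc _ hf'
    convert h1 using 3 with a b
    rw [← huv, ← he]; simp
  · have : u v = 0 := by
      have : v ∈ LinearMap.ker u := h ▸ Submodule.mem_top
      simpa using this
    rw [huv, sub_eq_zero] at this
    exact this

end H2

theorem nontrivial_H2_iff {k G : Type} {V : Type} [CommRing k] [Group G] [AddCommGroup V]
    [Module k V] (ρ : Representation k G V) :
    Nontrivial (groupCohomology.H2 (Rep.of ρ)) ↔ ¬ H2Trivial ρ := by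
  rw [← not_subsingleton_iff_nontrivial, not_iff_not]
  constructor
  · intro h f hf
    have hmem : (fun g : G × G => f g.1 g.2) ∈ groupCohomology.cocycles₂ (Rep.of ρ) := by
      rw [groupCohomology.mem_cocycles₂_iff]
      intro a b c
      have := hf a b c
      rw [add_comm (ρ a _)] at this
      simpa [add_comm] using this.symm
    have h0 : groupCohomology.H2π (Rep.of ρ) ⟨_, hmem⟩ = 0 := Subsingleton.elim _ _
    rw [groupCohomology.H2π_eq_zero_iff] at h0
    obtain ⟨h, hh⟩ := h0
    refine ⟨h, fun a b => ?_⟩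
    have := congrFun hh (a, b)
    exact this.symm
  · intro h
    refine ⟨fun x y => ?_⟩
    suffices H : ∀ z : groupCohomology.H2 (Rep.of ρ), z = 0 by rw [H x, H y]
    intro z
    refine groupCohomology.H2_induction_on z fun f => ?_
    rw [groupCohomology.H2π_eq_zero_iff]
    obtain ⟨h', hh'⟩ := h (fun a b => f (a, b)) (fun a b c => by
      exact ((groupCohomology.mem_cocycles₂_iff _).1 f.2 a b c).symm)
    refine ⟨h', ?_⟩
    ext ⟨a, b⟩
    exact (hh' a b).symm

section H2Restriction

variable {k G V : Type*} [CommRing k] [Group G] [AddCommGroup V] [Module k V]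

/-- Vanishing of `H²` passes from a subgroup of invertible index to the whole group. -/
theorem h2Trivial_of_subgroup [Finite G] (ρ : Representation k G V) (L : Subgroup G)
    (hL : IsUnit (L.index : k)) (h : H2Trivial (ρ.comp L.subtype)) : H2Trivial ρ := by
  classical
  -- reduce to cocycles vanishing on `L × L`
  suffices H : ∀ f : G → G → V, IsTwoCocycle ρ f → (∀ a b : L, f a b = 0) →
      IsTwoCoboundary ρ f by
    intro f hf
    obtain ⟨h0, hh0⟩ := h (fun a b => f a b) (fun a b c => hf a b c)
    let h1 : G → V := fun g => if hg : g ∈ L then h0 ⟨g, hg⟩ else 0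
    have h1L : ∀ a : L, h1 a = h0 a := fun a => by simp [h1]
    refine IsTwoCoboundary.of_sub h1 (H _ (hf.sub_coboundary h1) fun a b => ?_)
    have : f a b = ρ a (h0 b) - h0 (a * b) + h0 a := hh0 a b
    rw [this, ← Subgroup.coe_mul, h1L, h1L, h1L, sub_self]
  intro f hf hfL
  let t : G → G := fun g => (QuotientGroup.mk (s := L) g).out
  have htL : ∀ g, (t g)⁻¹ * g ∈ L := fun g => by
    rw [← QuotientGroup.eq]; exact Quotient.out_eq' _
  have ht : ∀ g (l : L), t (g * l) = t g := fun g l => by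
    have : (QuotientGroup.mk (s := L) (g * l)) = QuotientGroup.mk g := by simp
    simp only [t, this]
  let u : G → V := fun g => f (t g) ((t g)⁻¹ * g)
  suffices H : ∀ f : G → G → V, IsTwoCocycle ρ f → (∀ s (l : L), f s l = 0) →
      IsTwoCoboundary ρ f by
    refine IsTwoCoboundary.of_sub (fun a => - u a) (H _ (hf.sub_coboundary _) fun s l => ?_)
    have h1 : u l = 0 := by
      have : t l ∈ L := by
        have := L.mul_mem l.2 (L.inv_mem (htL l)); simpa using this
      exact hfL ⟨_, this⟩ ⟨_, htL l⟩
    have h2 := hf (t s) ((t s)⁻¹ * s) l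
    rw [hfL ⟨_, htL s⟩ l, map_zero, zero_add, mul_inv_cancel_left] at h2
    have h3 : u (s * l) = f (t s) ((t s)⁻¹ * s * l) := by
      simp only [u, ht, mul_assoc]
    simp only [h1, h3, h2, neg_zero, map_zero]
    simp only [u]
    abel
  clear hf hfL u f
  intro f hf hfL
  have hinv : ∀ a b (l : L), f a (b * l) = f a b := fun a b l => by
    have := hf a b l
    rwa [hfL, hfL, map_zero, zero_add, zero_add] at this
  let _ : Fintype (G ⧸ L) := Fintype.ofFinite _
  let F : G → G ⧸ L → V := fun a => Quotient.lift (s := QuotientGroup.leftRel L) (f a)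
    (fun b c hbc => by
      have : b⁻¹ * c ∈ L := by rwa [← QuotientGroup.leftRel_apply]
      have := hinv a b ⟨_, this⟩
      simpa using this.symm)
  have hF : ∀ a b, F a (QuotientGroup.mk b) = f a b := fun a b => rfl
  obtain ⟨m, hm⟩ := hL
  refine ⟨fun a => (↑m⁻¹ : k) • ∑ x, F a x, fun a b => ?_⟩
  have e1 : ∑ x, F a x = ∑ x : G ⧸ L, F a (b • x) :=
    (Fintype.sum_equiv (MulAction.toPerm b) _ _ (fun g => rfl)).symm
  have e2 : f a b = (↑m⁻¹ : k) • ∑ x : G ⧸ L, f a b := by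
    rw [Finset.sum_const, Finset.card_univ, ← Nat.card_eq_fintype_card]
    change f a b = (↑m⁻¹ : k) • (L.index • f a b)
    rw [← Nat.cast_smul_eq_nsmul k, ← hm, smul_smul]; simp
  dsimp only
  rw [e1, map_smul, map_sum]
  conv_lhs => rw [e2]
  rw [← smul_sub, ← smul_add, ← Finset.sum_sub_distrib, ← Finset.sum_add_distrib]
  congr 1
  refine Finset.sum_congr rfl fun x _ => ?_
  induction x using QuotientGroup.induction_on with
  | H g =>
    change f a b = ρ a (f b g) - f (a * b) g + f a (b * g)
    have := hf a b g
    linear_combination (norm := abel) -this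

/-- Vanishing of `H²` is closed under extensions. -/
theorem h2Trivial_of_extension (ρ : Representation k G V) (W : Submodule k V)
    (hW : ∀ g, W ≤ W.comap (ρ g)) (h1 : H2Trivial (ρ.subrepresentation W hW))
    (h2 : H2Trivial (ρ.quotient W hW)) : H2Trivial ρ := by
  intro f hf
  obtain ⟨u, hu⟩ := h2 (fun a b => W.mkQ (f a b)) (fun a b c => by
    have := congrArg W.mkQ (hf a b c)
    simpa using this)
  choose v hv using fun a => W.mkQ_surjective (u a)
  refine IsTwoCoboundary.of_sub v ?_
  have hmem : ∀ a b, f a b - (ρ a (v b) - v (a * b) + v a) ∈ W := fun a b => by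
    rw [← Submodule.ker_mkQ W, LinearMap.mem_ker]
    have := hu a b
    rw [← hv, ← hv, ← hv] at this
    simp only [map_sub, map_add, this]
    simp
  have hc := hf.sub_coboundary v
  obtain ⟨w, hw⟩ := h1 (fun a b => ⟨_, hmem a b⟩) (fun a b c => by
    apply Subtype.ext
    exact hc a b c)
  refine ⟨fun a => w a, fun a b => ?_⟩
  have := congrArg Subtype.val (hw a b)
  exact this

end H2Restriction

/-- The sum of the first `n` powers of `s` annihilates the module. -/
def NormZero {k G V : Type*} [CommRing k] [Group G] [AddCommGroup V] [Module k V]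
    (ρ : Representation k G V) (s : G) (n : ℕ) : Prop :=
  ∀ v, ∑ j ∈ Finset.range n, ρ (s ^ j) v = 0

/-- A finite module with nonvanishing `H²` has an irreducible subquotient with nonvanishing `H²`. -/
theorem exists_irreducible_subquotient {k G : Type} [CommRing k] [Group G] (n : ℕ) :
    ∀ (V : Type) [AddCommGroup V] [Module k V] [Finite V] (ρ : Representation k G V),
    Nat.card V ≤ n → ¬ H2Trivial ρ →
    ∃ (W : Type) (_ : AddCommGroup W) (_ : Module k W) (σ : Representation k G W),
      Finite W ∧ Nontrivial W ∧
      (∀ U : Submodule k W, (∀ (s : G), ∀ v ∈ U, σ s v ∈ U) → U = ⊥ ∨ U = ⊤) ∧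
      ¬ H2Trivial σ ∧ ∀ s m, NormZero ρ s m → NormZero σ s m := by
  induction n with
  | zero =>
    intro V _ _ _ ρ hV
    have : 0 < Nat.card V := Nat.card_pos
    omega
  | succ n ih =>
    intro V _ _ _ ρ hV hρ
    by_cases hirr : ∀ U : Submodule k V, (∀ (s : G), ∀ v ∈ U, ρ s v ∈ U) → U = ⊥ ∨ U = ⊤
    · refine ⟨V, _, _, ρ, inferInstance, ?_, hirr, hρ, fun _ _ h => h⟩
      by_contra hV'
      rw [not_nontrivial_iff_subsingleton] at hV'
      exact hρ fun f _ => ⟨fun _ => 0, fun _ _ => Subsingleton.elim _ _⟩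
    · push Not at hirr
      obtain ⟨U, hU, hbot, htop⟩ := hirr
      have hU' : ∀ g, U ≤ U.comap (ρ g) := fun g v hv => hU g v hv
      have hcard : Nat.card V = Nat.card U * Nat.card (V ⧸ U) :=
        Submodule.card_eq_card_quotient_mul_card U
      have : Finite (V ⧸ U) := Finite.of_surjective _ U.mkQ_surjective
      have hU1 : 1 < Nat.card U := by
        rw [Finite.one_lt_card_iff_nontrivial, Submodule.nontrivial_iff_ne_bot]; exact hbot
      have hU2 : 1 < Nat.card (V ⧸ U) := by
        rw [Finite.one_lt_card_iff_nontrivial, Submodule.Quotient.nontrivial_iff]; exact htop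
      by_cases h1 : H2Trivial (ρ.subrepresentation U hU')
      · have h2 : ¬ H2Trivial (ρ.quotient U hU') := fun h2 =>
          hρ (h2Trivial_of_extension ρ U hU' h1 h2)
        obtain ⟨W, i1, i2, σ, c1, c2, c3, c4, c5⟩ := ih (V ⧸ U) (ρ.quotient U hU')
          (by nlinarith) h2
        refine ⟨W, i1, i2, σ, c1, c2, c3, c4, fun s m h => c5 s m fun v => ?_⟩
        obtain ⟨v, rfl⟩ := U.mkQ_surjective v
        have := congrArg U.mkQ (h v)
        simpa using this
      · obtain ⟨W, i1, i2, σ, c1, c2, c3, c4, c5⟩ := ih U (ρ.subrepresentation U hU')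
          (by nlinarith) h1
        refine ⟨W, i1, i2, σ, c1, c2, c3, c4, fun s m h => c5 s m fun v => ?_⟩
        apply Subtype.ext
        simpa using h v

theorem normZero_of_fixed_eq_zero {k G V : Type*} [CommRing k] [Group G] [AddCommGroup V]
    [Module k V] (ρ : Representation k G V) (s : G) (n : ℕ) (hs : s ^ n = 1)
    (h : ∀ v, ρ s v = v → v = 0) : NormZero ρ s n := by
  intro v
  apply h
  rw [map_sum]
  have h1 : ∀ j, ρ s (ρ (s ^ j) v) = ρ (s ^ (j + 1)) v := fun j => by
    rw [pow_succ', map_mul]; rfl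
  simp only [h1]
  have h2 := Finset.sum_range_succ (fun j => ρ (s ^ j) v) n
  have h3 := Finset.sum_range_succ' (fun j => ρ (s ^ j) v) n
  rw [h2, hs, pow_zero] at h3
  exact (add_right_cancel h3).symm

theorem NormZero.fixed_eq_zero {k G V : Type*} [Field k] [Group G] [AddCommGroup V]
    [Module k V] {ρ : Representation k G V} {s : G} {n : ℕ} (h : NormZero ρ s n)
    (hn : (n : k) ≠ 0) {v : V} (hv : ρ s v = v) : v = 0 := by
  have h1 : ∀ j, ρ (s ^ j) v = v := fun j => by
    induction j with
    | zero => simp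
    | succ j ih => rw [pow_succ, map_mul, Module.End.mul_apply, hv, ih]
  have h2 := h v
  simp only [h1, Finset.sum_const, Finset.card_range] at h2
  rw [← Nat.cast_smul_eq_nsmul k] at h2
  exact (smul_eq_zero.mp h2).resolve_left hn

section ConjTrace

variable {G A : Type*} [Group G] [Ring A]

/-- The sum of the conjugates of `a` under the first `n` powers of `z`. -/
def conjTrace (σ : G →* A) (z : G) (n : ℕ) (a : A) : A :=
  ∑ j ∈ Finset.range n, σ (z ^ j) * a * σ (z ^ j)⁻¹

theorem conjTrace_add (σ : G →* A) (z : G) (n : ℕ) (a b : A) :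
    conjTrace σ z n (a + b) = conjTrace σ z n a + conjTrace σ z n b := by
  simp [conjTrace, mul_add, add_mul, Finset.sum_add_distrib]

theorem conjTrace_zero (σ : G →* A) (z : G) (n : ℕ) : conjTrace σ z n 0 = 0 := by
  simp [conjTrace]

theorem conjTrace_neg (σ : G →* A) (z : G) (n : ℕ) (a : A) :
    conjTrace σ z n (-a) = - conjTrace σ z n a := by
  simp [conjTrace]

theorem conjTrace_sub (σ : G →* A) (z : G) (n : ℕ) (a b : A) :
    conjTrace σ z n (a - b) = conjTrace σ z n a - conjTrace σ z n b := by
  rw [sub_eq_add_neg, conjTrace_add, conjTrace_neg, ← sub_eq_add_neg]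

theorem commute_pow_of_commute (σ : G →* A) {z : G} {b : A} (h : Commute (σ z) b) (j : ℕ) :
    Commute (σ (z ^ j)) b := by
  rw [map_pow]; exact h.pow_left j

theorem map_inv_mul_map (σ : G →* A) (g : G) : σ g⁻¹ * σ g = 1 := by
  rw [← map_mul]; simp

theorem map_mul_map_inv (σ : G →* A) (g : G) : σ g * σ g⁻¹ = 1 := by
  rw [← map_mul]; simp

theorem commute_map_inv (σ : G →* A) {z : G} {b : A} (h : Commute (σ z) b) :
    Commute (σ z⁻¹) b := by
  have h1 : σ z⁻¹ * (σ z * b) * σ z⁻¹ = σ z⁻¹ * (b * σ z) * σ z⁻¹ := by rw [h.eq]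
  rw [← mul_assoc, map_inv_mul_map, one_mul, mul_assoc, mul_assoc, map_mul_map_inv, mul_one] at h1
  exact h1.symm

theorem mul_conjTrace (σ : G →* A) {z : G} (n : ℕ) (a : A) {b : A} (h : Commute (σ z) b) :
    b * conjTrace σ z n a = conjTrace σ z n (b * a) := by
  simp only [conjTrace, Finset.mul_sum]
  refine Finset.sum_congr rfl fun j _ => ?_
  have := (commute_pow_of_commute σ h j).eq
  simp only [← mul_assoc, this]

theorem conjTrace_mul (σ : G →* A) {z : G} (n : ℕ) (a : A) {b : A} (h : Commute (σ z) b) :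
    conjTrace σ z n a * b = conjTrace σ z n (a * b) := by
  simp only [conjTrace, Finset.sum_mul]
  refine Finset.sum_congr rfl fun j _ => ?_
  have := (commute_map_inv σ (commute_pow_of_commute σ h j)).eq
  simp only [mul_assoc, this]

/-- Summing an equivariant family over a set without fixed points gives a trace. -/
theorem sum_eq_conjTrace_of_no_fixed {Ω : Type*} [DecidableEq Ω] (σ : G →* A) (z : G) {q : ℕ}
    (hq : q.Prime) (e : Equiv.Perm Ω) (he : e ^ q = 1) (F : Ω → A)
    (hF : ∀ ω, F (e ω) = σ z * F ω * σ z⁻¹) (n : ℕ) :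
    ∀ s : Finset Ω, s.card ≤ n → (∀ ω ∈ s, e ω ∈ s) → (∀ ω ∈ s, e ω ≠ ω) →
      ∃ a, ∑ ω ∈ s, F ω = conjTrace σ z q a := by
  have hFj : ∀ (j : ℕ) ω, F ((e ^ j) ω) = σ (z ^ j) * F ω * σ (z ^ j)⁻¹ := by
    intro j
    induction j with
    | zero => intro ω; simp
    | succ j ih =>
      intro ω
      rw [pow_succ', Equiv.Perm.mul_apply, hF, ih, pow_succ', mul_inv_rev, map_mul, map_mul]
      simp only [mul_assoc]
  induction n with
  | zero =>
    intro s hs _ _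
    have : s = ∅ := by simpa using hs
    exact ⟨0, by simp [this, conjTrace_zero]⟩
  | succ n ih =>
    intro s hs hinv hfix
    rcases s.eq_empty_or_nonempty with rfl | ⟨ω, hω⟩
    · exact ⟨0, by simp [conjTrace_zero]⟩
    let orb := (Finset.range q).image (fun j => (e ^ j) ω)
    have hpow : ∀ j : ℕ, (e ^ j) ω ∈ s := fun j => by
      induction j with
      | zero => simpa
      | succ j ih => rw [pow_succ', Equiv.Perm.mul_apply]; exact hinv _ ih
    have hsub : orb ⊆ s := by
      intro x hx
      obtain ⟨j, _, rfl⟩ := Finset.mem_image.mp hx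
      exact hpow j
    have hinj : Set.InjOn (fun j => (e ^ j) ω) (Finset.range q) := by
      have hper : Function.minimalPeriod e ω = q := by
        have : Fact q.Prime := ⟨hq⟩
        refine Function.minimalPeriod_eq_prime ?_ (fun h => hfix ω hω h)
        have := congrArg (fun f => f ω) he
        change e^[q] ω = ω
        rw [← Equiv.Perm.coe_pow]
        exact this
      intro i hi j hj hij
      simp only [Finset.coe_range, Set.mem_Iio] at hi hj
      simp only [Equiv.Perm.coe_pow] at hij
      exact Function.iterate_injOn_Iio_minimalPeriod (by simpa [hper] using hi)
        (by simpa [hper] using hj) hij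
    obtain ⟨a, ha⟩ := ih (s \ orb) (by
        have h1 : (s \ orb).card < s.card := Finset.card_lt_card (by
          refine Finset.sdiff_ssubset hsub ⟨ω, ?_⟩
          exact Finset.mem_image.mpr ⟨0, by simpa using hq.pos, by simp⟩)
        omega)
      (by
        intro x hx
        rw [Finset.mem_sdiff] at hx ⊢
        refine ⟨hinv x hx.1, fun h => hx.2 ?_⟩
        obtain ⟨j, hj, hje⟩ := Finset.mem_image.mp h
        have h2 : x = (e ^ (j + (q - 1))) ω := by
          apply e.injective
          rw [← Equiv.Perm.mul_apply, ← pow_succ', add_assoc, Nat.sub_add_cancel hq.one_le,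
            pow_add, he, mul_one]
          exact hje.symm
        refine Finset.mem_image.mpr ⟨(j + (q - 1)) % q, by
          simpa using Nat.mod_lt _ hq.pos, ?_⟩
        rw [h2, ← pow_eq_pow_mod _ he])
      (fun x hx => hfix x (Finset.mem_sdiff.mp hx).1)
    refine ⟨a + F ω, ?_⟩
    rw [conjTrace_add, ← ha, ← Finset.sum_sdiff hsub]
    congr 1
    rw [Finset.sum_image hinj, conjTrace]
    exact Finset.sum_congr rfl fun j _ => hFj j ω

/-- Summing an equivariant family gives the sum over the fixed points up to a trace. -/
theorem sum_eq_sum_fixed_add_conjTrace {Ω : Type*} [Fintype Ω] [DecidableEq Ω] (σ : G →* A) (z : G)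
    {q : ℕ} (hq : q.Prime) (e : Equiv.Perm Ω) (he : e ^ q = 1) (F : Ω → A)
    (hF : ∀ ω, F (e ω) = σ z * F ω * σ z⁻¹) :
    ∃ a, ∑ ω, F ω = ∑ ω with e ω = ω, F ω + conjTrace σ z q a := by
  obtain ⟨a, ha⟩ := sum_eq_conjTrace_of_no_fixed σ z hq e he F hF _
    (Finset.univ.filter fun ω => ¬ e ω = ω) le_rfl
    (by simp) (by simp)
  exact ⟨a, by rw [← ha, Finset.sum_filter_add_sum_filter_not]⟩

open Polynomial in
theorem sub_one_pow_eq_sum (q b : ℕ) [Fact q.Prime] (R : Type*) [Ring R] [Algebra (ZMod q) R]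
    (x : R) : (x - 1) ^ (q ^ b - 1) = ∑ j ∈ Finset.range (q ^ b), x ^ j := by
  have hq : q.Prime := Fact.out
  have key : (X - 1 : (ZMod q)[X]) ^ (q ^ b - 1) = ∑ j ∈ Finset.range (q ^ b), X ^ j := by
    have hne : (X - 1 : (ZMod q)[X]) ≠ 0 := by
      have := X_sub_C_ne_zero (1 : ZMod q); simpa using this
    apply mul_right_cancel₀ hne
    rw [geom_sum_mul, ← pow_succ, Nat.sub_add_cancel (Nat.one_le_pow _ _ hq.pos),
      sub_pow_char_pow, one_pow]
  simpa using congrArg (aeval x) key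

open Polynomial in
theorem sub_one_pow_char_pow (q b : ℕ) [Fact q.Prime] (R : Type*) [Ring R] [Algebra (ZMod q) R]
    (x : R) : (x - 1) ^ (q ^ b) = x ^ (q ^ b) - 1 := by
  have key : (X - 1 : (ZMod q)[X]) ^ (q ^ b) = X ^ (q ^ b) - 1 := by
    rw [sub_pow_char_pow, one_pow]
  simpa using congrArg (aeval x) key

/-- An idempotent fixed by a `q`-element `y` which is a trace from the trivial group to the
subgroup of order `q` of `⟨y⟩` is a trace from the trivial group to `⟨y⟩`. -/
theorem idempotent_eq_conjTrace (σ : G →* A) (q b : ℕ) [Fact q.Prime] [Algebra (ZMod q) A] (y : G)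
    (π φ : A) (hπ : π * π = π) (hc : Commute (σ y) π)
    (h : π = conjTrace σ (y ^ q ^ b) q φ) : ∃ φ', π = conjTrace σ y (q ^ (b + 1)) φ' := by
  have hq : q.Prime := Fact.out
  set τ : Module.End (ZMod q) A :=
    LinearMap.mulLeft (ZMod q) (σ y) * LinearMap.mulRight (ZMod q) (σ y⁻¹) with hτ
  have hτa : ∀ a, τ a = σ y * a * σ y⁻¹ := fun a => by simp [hτ, mul_assoc]
  have hτj : ∀ (j : ℕ) a, (τ ^ j) a = σ (y ^ j) * a * σ (y ^ j)⁻¹ := by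
    intro j
    induction j with
    | zero => intro a; simp
    | succ j ih =>
      intro a
      rw [pow_succ', Module.End.mul_apply, hτa, ih, pow_succ', mul_inv_rev, map_mul, map_mul]
      simp only [mul_assoc]
  set t := τ - 1 with ht
  set s := q ^ b with hs
  have hspos : 0 < s := pow_pos hq.pos b
  have hn : q ^ (b + 1) = q * s := by rw [pow_succ, mul_comm]
  have hts : t ^ s = τ ^ s - 1 := by
    exact sub_one_pow_char_pow q b _ τ
  have h1 : ∀ a, (t ^ (s * (q - 1))) a = conjTrace σ (y ^ s) q a := by
    intro a
    have := sub_one_pow_eq_sum q 1 _ (τ ^ s)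
    rw [pow_one] at this
    rw [pow_mul, hts, this, conjTrace, LinearMap.sum_apply]
    refine Finset.sum_congr rfl fun j _ => ?_
    rw [← pow_mul, hτj, pow_mul]
  have h2 : ∀ a, (t ^ (q * s - 1)) a = conjTrace σ y (q * s) a := by
    intro a
    have := sub_one_pow_eq_sum q (b + 1) _ τ
    rw [hn] at this
    rw [ht, this, conjTrace, LinearMap.sum_apply]
    exact Finset.sum_congr rfl fun j _ => hτj j a
  have hτπ : τ π = π := by
    rw [hτa, hc.eq, mul_assoc, map_mul_map_inv, mul_one]
  have htπ : t π = 0 := by simp [ht, hτπ]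
  have hπt : ∀ a, t (π * a) = π * t a := by
    intro a
    simp only [ht, LinearMap.sub_apply, Module.End.one_apply, hτa, mul_sub]
    congr 1
    rw [← mul_assoc, hc.eq]; simp only [mul_assoc]
  have hπtj : ∀ (j : ℕ) a, (t ^ j) (π * a) = π * (t ^ j) a := by
    intro j
    induction j with
    | zero => intro a; simp
    | succ j ih => intro a; rw [pow_succ', Module.End.mul_apply, ih, hπt, Module.End.mul_apply]
  have hsq : s * (q - 1) = s * (q - 2) + s := by
    have : q - 1 = q - 2 + 1 := by have := hq.two_le; omega
    rw [this, mul_add, mul_one]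
  have hqs : q * s = s * (q - 1) + s := by
    have : q = q - 1 + 1 := by have := hq.two_le; omega
    conv_lhs => rw [this]
    ring
  set u := π * φ with hu
  have hπu : (t ^ (s * (q - 1))) u = π := by
    rw [hu, hπtj, h1, ← h, hπ]
  set w := (t ^ (s * (q - 2) + 1)) u with hw
  have hw1 : (t ^ (s - 1)) w = π := by
    rw [hw, ← Module.End.mul_apply, ← pow_add, ← hπu]
    congr 2; omega
  have hw2 : (τ ^ s) w = w := by
    have : (t ^ s) w = 0 := by
      have e : s = (s - 1) + 1 := by omega
      rw [e, pow_succ', Module.End.mul_apply, hw1, htπ]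
    rw [hts, LinearMap.sub_apply, sub_eq_zero] at this
    exact this
  have hw3 : π * w = w := by
    rw [hw, ← hπtj, hu, ← mul_assoc, hπ]
  have hwc : Commute (σ (y ^ s)) w := by
    rw [hτj] at hw2
    have := congrArg (· * σ (y ^ s)) hw2
    simp only [mul_assoc, map_inv_mul_map, mul_one] at this
    exact this
  refine ⟨φ * w, ?_⟩
  rw [hn, ← h2]
  have hw4 : w = (t ^ (s * (q - 1))) (φ * w) := by
    rw [h1, ← conjTrace_mul _ _ _ hwc, ← h, hw3]
  rw [← hw1]
  conv_lhs => rw [hw4]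
  rw [← Module.End.mul_apply, ← pow_add]
  congr 2; omega

theorem sum_eq_sum_quotient_out {M : Type*} [AddCommMonoid M] [Fintype G] (L : Subgroup G)
    [Fintype (G ⧸ L)] [Fintype L] (F : G → M) :
    ∑ g, F g = ∑ c : G ⧸ L, ∑ l : L, F (c.out * l) := by
  rw [← Fintype.sum_prod_type']
  symm
  refine Fintype.sum_bijective (fun x : (G ⧸ L) × L => x.1.out * (x.2 : G)) ⟨?_, ?_⟩ _ _
    fun x => rfl
  · rintro ⟨c, l⟩ ⟨c', l'⟩ h
    have hc : c = c' := by
      have := congrArg (QuotientGroup.mk (s := L)) h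
      simpa using this
    subst hc
    have := mul_left_cancel h
    rw [Prod.mk.injEq]
    exact ⟨rfl, Subtype.ext this⟩
  · intro g
    have : ((QuotientGroup.mk (s := L) g).out)⁻¹ * g ∈ L := by
      rw [← QuotientGroup.eq]; exact Quotient.out_eq' _
    exact ⟨(QuotientGroup.mk g, ⟨_, this⟩), by simp⟩

theorem sum_zpowers_eq_sum_range {M : Type*} [AddCommMonoid M] [Finite G] (y : G)
    [Fintype (Subgroup.zpowers y)] (F : G → M) :
    ∑ l : Subgroup.zpowers y, F l = ∑ j ∈ Finset.range (orderOf y), F (y ^ j) := by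
  rw [Finset.sum_range]
  exact (Fintype.sum_equiv (finEquivZPowers (isOfFinOrder_of_finite y)) _ _ fun j => rfl).symm

/-- A central element which is a trace from the trivial group to a cyclic subgroup of invertible
index is a trace from the trivial group to the whole group. -/
theorem exists_sum_conj_of_conjTrace [Fintype G] (q : ℕ) [Fact q.Prime] [Algebra (ZMod q) A]
    (σ : G →* A) (y : G) (π φ : A) (hc : ∀ g, Commute (σ g) π)
    (h : π = conjTrace σ y (orderOf y) φ) (hi : ¬ q ∣ (Subgroup.zpowers y).index) :
    ∃ φ', π = ∑ g, σ g * φ' * σ g⁻¹ := by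
  classical
  have hi' : ((Subgroup.zpowers y).index : ZMod q) ≠ 0 := by
    rwa [Ne, ZMod.natCast_eq_zero_iff]
  have h1 : ∑ g, σ g * φ * σ g⁻¹ = ((Subgroup.zpowers y).index : ZMod q) • π := by
    rw [sum_eq_sum_quotient_out (Subgroup.zpowers y)]
    have h2 : ∀ c : G ⧸ Subgroup.zpowers y,
        ∑ l : Subgroup.zpowers y, σ (c.out * l) * φ * σ (c.out * l)⁻¹ = π := fun c => by
      rw [sum_zpowers_eq_sum_range y (fun l => σ (c.out * l) * φ * σ (c.out * l)⁻¹)]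
      have h3 : σ c.out * π * σ c.out⁻¹ = π := by
        rw [(hc _).eq, mul_assoc, map_mul_map_inv, mul_one]
      rw [← h3]
      conv_rhs => rw [h]
      rw [conjTrace, Finset.mul_sum, Finset.sum_mul]
      refine Finset.sum_congr rfl fun j _ => ?_
      simp only [mul_inv_rev, map_mul, mul_assoc]
    rw [Finset.sum_congr rfl fun c _ => h2 c, Finset.sum_const, Finset.card_univ,
      ← Nat.card_eq_fintype_card, Nat.cast_smul_eq_nsmul]
    rfl
  refine ⟨((Subgroup.zpowers y).index : ZMod q)⁻¹ • φ, ?_⟩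
  simp only [mul_smul_comm, smul_mul_assoc]
  rw [← Finset.smul_sum, h1, smul_smul, inv_mul_cancel₀ hi', one_smul]

end ConjTrace

theorem mem_zpowers_symm_of_orderOf_eq {G : Type*} [Group G] [Finite G] {u v : G}
    (h : orderOf u = orderOf v) (hu : u ∈ Subgroup.zpowers v) : v ∈ Subgroup.zpowers u := by
  have h1 : Subgroup.zpowers u ≤ Subgroup.zpowers v := by simpa using hu
  have h2 := Subgroup.eq_of_le_of_card_ge h1 (by simp [Nat.card_zpowers, h])
  rw [h2]; exact Subgroup.mem_zpowers v

/-- Two commuting elements of order `q` whose group acts without fixed points are dependent. -/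
theorem mem_zpowers_of_normZero {k G V : Type*} [Field k] [Group G] [Finite G] [AddCommGroup V]
    [Module k V] [Nontrivial V] (ρ : Representation k G V) {q : ℕ} (hq : q.Prime)
    (hqk : (q : k) ≠ 0) (h : ∀ s : G, s ≠ 1 → s ^ q = 1 → NormZero ρ s q)
    {a b : G} (ha : orderOf a = q) (hb : orderOf b = q) (hab : Commute a b) :
    b ∈ Subgroup.zpowers a := by
  by_contra hba
  obtain ⟨v, hv⟩ := exists_ne (0 : V)
  apply hv
  have haq : a ^ q = 1 := ha ▸ pow_orderOf_eq_one a
  have hbq : b ^ q = 1 := hb ▸ pow_orderOf_eq_one b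
  have h1 : ∀ j : ℕ, ∑ i ∈ Finset.range q, ρ ((a * b ^ j) ^ i) v = 0 := fun j => by
    apply h
    · intro h1
      apply hba
      apply mem_zpowers_symm_of_orderOf_eq (ha.trans hb.symm)
      rw [mul_eq_one_iff_eq_inv] at h1
      rw [h1]
      exact inv_mem (pow_mem (Subgroup.mem_zpowers b) j)
    · rw [(hab.pow_right j).mul_pow, haq, one_mul, ← pow_mul, mul_comm, pow_mul, hbq, one_pow]
  have h2 : ∑ j ∈ Finset.range q, ∑ i ∈ Finset.range q, ρ ((a * b ^ j) ^ i) v = 0 :=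
    Finset.sum_eq_zero fun j _ => h1 j
  rw [Finset.sum_comm] at h2
  have h3 : ∀ i j : ℕ, ρ ((a * b ^ j) ^ i) v = ρ (a ^ i) (ρ ((b ^ i) ^ j) v) := fun i j => by
    rw [(hab.pow_right j).mul_pow, ← pow_mul, ← pow_mul, mul_comm j i, map_mul]; rfl
  simp only [h3, ← map_sum] at h2
  rw [Finset.sum_eq_single 0] at h2
  · simp only [pow_zero, one_pow, map_one, Module.End.one_apply, Finset.sum_const,
      Finset.card_range] at h2
    rw [← Nat.cast_smul_eq_nsmul k] at h2
    exact (smul_eq_zero.mp h2).resolve_left hqk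
  · intro i hi hi0
    have : b ^ i ≠ 1 := by
      intro hbi
      have := orderOf_dvd_of_pow_eq_one hbi
      rw [hb] at this
      have := Nat.le_of_dvd (Nat.pos_of_ne_zero hi0) this
      have := Finset.mem_range.mp hi
      omega
    rw [h _ this (by rw [← pow_mul, mul_comm, pow_mul, hbq, one_pow]) v, map_zero]
  · intro h0
    exact absurd (Finset.mem_range.mpr hq.pos) h0

theorem conj_pow_eq_of_conj {G : Type*} [Group G] {a b : G} {k : ℕ} (h : b * a * b⁻¹ = a ^ k)
    (j : ℕ) : b ^ j * a * (b ^ j)⁻¹ = a ^ k ^ j := by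
  induction j with
  | zero => simp
  | succ j ih =>
    have : b ^ (j + 1) * a * (b ^ (j + 1))⁻¹ = b * (b ^ j * a * (b ^ j)⁻¹) * b⁻¹ := by
      rw [pow_succ']; group
    rw [this, ih, ← conj_pow, h, ← pow_mul, pow_succ']

theorem mul_pow_of_conj {G : Type*} [Group G] {a b : G} {k : ℕ} (h : b * a * b⁻¹ = a ^ k)
    (i j : ℕ) : (a ^ i * b) ^ j = a ^ (i * ∑ l ∈ Finset.range j, k ^ l) * b ^ j := by
  induction j with
  | zero => simp
  | succ j ih =>
    have h1 : b ^ j * a ^ i = a ^ (i * k ^ j) * b ^ j := by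
      have := conj_pow_eq_of_conj h j
      have h2 : b ^ j * a ^ i * (b ^ j)⁻¹ = a ^ (i * k ^ j) := by
        rw [← conj_pow, this, ← pow_mul, mul_comm]
      rw [← h2]; group
    rw [pow_succ, ih, Finset.sum_range_succ, mul_add, pow_add, pow_succ, mul_assoc, ← mul_assoc (b ^ j),
      h1]
    group

/-- A finite `q`-group, `q` odd, in which commuting elements of order `q` are dependent,
is cyclic. -/
theorem isCyclic_of_commuting_dependent (q : ℕ) (hq : q.Prime) (hodd : Odd q) (n : ℕ) :
    ∀ (Y : Type) [Group Y] [Finite Y], Nat.card Y = q ^ n →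
    (∀ u v : Y, orderOf u = q → orderOf v = q → Commute u v → v ∈ Subgroup.zpowers u) →
    IsCyclic Y := by
  have : Fact q.Prime := ⟨hq⟩
  induction n with
  | zero =>
    intro Y _ _ hY _
    have : Subsingleton Y := (Nat.card_eq_one_iff_unique.mp (by simpa using hY)).1
    infer_instance
  | succ n ih =>
    intro Y _ _ hY hdep
    rcases Nat.eq_zero_or_pos n with rfl | hn
    · exact isCyclic_of_prime_card (p := q) (by simpa using hY)
    by_contra hnc
    obtain ⟨M, hM⟩ := Sylow.exists_subgroup_card_pow_prime (G := Y) q (n := n)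
      (hY ▸ pow_dvd_pow q (Nat.le_succ n))
    have hindex : M.index = q := by
      have := M.card_mul_index
      rw [hM, hY, pow_succ] at this
      exact Nat.eq_of_mul_eq_mul_left (pow_pos hq.pos n) this
    have hMn : M.Normal := by
      apply Subgroup.normal_of_index_eq_minFac_card
      rw [hindex, hY, hq.pow_minFac (Nat.succ_ne_zero n)]
    have hMc : IsCyclic M := ih M hM (fun u v hu hv huv => by
      have := hdep u v (by simpa using hu) (by simpa using hv)
        (congrArg Subtype.val huv.eq)
      obtain ⟨j, hj⟩ := this
      exact ⟨j, Subtype.ext (by simpa using hj)⟩)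
    obtain ⟨⟨a, haM⟩, ha⟩ := hMc.exists_generator
    have hMa : M = Subgroup.zpowers a := by
      apply le_antisymm
      · intro x hx
        obtain ⟨j, hj⟩ := ha ⟨x, hx⟩
        exact ⟨j, by simpa using congrArg Subtype.val hj⟩
      · simpa using haM
    have horda : orderOf a = q ^ n := by rw [← Nat.card_zpowers, ← hMa, hM]
    obtain ⟨b, hb⟩ : ∃ b, b ∉ M := by
      by_contra! h
      have : M = ⊤ := eq_top_iff.mpr fun x _ => h x
      rw [this, Subgroup.index_top] at hindex
      exact hq.one_lt.ne hindex
    have hpowmem : ∀ x ∈ M, ∃ c : ℕ, x = a ^ c := fun x hx => by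
      rw [hMa] at hx
      obtain ⟨c, hc⟩ := mem_powers_iff_mem_zpowers.mpr hx
      exact ⟨c, hc.symm⟩
    have hbq : b ^ q ∈ M := by
      have := M.pow_index_mem (g := b)
      rwa [hindex] at this
    obtain ⟨c, hc⟩ := hpowmem _ hbq
    obtain ⟨k, hk⟩ := hpowmem _ (hMn.conj_mem a haM b)
    have hqc : q ∣ c := by
      by_contra hqc
      apply hnc
      have h1 : orderOf (b ^ q) = q ^ n := by
        rw [hc, Nat.Coprime.orderOf_pow, horda]
        rw [horda]; exact Nat.Coprime.pow_left n ((Nat.Prime.coprime_iff_not_dvd hq).mpr hqc)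
      have h2 : orderOf b = q ^ (n + 1) := by
        refine orderOf_eq_prime_pow ?_ ?_
        · intro h3
          have h4 : (b ^ q) ^ q ^ (n - 1) = 1 := by
            rw [← pow_mul, ← pow_succ', Nat.sub_add_cancel hn]; exact h3
          have := orderOf_dvd_of_pow_eq_one h4
          rw [h1] at this
          have := Nat.pow_dvd_pow_iff_le_right hq.one_lt |>.mp this
          omega
        · rw [pow_succ', pow_mul, ← h1, pow_orderOf_eq_one]
      exact isCyclic_of_orderOf_eq_card b (h2.trans hY.symm)
    obtain ⟨c', rfl⟩ := hqc
    -- `k ≡ 1` modulo `q`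
    have hk1 : (q : ℤ) ∣ (k : ℤ) - 1 := by
      have h1 := conj_pow_eq_of_conj hk q
      rw [hc] at h1
      have h2 : a ^ k ^ q = a ^ 1 := by
        rw [← h1, pow_one]; group
      rw [pow_eq_pow_iff_modEq, horda] at h2
      have h3 : k ^ q ≡ 1 [MOD q] := h2.of_dvd (dvd_pow_self q hn.ne')
      have h4 : ((k : ZMod q)) ^ q = 1 := by
        have := (ZMod.natCast_eq_natCast_iff _ _ _).mpr h3
        simpa using this
      rw [ZMod.pow_card] at h4
      rw [← ZMod.intCast_zmod_eq_zero_iff_dvd]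
      simp [h4]
    obtain ⟨m, hm⟩ := hk1
    have hkm : (k : ℤ) = 1 + q * m := by linarith
    obtain ⟨t, ht⟩ : ∃ t : ℤ, ((∑ l ∈ Finset.range q, k ^ l : ℕ) : ℤ) = q * (1 + q * t) := by
      have := odd_sq_dvd_geom_sum₂_sub (R := ℤ) (p := q) (a := 1) (b := m) hodd
      obtain ⟨t, ht⟩ := this
      refine ⟨t, ?_⟩
      push_cast
      rw [hkm]
      simp only [one_pow, mul_one] at ht
      linarith
    have hcop : IsCoprime (1 + q * t) ((q : ℤ) ^ n) := by
      apply IsCoprime.pow_right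
      exact ⟨1, -t, by ring⟩
    obtain ⟨α, β, hαβ⟩ := hcop
    -- solve for an exponent
    obtain ⟨i, hi⟩ : ∃ i : ℕ, ((q : ℤ) ^ n) ∣ (i : ℤ) + c' * α := by
      have hpos : (0 : ℤ) < (q : ℤ) ^ n := by have := hq.pos; positivity
      refine ⟨((-(c' * α)) % (q : ℤ) ^ n).toNat, ?_⟩
      rw [Int.toNat_of_nonneg (Int.emod_nonneg _ hpos.ne')]
      have := Int.emod_add_mul_ediv (-(c' * α)) ((q : ℤ) ^ n)
      exact ⟨-(-(c' * α) / (q : ℤ) ^ n), by linarith⟩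
    have hv : (a ^ i * b) ^ q = 1 := by
      rw [mul_pow_of_conj hk, hc, ← pow_add, ← orderOf_dvd_iff_pow_eq_one, horda]
      zify
      push_cast at ht
      rw [ht]
      obtain ⟨r, hr⟩ := hi
      refine ⟨q * ((1 + q * t) * r + c' * β), ?_⟩
      have : (i : ℤ) = (q : ℤ) ^ n * r - c' * α := by linarith
      rw [this]
      linear_combination (-(q : ℤ) * c') * hαβ
    have hvM : a ^ i * b ∉ M := fun h => hb ((M.mul_mem_cancel_left (pow_mem haM i)).mp h)
    have hvo : orderOf (a ^ i * b) = q :=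
      orderOf_eq_prime hv (fun h => hvM (h ▸ M.one_mem))
    have huo : orderOf (a ^ q ^ (n - 1)) = q := by
      rw [orderOf_pow_of_dvd (pow_ne_zero _ hq.ne_zero) (horda ▸ pow_dvd_pow q (Nat.sub_le n 1)), horda,
        Nat.pow_div (Nat.sub_le n 1) hq.pos]
      have : n - (n - 1) = 1 := by omega
      rw [this, pow_one]
    have hbu : Commute b (a ^ q ^ (n - 1)) := by
      have h1 : b * a ^ q ^ (n - 1) * b⁻¹ = a ^ q ^ (n - 1) := by
        rw [← conj_pow, hk, ← pow_mul, pow_eq_pow_iff_modEq, horda, Nat.modEq_iff_dvd]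
        push_cast
        refine ⟨-m, ?_⟩
        have : (q : ℤ) ^ n = q ^ (n - 1) * q := by rw [← pow_succ, Nat.sub_add_cancel hn]
        rw [this, hkm]
        ring
      exact eq_mul_inv_iff_mul_eq.mp h1.symm |>.symm
    have hcomm : Commute (a ^ q ^ (n - 1)) (a ^ i * b) :=
      ((Commute.refl a).pow_pow _ _).mul_right hbu.symm
    have := hdep _ _ huo hvo hcomm
    apply hvM
    exact (Subgroup.zpowers_le.mpr (pow_mem haM _)) this

section SylowGen

variable {G : Type*} [Group G] [Finite G] {p : ℕ}

/-- `x` generates a (cyclic) Sylow `p`-subgroup. -/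
def IsSylowGen (p : ℕ) (x : G) : Prop := orderOf x = p ^ (Nat.card G).factorization p

theorem IsSylowGen.exists_sylow [Fact p.Prime] {x : G} (hx : IsSylowGen p x) :
    ∃ X : Sylow p G, (X : Subgroup G) = Subgroup.zpowers x :=
  ⟨Sylow.ofCard (Subgroup.zpowers x) (by rw [Nat.card_zpowers, hx]), Sylow.coe_ofCard _ _⟩

theorem IsSylowGen.of_sylow [Fact p.Prime] {x : G} {X : Sylow p G}
    (h : (X : Subgroup G) = Subgroup.zpowers x) : IsSylowGen p x := by
  rw [IsSylowGen, ← Nat.card_zpowers, ← h]; exact X.card_eq_multiplicity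

omit [Finite G] in
theorem orderOf_conj (x g : G) : orderOf (g * x * g⁻¹) = orderOf x :=
  MulEquiv.orderOf_eq (MulAut.conj g) x

omit [Finite G] in
theorem IsSylowGen.conj {x : G} (hx : IsSylowGen p x) (g : G) :
    IsSylowGen p (g * x * g⁻¹) := by
  rw [IsSylowGen, orderOf_conj]; exact hx

theorem IsSylowGen.subgroup [Fact p.Prime] {H : Subgroup G} {x : H}
    (hx : IsSylowGen p (x : G)) : IsSylowGen p x := by
  have hp : p.Prime := Fact.out
  have h1 : orderOf x = p ^ (Nat.card G).factorization p := by
    rw [← Subgroup.orderOf_coe]; exact hx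
  rw [IsSylowGen, h1]
  congr 1
  apply le_antisymm
  · rw [← hp.pow_dvd_iff_le_factorization Nat.card_pos.ne', ← h1]
    exact orderOf_dvd_natCard x
  · exact (Nat.factorization_le_iff_dvd Nat.card_pos.ne' Nat.card_pos.ne').mpr
      (Subgroup.card_subgroup_dvd_card H) p

theorem IsSylowGen.exists_conj_mem [Fact p.Prime] {x : G} (hx : IsSylowGen p x)
    {L : Subgroup G} (hL : IsPGroup p L) : ∃ g : G, ∀ l ∈ L, g * l * g⁻¹ ∈ Subgroup.zpowers x := by
  obtain ⟨X, hX⟩ := hx.exists_sylow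
  obtain ⟨Q, hQ⟩ := hL.exists_le_sylow
  obtain ⟨g, hg⟩ := MulAction.exists_smul_eq G Q X
  refine ⟨g, fun l hl => ?_⟩
  rw [← hX, ← hg]
  exact Subgroup.smul_mem_pointwise_smul l (MulAut.conj g) (Q : Subgroup G) (hQ hl)

theorem IsSylowGen.exists_conj_mem_of_orderOf [Fact p.Prime] {x : G} (hx : IsSylowGen p x)
    {u : G} {n : ℕ} (hu : orderOf u = p ^ n) : ∃ g : G, g * u * g⁻¹ ∈ Subgroup.zpowers x := by
  obtain ⟨g, hg⟩ := hx.exists_conj_mem (L := Subgroup.zpowers u)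
    (IsPGroup.of_card (n := n) (by rw [Nat.card_zpowers, hu]))
  exact ⟨g, hg u (Subgroup.mem_zpowers u)⟩

omit [Finite G] in
theorem zpowers_conj_mem_iff {u v g : G} :
    g * v * g⁻¹ ∈ Subgroup.zpowers (g * u * g⁻¹) ↔ v ∈ Subgroup.zpowers u := by
  simp only [Subgroup.mem_zpowers_iff, conj_zpow, mul_left_inj, mul_right_inj]

theorem mem_zpowers_of_mem_zpowers_of_orderOf_eq (hp : p.Prime) {x u v : G}
    (hux : u ∈ Subgroup.zpowers x) (hvx : v ∈ Subgroup.zpowers x) (hu : orderOf u = p)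
    (hv : orderOf v = p) : v ∈ Subgroup.zpowers u := by
  have hpx : p ∣ orderOf x := by
    obtain ⟨j, rfl⟩ := mem_powers_iff_mem_zpowers.mpr hux
    rw [← hu]; exact orderOf_pow_dvd j
  have hx0 : 0 < orderOf x := orderOf_pos x
  set x₁ := x ^ (orderOf x / p) with hx₁
  have hox : orderOf x₁ = p := by
    rw [hx₁, orderOf_pow_of_dvd (Nat.div_pos (Nat.le_of_dvd hx0 hpx) hp.pos).ne'
      (Nat.div_dvd_of_dvd hpx), Nat.div_div_self hpx hx0.ne']
  have key : ∀ w ∈ Subgroup.zpowers x, orderOf w = p → w ∈ Subgroup.zpowers x₁ := by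
    intro w hw hwp
    obtain ⟨j, rfl⟩ := mem_powers_iff_mem_zpowers.mpr hw
    have h1 : x ^ (j * p) = 1 := by rw [pow_mul]; conv_lhs => rw [← hwp]
                                    exact pow_orderOf_eq_one _
    have h2 := orderOf_dvd_of_pow_eq_one h1
    obtain ⟨m, hm⟩ := hpx
    rw [hx₁, hm, Nat.mul_div_cancel_left m hp.pos]
    rw [hm, mul_comm, Nat.mul_dvd_mul_iff_right hp.pos] at h2
    obtain ⟨l, rfl⟩ := h2
    dsimp only
    rw [pow_mul]
    exact pow_mem (Subgroup.mem_zpowers _) l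
  have h1 := key u hux hu
  have h2 := mem_zpowers_symm_of_orderOf_eq (hu.trans hox.symm) h1
  exact (Subgroup.zpowers_le.mpr h2) (key v hvx hv)

theorem IsSylowGen.mem_zpowers_of_normalizes [Fact p.Prime] {x : G} (hx : IsSylowGen p x)
    {u v : G} (hu : orderOf u = p) (hv : orderOf v = p)
    (h : v * u * v⁻¹ ∈ Subgroup.zpowers u) : v ∈ Subgroup.zpowers u := by
  have hp : p.Prime := Fact.out
  have hnorm : Subgroup.zpowers v ≤ Subgroup.normalizer (Subgroup.zpowers u : Set G) := by
    rw [Subgroup.zpowers_le]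
    have h1 : (Subgroup.zpowers u).map (MulAut.conj v).toMonoidHom ≤ Subgroup.zpowers u := by
      rw [Subgroup.map_le_iff_le_comap, Subgroup.zpowers_le]
      exact h
    have h2 : (Subgroup.zpowers u).map (MulAut.conj v).toMonoidHom = Subgroup.zpowers u := by
      apply Subgroup.eq_of_le_of_card_ge h1
      rw [Subgroup.card_map_of_injective (MulAut.conj v).injective]
    rw [Subgroup.mem_normalizer_iff]
    intro w
    constructor
    · intro hw
      exact h1 ⟨w, hw, rfl⟩
    · intro hw
      rw [← h2] at hw
      obtain ⟨w', hw', e⟩ := hw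
      have : w' = w := (MulAut.conj v).injective e
      exact this ▸ hw'
  have hpg : ∀ w : G, orderOf w = p → IsPGroup p (Subgroup.zpowers w) := fun w hw =>
    IsPGroup.of_card (n := 1) (by rw [Nat.card_zpowers, hw, pow_one])
  obtain ⟨g, hg⟩ := hx.exists_conj_mem ((hpg u hu).to_sup_of_normal_left' (hpg v hv) hnorm)
  rw [← zpowers_conj_mem_iff (g := g)]
  apply mem_zpowers_of_mem_zpowers_of_orderOf_eq hp (x := x)
  · exact hg u (Subgroup.mem_sup_left (Subgroup.mem_zpowers u))
  · exact hg v (Subgroup.mem_sup_right (Subgroup.mem_zpowers v))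
  · rw [orderOf_conj, hu]
  · rw [orderOf_conj, hv]

theorem orderOf_pow_div (hp : p.Prime) {h : G} (hh : p ∣ orderOf h) :
    orderOf (h ^ (orderOf h / p)) = p := by
  have h0 : 0 < orderOf h := orderOf_pos h
  rw [orderOf_pow_of_dvd (Nat.div_pos (Nat.le_of_dvd h0 hh) hp.pos).ne'
      (Nat.div_dvd_of_dvd hh), Nat.div_div_self hh h0.ne']

/-- Burnside's transfer theorem for a cyclic Sylow subgroup. -/
theorem IsSylowGen.exists_transfer [Fact p.Prime] {x : G} (hx : IsSylowGen p x)
    (h : ∀ (n : G) (k : ℕ), n * x * n⁻¹ = x ^ k → k ≡ 1 [MOD p]) :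
    ∃ π : G →* Subgroup.zpowers x, Function.Surjective π ∧ ∀ g, π g = 1 ↔ ¬ p ∣ orderOf g := by
  have hp : p.Prime := Fact.out
  obtain ⟨X, hX⟩ := hx.exists_sylow
  have hcent : ∀ n : G, n * x * n⁻¹ ∈ Subgroup.zpowers x → Commute n x := by
    intro n hn
    set a := (Nat.card G).factorization p with ha
    obtain ⟨m, hpm, hm⟩ : ∃ m, ¬ p ∣ m ∧ orderOf n = p ^ (orderOf n).factorization p * m :=
      ⟨_, Nat.not_dvd_ordCompl hp (orderOf_pos n).ne', (Nat.ordProj_mul_ordCompl_eq_self _ _).symm⟩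
    set e := (orderOf n).factorization p
    have hnj : ∀ j : ℕ, ∃ k : ℕ, n ^ j * x * (n ^ j)⁻¹ = x ^ k := fun j => by
      obtain ⟨k, hk⟩ := mem_powers_iff_mem_zpowers.mpr hn
      exact ⟨k ^ j, conj_pow_eq_of_conj hk.symm j⟩
    -- the `p'`-part
    have h1 : Commute (n ^ p ^ e) x := by
      obtain ⟨k, hk⟩ := hnj (p ^ e)
      have hk1 := h _ _ hk
      have e1 := conj_pow_eq_of_conj hk m
      rw [← pow_mul, ← hm, pow_orderOf_eq_one] at e1
      have e2 : k ^ m ≡ 1 [MOD p ^ a] := by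
        rw [← hx, ← pow_eq_pow_iff_modEq, ← e1]; simp
      have e3 : k ^ p ^ a ≡ 1 [MOD p ^ a] := by
        have h3 : (p : ℤ) ∣ (k : ℤ) - 1 := by
          have := (Nat.modEq_iff_dvd.mp hk1.symm); simpa using this
        have h4 := dvd_sub_pow_of_dvd_sub h3 a
        have h5 : (p : ℤ) ^ a ∣ (k : ℤ) ^ p ^ a - 1 := by
          refine (pow_dvd_pow _ (Nat.le_succ a)).trans ?_
          simpa using h4
        refine (Nat.modEq_iff_dvd.mpr ?_).symm
        push_cast; exact h5
      have e4 : k ≡ 1 [MOD p ^ a] := by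
        rw [← ZMod.natCast_eq_natCast_iff] at e2 e3 ⊢
        push_cast at e2 e3 ⊢
        have := orderOf_dvd_of_pow_eq_one e2
        have h6 := Nat.dvd_gcd this (orderOf_dvd_of_pow_eq_one e3)
        have h7 : Nat.gcd m (p ^ a) = 1 :=
          Nat.Coprime.pow_right a ((Nat.Prime.coprime_iff_not_dvd hp).mpr hpm).symm
        rw [h7, Nat.dvd_one, orderOf_eq_one_iff] at h6
        exact h6
      have e5 : x ^ k = x := by
        conv_rhs => rw [← pow_one x]
        rw [pow_eq_pow_iff_modEq, hx]; exact e4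
      rw [e5] at hk
      exact (eq_mul_inv_iff_mul_eq.mp hk.symm).symm
    -- the `p`-part
    have h2 : Commute (n ^ m) x := by
      have hnorm : Subgroup.zpowers (n ^ m) ≤ Subgroup.normalizer (X : Set G) := by
        rw [Subgroup.zpowers_le]
        apply pow_mem
        have h1 : (Subgroup.zpowers x).map (MulAut.conj n).toMonoidHom ≤ Subgroup.zpowers x := by
          rw [Subgroup.map_le_iff_le_comap, Subgroup.zpowers_le]
          exact hn
        have h2 : (Subgroup.zpowers x).map (MulAut.conj n).toMonoidHom = Subgroup.zpowers x := by
          apply Subgroup.eq_of_le_of_card_ge h1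
          rw [Subgroup.card_map_of_injective (MulAut.conj n).injective]
        change n ∈ Subgroup.normalizer ((X : Subgroup G) : Set G)
        rw [Subgroup.mem_normalizer_iff]
        intro w
        rw [hX]
        constructor
        · intro hw
          exact h1 ⟨w, hw, rfl⟩
        · intro hw
          rw [← h2] at hw
          obtain ⟨w', hw', e⟩ := hw
          have : w' = w := (MulAut.conj n).injective e
          exact this ▸ hw'
      have hpg : IsPGroup p (Subgroup.zpowers (n ^ m)) := by
        refine IsPGroup.of_card (n := e) ?_
        rw [Nat.card_zpowers, orderOf_pow_of_dvd (by rintro rfl; simp at hpm)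
          (hm ▸ dvd_mul_left m _), hm, Nat.mul_div_cancel]
        exact Nat.pos_of_ne_zero (by rintro rfl; simp at hpm)
      have h3 : (X : Subgroup G) ⊔ Subgroup.zpowers (n ^ m) = X :=
        X.3 (IsPGroup.to_sup_of_normal_left' X.2 hpg hnorm) le_sup_left
      have h4 : n ^ m ∈ Subgroup.zpowers x := by
        rw [← hX, ← h3]; exact Subgroup.mem_sup_right (Subgroup.mem_zpowers _)
      obtain ⟨j, hj⟩ := h4
      rw [← hj]; exact (Commute.refl x).zpow_left j
    have h3 : IsCoprime ((p ^ e : ℕ) : ℤ) (m : ℤ) := by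
      rw [Nat.isCoprime_iff_coprime]
      exact Nat.Coprime.pow_left e ((Nat.Prime.coprime_iff_not_dvd hp).mpr hpm)
    obtain ⟨α, β, hαβ⟩ := h3
    have h4 : n = (n ^ p ^ e) ^ α * (n ^ m) ^ β := by
      rw [← zpow_natCast, ← zpow_natCast, ← zpow_mul, ← zpow_mul, ← zpow_add, mul_comm _ α,
        mul_comm _ β, hαβ, zpow_one]
    rw [h4]
    exact (h1.zpow_left α).mul_left (h2.zpow_left β)
  have hP : Subgroup.normalizer (X : Set G) ≤ Subgroup.centralizer (X : Set G) := by
    intro n hn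
    have hmem : x ∈ (X : Subgroup G) := hX ▸ Subgroup.mem_zpowers x
    have h1 : n * x * n⁻¹ ∈ Subgroup.zpowers x := by
      rw [← hX]; exact (Subgroup.mem_normalizer_iff.mp hn x).mp hmem
    have h2 := hcent n h1
    rw [Subgroup.mem_centralizer_iff]
    intro w hw
    have hw' : w ∈ Subgroup.zpowers x := hX ▸ hw
    obtain ⟨j, rfl⟩ := hw'
    exact (h2.zpow_right j).eq.symm
  let π := MonoidHom.transferSylow X hP
  have hcard : Nat.card π.ker * Nat.card X = Nat.card G :=
    (MonoidHom.ker_transferSylow_isComplement' X hP).card_mul_card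
  have hsurj : Function.Surjective π := by
    rw [← MonoidHom.range_eq_top]
    apply Subgroup.eq_top_of_card_eq
    have h1 := π.ker.card_mul_index
    rw [Subgroup.index_ker, ← hcard] at h1
    exact Nat.eq_of_mul_eq_mul_left Nat.card_pos h1
  have hker : ∀ g, π g = 1 ↔ ¬ p ∣ orderOf g := by
    intro g
    constructor
    · intro hg hpg
      apply MonoidHom.not_dvd_card_ker_transferSylow X hP
      refine hpg.trans ?_
      have h1 : g ∈ π.ker := hg
      have := orderOf_dvd_natCard (⟨g, h1⟩ : π.ker)
      rwa [Subgroup.orderOf_mk] at this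
    · intro hg
      rw [← orderOf_eq_one_iff]
      obtain ⟨k, hk⟩ := IsPGroup.iff_orderOf.mp X.2 (π g)
      have h1 := orderOf_map_dvd π g
      rw [hk] at h1 ⊢
      rcases Nat.eq_zero_or_pos k with rfl | hk0
      · simp
      · exact absurd ((dvd_pow_self p hk0.ne').trans h1) hg
  let f : X ≃* Subgroup.zpowers x := MulEquiv.subgroupCongr hX
  exact ⟨f.toMonoidHom.comp π, f.surjective.comp hsurj, fun g => by simp [hker]⟩

end SylowGen

section GroupAlgebra

open scoped Matrix

variable {k : Type*} [CommRing k] {G : Type*} [Group G]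

/-- Conjugation by a group element on the group algebra. -/
noncomputable def gconj (g : G) : MonoidAlgebra k G →ₐ[k] MonoidAlgebra k G :=
  MonoidAlgebra.mapDomainAlgHom k k (MulAut.conj g).toMonoidHom

theorem gconj_apply (g : G) (a : MonoidAlgebra k G) :
    gconj g a = MonoidAlgebra.of k G g * a * MonoidAlgebra.of k G g⁻¹ := by
  induction a using MonoidAlgebra.induction_linear with
  | zero => simp
  | add a b ha hb => rw [map_add, ha, hb, mul_add, add_mul]
  | single h r => simp [gconj, MonoidAlgebra.single_mul_single]

@[simp]
theorem gconj_single (g h : G) (r : k) :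
    gconj g (MonoidAlgebra.single h r) = MonoidAlgebra.single (g * h * g⁻¹) r := by
  simp [gconj]

theorem gconj_coeff (g h : G) (a : MonoidAlgebra k G) :
    (gconj g a).coeff h = a.coeff (g⁻¹ * h * g) := by
  rw [gconj_apply]
  simp [MonoidAlgebra.of_apply, MonoidAlgebra.coeff_mul_single_apply,
    MonoidAlgebra.coeff_single_mul_apply, mul_assoc]

theorem gconj_coeff_one (g : G) (a : MonoidAlgebra k G) :
    (gconj g a).coeff 1 = a.coeff 1 := by
  simp [gconj_coeff]

theorem gconj_mul (g h : G) (a : MonoidAlgebra k G) : gconj (g * h) a = gconj g (gconj h a) := by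
  induction a using MonoidAlgebra.induction_linear with
  | zero => simp
  | add a b ha hb => simp only [map_add, ha, hb]
  | single x r => simp [mul_assoc]

@[simp]
theorem gconj_one (a : MonoidAlgebra k G) : gconj 1 a = a := by
  rw [gconj_apply, inv_one, map_one, one_mul, mul_one]

theorem coeff_one_mul_comm [Fintype G] (a b : MonoidAlgebra k G) :
    (a * b).coeff 1 = (b * a).coeff 1 := by
  induction a using MonoidAlgebra.induction_linear with
  | zero => simp
  | add a a' ha hb => simp only [add_mul, mul_add, MonoidAlgebra.coeff_add, Finsupp.add_apply, ha, hb]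
  | single h r =>
    rw [MonoidAlgebra.coeff_single_mul_apply, MonoidAlgebra.coeff_mul_single_apply]
    simp [mul_comm]

theorem coeff_mul_one_eq_sum [Fintype G] (a b : MonoidAlgebra k G) :
    (a * b).coeff 1 = ∑ h, a.coeff h * b.coeff h⁻¹ := by
  rw [MonoidAlgebra.coeff_mul_apply_left, Finsupp.sum_fintype _ _ (by simp)]
  simp

/-- The coefficient form `(a, b) ↦ ∑ g, (a * g b g⁻¹)₁`. -/
noncomputable def blockForm [Fintype G] (a b : MonoidAlgebra k G) : k :=
  ∑ g : G, (a * gconj g b).coeff 1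

theorem trace_mulLeftRight_eq_blockForm [Fintype G] (a b : MonoidAlgebra k G) :
    LinearMap.trace k (MonoidAlgebra k G) (LinearMap.mulLeft k a ∘ₗ LinearMap.mulRight k b) =
      blockForm a b := by
  classical
  let B : Module.Basis G k (MonoidAlgebra k G) := ⟨MonoidAlgebra.coeffLinearEquiv k⟩
  rw [LinearMap.trace_eq_matrix_trace k B, Matrix.trace, blockForm]
  refine Finset.sum_congr rfl fun g _ => ?_
  rw [Matrix.diag_apply, LinearMap.toMatrix_apply]
  have hB : B g = MonoidAlgebra.single g 1 := rfl
  have hr : ∀ u, B.repr u g = u.coeff g := fun u => rfl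
  rw [hr, hB, gconj_apply, LinearMap.comp_apply, LinearMap.mulLeft_apply,
    LinearMap.mulRight_apply, ← mul_assoc, ← mul_assoc, ← mul_assoc, MonoidAlgebra.of_apply,
    MonoidAlgebra.of_apply, MonoidAlgebra.coeff_mul_single_apply]
  simp

theorem trace_mulLeftRight_pi_matrix {m : ℕ} {d : Fin m → ℕ}
    (M N : Π i, Matrix (Fin (d i)) (Fin (d i)) k) :
    LinearMap.trace k (Π i, Matrix (Fin (d i)) (Fin (d i)) k)
      (LinearMap.mulLeft k M ∘ₗ LinearMap.mulRight k N) =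
      ∑ i, (M i).trace * (N i).trace := by
  classical
  let B := Pi.basis fun i => Matrix.stdBasis k (Fin (d i)) (Fin (d i))
  rw [LinearMap.trace_eq_matrix_trace k B, Matrix.trace, Fintype.sum_sigma]
  refine Finset.sum_congr rfl fun i _ => ?_
  rw [Matrix.trace, Matrix.trace, Fintype.sum_prod_type, Finset.sum_mul_sum]
  refine Finset.sum_congr rfl fun s _ => Finset.sum_congr rfl fun t _ => ?_
  rw [Matrix.diag_apply, LinearMap.toMatrix_apply]
  have hrepr : ∀ L : Matrix (Fin (d i)) (Fin (d i)) k,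
      (Matrix.stdBasis k (Fin (d i)) (Fin (d i))).repr L (s, t) = L s t := fun L => by
    simp [Matrix.stdBasis]
  simp [B, Pi.basis_apply, Pi.basis_repr, Matrix.stdBasis_eq_single, hrepr, ← mul_assoc]
  rw [Matrix.mul_apply, Finset.sum_eq_single t]
  · simp
  · intro b _ hb
    rw [Matrix.mul_single_apply_of_ne (hbj := hb), zero_mul]
  · simp

theorem sum_trace_mul_trace [Fintype G] {m : ℕ} {d : Fin m → ℕ}
    (Φ : MonoidAlgebra k G ≃ₐ[k] Π i, Matrix (Fin (d i)) (Fin (d i)) k) (a b : MonoidAlgebra k G) :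
    ∑ i, (Φ a i).trace * (Φ b i).trace = blockForm a b := by
  rw [← trace_mulLeftRight_pi_matrix, ← trace_mulLeftRight_eq_blockForm,
    ← LinearMap.trace_conj' _ Φ.toLinearEquiv]
  congr 1
  refine LinearMap.ext fun u => ?_
  simp [LinearEquiv.conj_apply]

end GroupAlgebra

theorem Matrix.exists_nat_trace_of_isIdempotentElem {k : Type*} [Field k] [CharZero k] {n : Type*}
    [Fintype n] [DecidableEq n] {M : Matrix n n k} (h : M * M = M) :
    ∃ a : ℕ, M.trace = a ∧ (a = 0 → M = 0) := by
  have h1 : IsIdempotentElem (Matrix.toLin' M) := by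
    rw [IsIdempotentElem, Module.End.mul_eq_comp, ← Matrix.toLin'_mul, h]
  refine ⟨Module.finrank k (LinearMap.range (Matrix.toLin' M)), ?_, fun h0 => ?_⟩
  · rw [← Matrix.trace_toLin'_eq]
    exact (LinearMap.IsIdempotentElem.isProj_range _ h1).trace
  · rw [Submodule.finrank_eq_zero, LinearMap.range_eq_bot] at h0
    exact Matrix.toLin'.map_eq_zero_iff.mp h0

section Lifting

open Polynomial

theorem exists_valuationSubring (K : Type*) [Field K] [CharZero K] (q : ℕ) [Fact q.Prime] :
    ∃ A : ValuationSubring K, (q : A) ∈ IsLocalRing.maximalIdeal A := by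
  have hq : q.Prime := Fact.out
  let Z : Subring K := (algebraMap ℤ K).range
  let z : Z := ⟨q, q, by simp⟩
  have hz : Ideal.span {z} ≠ ⊤ := by
    rw [Ne, Ideal.span_singleton_eq_top, isUnit_iff_exists_inv]
    rintro ⟨⟨_, w, rfl⟩, hw⟩
    have h1 : ((q * w : ℤ) : K) = (1 : ℤ) := by
      have := congrArg Subtype.val hw
      simpa [z] using this
    have h2 := Int.cast_injective h1
    have h3 : (q : ℤ) ∣ 1 := ⟨w, h2.symm⟩
    have := Int.natCast_dvd_natCast.mp (by simpa using h3 : (q : ℤ) ∣ (1 : ℕ))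
    exact hq.one_lt.ne' (Nat.dvd_one.mp this)
  obtain ⟨V, -, hV⟩ := Ideal.image_subset_nonunits_valuationSubring _ hz
  refine ⟨V, ?_⟩
  have h1 : (q : K) ∈ V.nonunits := hV ⟨z, Ideal.mem_span_singleton_self z, rfl⟩
  rw [← SetLike.mem_coe, ← V.image_maximalIdeal] at h1
  obtain ⟨a, ha, e⟩ := h1
  have : a = (q : V) := Subtype.ext (by simpa using e)
  exact this ▸ ha

theorem ValuationSubring.splits_of_monic {K : Type*} [Field K] [IsAlgClosed K]
    (A : ValuationSubring K) (P : A[X]) (hP : P.Monic) :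
    ∃ m : Multiset A, P = (m.map fun r => X - C r).prod := by
  have h1 := (IsAlgClosed.splits (P.map (algebraMap A K))).eq_prod_roots_of_monic (hP.map _)
  have h2 : ∀ r ∈ (P.map (algebraMap A K)).roots, ∃ a : A, algebraMap A K a = r := by
    intro r hr
    apply IsIntegrallyClosed.isIntegral_iff.mp
    refine ⟨P, hP, ?_⟩
    have := (Polynomial.mem_roots'.mp hr).2
    rwa [IsRoot, eval_map] at this
  obtain ⟨m, hm⟩ : ∃ m : Multiset A, m.map (algebraMap A K) = (P.map (algebraMap A K)).roots := by
    choose! f hf using h2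
    refine ⟨(P.map (algebraMap A K)).roots.map f, ?_⟩
    rw [Multiset.map_map]
    conv_rhs => rw [← Multiset.map_id (P.map (algebraMap A K)).roots]
    exact Multiset.map_congr rfl fun x hx => hf x hx
  refine ⟨m, Polynomial.map_injective _ (IsFractionRing.injective A K) ?_⟩
  rw [h1, ← hm, Polynomial.map_multiset_prod, Multiset.map_map, Multiset.map_map]
  simp [Function.comp_def]

theorem ValuationSubring.isAlgClosed_residueField {K : Type*} [Field K] [IsAlgClosed K]
    (A : ValuationSubring K) : IsAlgClosed (IsLocalRing.ResidueField A) := by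
  refine IsAlgClosed.of_exists_root _ fun P hP hirr => ?_
  obtain ⟨Q, hQ, hdeg, hQm⟩ := Polynomial.lifts_and_degree_eq_and_monic
    (Polynomial.map_surjective _ IsLocalRing.residue_surjective P) hP
  obtain ⟨m, hm⟩ := A.splits_of_monic Q hQm
  have : m ≠ 0 := by
    rintro rfl
    rw [Multiset.map_zero, Multiset.prod_zero] at hm
    rw [hm, Polynomial.map_one] at hQ
    exact hirr.ne_one hQ.symm
  obtain ⟨r, hr⟩ := Multiset.exists_mem_of_ne_zero this
  refine ⟨IsLocalRing.residue A r, ?_⟩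
  rw [← hQ, eval_map, eval₂_hom, hm, eval_multiset_prod]
  rw [Multiset.prod_eq_zero, map_zero]
  rw [Multiset.map_map]
  exact Multiset.mem_map.mpr ⟨r, hr, by simp⟩

variable {A : Type*} [CommRing A] [IsLocalRing A]

theorem exists_idempotent_of_not_isNilpotent
    (hs : ∀ P : A[X], P.Monic → ∃ m : Multiset A, P = (m.map fun r => X - C r).prod)
    {R : Type*} [Ring R] [Algebra A R] {v : R} (hv : IsIntegral A v)
    {R' : Type*} [Ring R'] (ρ : R →+* R')
    (hρ : ∀ a ∈ IsLocalRing.maximalIdeal A, ρ (algebraMap A R a) = 0)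
    (hn : ¬ IsNilpotent (ρ v)) :
    ∃ S : A[X], (aeval v S * v) * (aeval v S * v) = aeval v S * v ∧ aeval v S * v ≠ 0 := by
  classical
  obtain ⟨P, hP, hPv⟩ := hv
  obtain ⟨m, hm⟩ := hs P hP
  set m₀ := m.filter (· ∈ IsLocalRing.maximalIdeal A)
  set m₁ := m.filter (¬ · ∈ IsLocalRing.maximalIdeal A)
  set P₀ := (m₀.map fun r => X - C r).prod with hP₀
  set P₁ := (m₁.map fun r => X - C r).prod with hP₁
  have hPP : P = P₀ * P₁ := by
    rw [hm, hP₀, hP₁, ← Multiset.prod_add, ← Multiset.map_add, Multiset.filter_add_not]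
  have hcop1 : ∀ a b : A, a ∈ IsLocalRing.maximalIdeal A → b ∉ IsLocalRing.maximalIdeal A →
      IsCoprime (X - C a) (X - C b) := by
    intro a b ha hb
    have hu : IsUnit (b - a) := by
      by_contra hu
      have h1 : b - a ∈ IsLocalRing.maximalIdeal A := hu
      exact hb (by simpa using add_mem h1 ha)
    obtain ⟨u, hu⟩ := hu
    refine ⟨C (↑u⁻¹ : A), - C (↑u⁻¹ : A), ?_⟩
    have : C (↑u⁻¹ : A) * (C b - C a) = 1 := by
      rw [← C_sub, ← hu, ← C_mul]; simp
    linear_combination this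
  have hcop2 : ∀ (a : A) (s : Multiset A), a ∈ IsLocalRing.maximalIdeal A →
      (∀ b ∈ s, b ∉ IsLocalRing.maximalIdeal A) →
      IsCoprime (X - C a) (s.map fun r => X - C r).prod := by
    intro a s ha
    induction s using Multiset.induction_on with
    | empty => intro; simpa using isCoprime_one_right
    | cons b s ih =>
      intro h
      rw [Multiset.map_cons, Multiset.prod_cons]
      exact (hcop1 a b ha (h b (Multiset.mem_cons_self b s))).mul_right
        (ih fun c hc => h c (Multiset.mem_cons_of_mem hc))
  have hcop3 : ∀ s : Multiset A, (∀ a ∈ s, a ∈ IsLocalRing.maximalIdeal A) →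
      IsCoprime (s.map fun r => X - C r).prod P₁ := by
    intro s
    induction s using Multiset.induction_on with
    | empty => intro; simpa using isCoprime_one_left
    | cons b s ih =>
      intro h
      rw [Multiset.map_cons, Multiset.prod_cons]
      exact (hcop2 b m₁ (h b (Multiset.mem_cons_self b s))
        fun c hc => (Multiset.mem_filter.mp hc).2).mul_left
        (ih fun c hc => h c (Multiset.mem_cons_of_mem hc))
  have hcop : IsCoprime (X * P₀) P₁ := by
    have := hcop3 (0 ::ₘ m₀) (by
      intro a ha
      rcases Multiset.mem_cons.mp ha with rfl | ha
      · exact zero_mem _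
      · exact (Multiset.mem_filter.mp ha).2)
    simpa using this
  obtain ⟨α, β, hαβ⟩ := hcop
  have hPv0 : aeval v P = 0 := hPv
  have hXP : aeval v (α * P₀) * v = aeval v (α * (X * P₀)) := by
    rw [← mul_assoc, mul_comm α X, mul_assoc, mul_comm X, map_mul _ _ X, aeval_X]
  refine ⟨α * P₀, ?_, ?_⟩
  · rw [hXP, ← map_mul]
    have h2 : α * (X * P₀) * (α * (X * P₀)) = α * (X * P₀) - α * X * β * P := by
      rw [hPP]; linear_combination (α * (X * P₀)) * hαβ
    rw [h2, map_sub, map_mul _ _ P, hPv0, mul_zero, sub_zero]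
  · rw [hXP]
    intro h0
    apply hn
    have h3 : aeval v (X * P₀) = 0 := by
      have : X * P₀ = α * (X * P₀) * (X * P₀) + β * X * P := by
        rw [hPP]; linear_combination (-(X * P₀)) * hαβ
      rw [this, map_add, map_mul _ (α * _), h0, zero_mul, map_mul _ _ P, hPv0, mul_zero, add_zero]
    have h4 : ∀ s : Multiset A, (∀ a ∈ s, a ∈ IsLocalRing.maximalIdeal A) →
        ρ (aeval v (s.map fun r => X - C r).prod) = ρ v ^ (Multiset.card s) := by
      intro s
      induction s using Multiset.induction_on with
      | empty => intro; simp
      | cons b s ih =>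
        intro h
        rw [Multiset.map_cons, Multiset.prod_cons, map_mul, map_mul,
          ih fun c hc => h c (Multiset.mem_cons_of_mem hc), Multiset.card_cons, map_sub, aeval_X,
          aeval_C, map_sub, hρ b (h b (Multiset.mem_cons_self b s)), sub_zero, pow_succ']
    refine ⟨Multiset.card m₀ + 1, ?_⟩
    rw [pow_succ', ← h4 m₀ fun a ha => (Multiset.mem_filter.mp ha).2, ← map_mul, ← hP₀]
    rw [map_mul, aeval_X] at h3
    rw [h3, map_zero]

end Lifting

section Primitive

open Polynomial

theorem exists_not_isNilpotent_mul_idempotent {R : Type*} [Ring R] [IsArtinianRing R] {x : R}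
    (hx : ¬ IsNilpotent x) {L : Type*} [Fintype L] (e : L → R) (he : ∑ l, e l = 1) :
    ∃ l y, ¬ IsNilpotent (y * (x * e l)) := by
  by_contra! h
  apply hx
  obtain ⟨n, hn⟩ := IsArtinianRing.isNilpotent_jacobson_bot (R := R)
  refine ⟨n, ?_⟩
  have hmem : x ∈ Ideal.jacobson (⊥ : Ideal R) := by
    rw [← mul_one x, ← he, Finset.mul_sum]
    refine sum_mem fun l _ => ?_
    rw [Ideal.mem_jacobson_iff]
    intro y
    obtain ⟨u, hu⟩ := (h l y).isUnit_one_add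
    refine ⟨↑u⁻¹, ?_⟩
    rw [Ideal.mem_bot, mul_assoc, sub_eq_zero]
    calc ↑u⁻¹ * (y * (x * e l)) + ↑u⁻¹ = ↑u⁻¹ * (1 + y * (x * e l)) := by rw [mul_add, mul_one, add_comm]
      _ = 1 := by rw [← hu]; simp
  have := Ideal.pow_mem_pow hmem n
  rw [hn] at this
  exact this

theorem exists_sum_primitive_eq_one (k : Type*) [Field k] [IsAlgClosed k] (C : Type*) [Group C]
    [Finite C] (h : (Nat.card C : k) ≠ 0) :
    ∃ (L : Type) (_ : Fintype L) (e : L → MonoidAlgebra k C), ∑ l, e l = 1 ∧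
      (∀ l, e l * e l = e l) ∧ ∀ l a, ∃ r : k, e l * a * e l = r • e l := by
  classical
  have : Fintype C := Fintype.ofFinite C
  have : NeZero (Nat.card C : k) := ⟨h⟩
  obtain ⟨m, d, -, ⟨Φ⟩⟩ := IsSemisimpleRing.exists_algEquiv_pi_matrix_of_isAlgClosed
    (F := k) (R := MonoidAlgebra k C)
  have key : ∀ (i : Fin m) (s : Fin (d i)) (a : Π i, Matrix (Fin (d i)) (Fin (d i)) k),
      Pi.single i (Matrix.single s s 1) * a * Pi.single i (Matrix.single s s 1) =
        (a i s s) • (Pi.single i (Matrix.single s s 1) :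
          Π i, Matrix (Fin (d i)) (Fin (d i)) k) := by
    intro i s a
    funext j
    by_cases hj : j = i
    · subst hj
      simp
    · simp [Pi.single_eq_of_ne hj]
  refine ⟨Σ i, Fin (d i), inferInstance,
    fun l => Φ.symm (Pi.single l.1 (Matrix.single l.2 l.2 1)), ?_, fun l => ?_, fun l a => ?_⟩
  · rw [← map_sum, ← map_one Φ.symm]
    congr 1
    rw [Fintype.sum_sigma]
    funext j
    rw [Finset.sum_apply, Finset.sum_eq_single j]
    · simp only [Finset.sum_apply, Pi.single_eq_same, Pi.one_apply]
      ext s t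
      simp [Matrix.sum_apply, Matrix.single_apply, Matrix.one_apply, ite_and]
    · intro i _ hi
      simp [Pi.single_eq_of_ne hi.symm]
    · simp
  · rw [← map_mul, ← Pi.single_mul]; simp
  · refine ⟨Φ a l.1 l.2 l.2, Φ.injective ?_⟩
    simp only [map_mul, map_smul, AlgEquiv.apply_symm_apply]
    exact key _ _ _

variable {A : Type*} [CommRing A] [IsLocalRing A]

theorem peirce_eq_zero {R : Type*} [Ring R] [Algebra A R] [Module.Finite A R] {e f : R}
    (he : e * e = e) (hf : f * f = f)
    (h : ∀ a, e * a * f ∈ IsLocalRing.maximalIdeal A • (⊤ : Submodule A R)) (a : R) :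
    e * a * f = 0 := by
  let T : R →ₗ[A] R := LinearMap.mulRight A f ∘ₗ LinearMap.mulLeft A e
  have hT : ∀ a, T a = e * a * f := fun a => rfl
  have hN : LinearMap.range T = ⊥ := by
    refine Submodule.eq_bot_of_le_smul_of_le_jacobson_bot (IsLocalRing.maximalIdeal A) _
      (by rw [LinearMap.range_eq_map]; exact Module.Finite.fg_top.map T) ?_
      (IsLocalRing.maximalIdeal_le_jacobson _)
    rintro _ ⟨a, rfl⟩
    have h1 : T a = T (e * a * f) := by
      rw [hT, hT]
      calc e * a * f = (e * e) * a * (f * f) := by rw [he, hf]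
        _ = _ := by noncomm_ring
    rw [h1, LinearMap.range_eq_map, ← Submodule.map_smul'']
    exact Submodule.mem_map_of_mem (h a)
  have : T a ∈ LinearMap.range T := ⟨a, rfl⟩
  rwa [hN, Submodule.mem_bot] at this

theorem eq_zero_of_mem_smul_top {R : Type*} [Ring R] [Algebra A R] [Module.Finite A R] {f : R}
    (hf : f * f = f) (h : f ∈ IsLocalRing.maximalIdeal A • (⊤ : Submodule A R)) : f = 0 := by
  have := peirce_eq_zero (A := A) hf hf (fun a => ?_) 1
  · rwa [mul_one, hf] at this
  · have h1 := Submodule.mem_map_of_mem (f := LinearMap.mulLeft A (f * a)) h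
    rw [Submodule.map_smul''] at h1
    exact Submodule.smul_mono le_rfl le_top h1

theorem exists_smul_of_residue {R : Type*} [Ring R] [Algebra A R] [Module.Finite A R] {i : R}
    (hi : i * i = i)
    (h : ∀ a, ∃ r : A, i * a * i - r • i ∈ IsLocalRing.maximalIdeal A • (⊤ : Submodule A R))
    (a : R) : ∃ r : A, i * a * i = r • i := by
  let T : R →ₗ[A] R := LinearMap.mulRight A i ∘ₗ LinearMap.mulLeft A i
  have hT : ∀ a, T a = i * a * i := fun a => rfl
  have hN : LinearMap.range T ≤ Submodule.span A {i} := by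
    refine Submodule.le_of_le_smul_of_le_jacobson_bot (I := IsLocalRing.maximalIdeal A)
      (by rw [LinearMap.range_eq_map]; exact Module.Finite.fg_top.map T)
      (IsLocalRing.maximalIdeal_le_jacobson _) ?_
    rintro _ ⟨a, rfl⟩
    obtain ⟨r, hr⟩ := h a
    have h1 : T a = r • i + T (i * a * i - r • i) := by
      rw [hT, hT, mul_sub, sub_mul, mul_smul_comm, smul_mul_assoc, hi, hi]
      have : i * (i * a * i) * i = (i * i) * a * (i * i) := by noncomm_ring
      rw [this, hi]; abel
    rw [h1]
    refine Submodule.add_mem_sup (Submodule.smul_mem _ _ (Submodule.mem_span_singleton_self i)) ?_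
    rw [LinearMap.range_eq_map, ← Submodule.map_smul'']
    exact Submodule.mem_map_of_mem hr
  obtain ⟨r, hr⟩ := Submodule.mem_span_singleton.mp (hN ⟨a, rfl⟩)
  exact ⟨r, hr.symm⟩

/-- Reduction of a group algebra modulo the maximal ideal. -/
noncomputable abbrev residueMap (A : Type*) [CommRing A] [IsLocalRing A] (G : Type*) [Group G] :
    MonoidAlgebra A G →+* MonoidAlgebra (IsLocalRing.ResidueField A) G :=
  MonoidAlgebra.mapRingHom G (IsLocalRing.residue A)

theorem residueMap_coeff {G : Type*} [Group G] (a : MonoidAlgebra A G) (g : G) :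
    (residueMap A G a).coeff g = IsLocalRing.residue A (a.coeff g) := by
  simp

theorem residueMap_surjective {G : Type*} [Group G] : Function.Surjective (residueMap A G) := by
  intro b
  induction b using MonoidAlgebra.induction_linear with
  | zero => exact ⟨0, map_zero _⟩
  | add a b ha hb =>
    obtain ⟨a, rfl⟩ := ha
    obtain ⟨b, rfl⟩ := hb
    exact ⟨a + b, map_add _ _ _⟩
  | single g r =>
    obtain ⟨r, rfl⟩ := IsLocalRing.residue_surjective r
    exact ⟨MonoidAlgebra.single g r, by simp⟩

theorem mem_smul_top_of_residueMap_eq_zero {G : Type*} [Group G] [Finite G] {a : MonoidAlgebra A G}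
    (h : residueMap A G a = 0) :
    a ∈ IsLocalRing.maximalIdeal A • (⊤ : Submodule A (MonoidAlgebra A G)) := by
  rw [← MonoidAlgebra.sum_coeff_single a]
  refine sum_mem fun g _ => ?_
  have : MonoidAlgebra.single g (a.coeff g) = (a.coeff g) • MonoidAlgebra.single g (1 : A) := by
    simp
  rw [this]
  refine Submodule.smul_mem_smul ?_ trivial
  rw [← IsLocalRing.residue_eq_zero_iff, ← residueMap_coeff, h]; rfl

theorem residueMap_algebraMap {G : Type*} [Group G] {a : A} (ha : a ∈ IsLocalRing.maximalIdeal A) :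
    residueMap A G (algebraMap A _ a) = 0 := by
  rw [← IsLocalRing.residue_eq_zero_iff] at ha
  simp [MonoidAlgebra.coe_algebraMap, ha]

theorem exists_primitive_lift {H : Type*} [Group H] [Finite H]
    (hs : ∀ P : A[X], P.Monic → ∃ m : Multiset A, P = (m.map fun r => X - C r).prod)
    {i' : MonoidAlgebra (IsLocalRing.ResidueField A) H} (hi' : i' * i' = i') (hi0 : i' ≠ 0)
    (hprim : ∀ a, ∃ r : IsLocalRing.ResidueField A, i' * a * i' = r • i') :
    ∃ i : MonoidAlgebra A H, residueMap A H i = i' ∧ i * i = i ∧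
      ∀ a, ∃ r : A, i * a * i = r • i := by
  obtain ⟨v, hv⟩ := residueMap_surjective i'
  obtain ⟨S, hS, hS0⟩ := exists_idempotent_of_not_isNilpotent hs (v := v)
    (Algebra.IsIntegral.isIntegral v) (residueMap A H) (fun a ha => residueMap_algebraMap ha) (by
      rintro ⟨n, hn⟩
      rw [hv] at hn
      have : IsIdempotentElem i' := hi'
      rcases n with - | n
      · apply hi0
        rw [← mul_one i', ← pow_zero i', hn, mul_zero]
      · rw [this.pow_succ_eq] at hn
        exact hi0 hn)
  set i := aeval v S * v with hi
  have hcomm : Commute (aeval v S) v := by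
    have := congrArg (aeval v) (mul_comm S X)
    rwa [map_mul, map_mul, aeval_X] at this
  obtain ⟨r, hr⟩ := hprim (residueMap A H (aeval v S))
  have hri : residueMap A H i = r • i' := by
    have h1 := hcomm.map (residueMap A H)
    rw [hv] at h1
    rw [← hr, ← h1.eq, mul_assoc, hi', hi, map_mul, hv]
  have hr2 : r = 0 ∨ r = 1 := by
    have h1 : (r * r) • i' = r • i' := by
      rw [← hri]
      conv_rhs => rw [← hS, map_mul, hri, smul_mul_smul_comm, hi']
    have h2 : r * r = r := smul_left_injective _ hi0 h1
    by_cases h0 : r = 0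
    · exact Or.inl h0
    · exact Or.inr (mul_left_cancel₀ h0 (by rw [h2, mul_one]))
  have hr1 : residueMap A H i = i' := by
    rcases hr2 with rfl | rfl
    · refine absurd (eq_zero_of_mem_smul_top hS (mem_smul_top_of_residueMap_eq_zero ?_)) hS0
      rw [hri, zero_smul]
    · rw [hri, one_smul]
  refine ⟨i, hr1, hS, exists_smul_of_residue hS fun a => ?_⟩
  obtain ⟨t, ht⟩ := hprim (residueMap A H a)
  obtain ⟨t, rfl⟩ := IsLocalRing.residue_surjective t
  refine ⟨t, mem_smul_top_of_residueMap_eq_zero ?_⟩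
  have : residueMap A H (t • i) = IsLocalRing.residue A t • i' := by
    rw [← hr1]
    ext g
    simp
  rw [map_sub, map_mul, map_mul, hr1, ht, this, sub_self]

end Primitive

section Incl

/-- The inclusion of the group algebra of a subgroup. -/
noncomputable abbrev incl (k : Type*) [CommRing k] {G : Type*} [Group G] (C : Subgroup G) :
    MonoidAlgebra k C →ₐ[k] MonoidAlgebra k G :=
  MonoidAlgebra.mapDomainAlgHom k k C.subtype

/-- The sum of the first `n` powers of a group element in a group algebra. -/
noncomputable def powSum (k : Type*) [CommRing k] {G : Type*} [Group G] (x : G) (n : ℕ) :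
    MonoidAlgebra k G := ∑ j ∈ Finset.range n, MonoidAlgebra.of k G (x ^ j)

theorem mapRingHom_powSum {k k' : Type*} [CommRing k] [CommRing k'] (φ : k →+* k') {G : Type*}
    [Group G] (x : G) (n : ℕ) : MonoidAlgebra.mapRingHom G φ (powSum k x n) = powSum k' x n := by
  simp [powSum, map_sum]

theorem of_mul_powSum {k : Type*} [CommRing k] {G : Type*} [Group G] {x : G} {n : ℕ}
    (hx : x ^ n = 1) : MonoidAlgebra.of k G x * powSum k x n = powSum k x n := by
  rw [powSum, Finset.mul_sum]
  have h := Finset.sum_range_succ' (fun j => MonoidAlgebra.of k G (x ^ j)) n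
  rw [Finset.sum_range_succ, hx, pow_zero, add_left_inj] at h
  rw [h]
  refine Finset.sum_congr rfl fun j _ => ?_
  rw [← map_mul, pow_succ']

theorem powSum_mul_powSum {k : Type*} [CommRing k] {G : Type*} [Group G] {x : G} {n : ℕ}
    (hx : x ^ n = 1) : powSum k x n * powSum k x n = (n : k) • powSum k x n := by
  have h : ∀ j, MonoidAlgebra.of k G (x ^ j) * powSum k x n = powSum k x n := by
    intro j
    induction j with
    | zero => rw [pow_zero, map_one, one_mul]
    | succ j ih => rw [pow_succ, map_mul, mul_assoc, of_mul_powSum hx, ih]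
  have h2 : powSum k x n * powSum k x n =
      ∑ j ∈ Finset.range n, MonoidAlgebra.of k G (x ^ j) * powSum k x n := by
    rw [← Finset.sum_mul]; rfl
  rw [h2, Finset.sum_congr rfl fun j _ => h j, Finset.sum_const, Finset.card_range, Nat.cast_smul_eq_nsmul]

theorem mul_mul_eq_zero_of_of {k : Type*} [CommRing k] {G : Type*} [Group G]
    {x u : MonoidAlgebra k G} (h : ∀ g, x * MonoidAlgebra.of k G g * u = 0) (a) : x * a * u = 0 := by
  induction a using MonoidAlgebra.induction_linear with
  | zero => simp
  | add a b ha hb => rw [mul_add, add_mul, ha, hb, add_zero]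
  | single g r =>
    have : MonoidAlgebra.single g r = r • MonoidAlgebra.of k G g := by simp
    rw [this, mul_smul_comm, smul_mul_assoc, h, smul_zero]

theorem isNilpotent_mul_comm' {R : Type*} [Ring R] {a b : R} (h : IsNilpotent (a * b)) :
    IsNilpotent (b * a) := by
  obtain ⟨n, hn⟩ := h
  refine ⟨n + 1, ?_⟩
  have : ∀ n, (b * a) ^ (n + 1) = b * (a * b) ^ n * a := by
    intro n
    induction n with
    | zero => simp
    | succ n ih => rw [pow_succ, ih, pow_succ (a * b)]; simp only [mul_assoc]
  rw [this, hn]; simp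

theorem exists_primitive_and_idempotent {K : Type*} [Field K] [IsAlgClosed K]
    (A : ValuationSubring K) {q : ℕ} [Fact q.Prime]
    (hqA : (q : A) ∈ IsLocalRing.maximalIdeal A) {G : Type*} [Group G] [Finite G]
    (C : Subgroup G) (hC : ¬ q ∣ Nat.card C) {x : G} {p : ℕ} (hx : x ^ p = 1)
    (hpA : IsUnit (p : A)) {u : MonoidAlgebra (ZMod q) G} (hu : ¬ IsNilpotent u)
    (hxu : ∀ g, powSum (ZMod q) x p * MonoidAlgebra.of (ZMod q) G g * u = 0) :
    ∃ (i : MonoidAlgebra A C) (f : MonoidAlgebra A G), i * i = i ∧ (∃ c, IsUnit (i.coeff c)) ∧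
      (∀ a, ∃ r : A, i * a * i = r • i) ∧ f * f = f ∧ f ≠ 0 ∧ incl A C i * f = f ∧
      f * incl A C i = f ∧ ∀ a, powSum A x p * a * f = 0 := by
  classical
  set κ := IsLocalRing.ResidueField A
  have : IsAlgClosed κ := ValuationSubring.isAlgClosed_residueField A
  have hq0 : (q : κ) = 0 := by
    rw [← IsLocalRing.residue_eq_zero_iff] at hqA
    rwa [map_natCast] at hqA
  have : CharP κ q := by
    rw [← CharP.ringChar_of_prime_eq_zero Fact.out hq0]
    exact ringChar.charP κ
  set θ : ZMod q →+* κ := ZMod.castHom dvd_rfl κ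
  set u' := MonoidAlgebra.mapRingHom G θ u with hu'
  have hu'n : ¬ IsNilpotent u' := by
    rw [hu', IsNilpotent.map_iff]
    · exact hu
    · intro a b hab
      ext g
      have := congrArg (fun z => z.coeff g) hab
      simp only [MonoidAlgebra.coeff_mapRingHom] at this
      exact θ.injective this
  have hxu' : ∀ a, powSum κ x p * a * u' = 0 := by
    refine mul_mul_eq_zero_of_of fun g => ?_
    have := congrArg (MonoidAlgebra.mapRingHom G θ) (hxu g)
    rw [map_mul, map_mul, mapRingHom_powSum, map_zero] at this
    simpa using this
  have : IsArtinianRing (MonoidAlgebra κ G) := IsArtinianRing.of_finite κ _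
  obtain ⟨L, _, e, he1, hee, hep⟩ := exists_sum_primitive_eq_one κ C (by
    rw [Ne, CharP.cast_eq_zero_iff κ q]; exact hC)
  obtain ⟨l, y, hl⟩ := exists_not_isNilpotent_mul_idempotent hu'n (fun l => incl κ C (e l))
    (by rw [← map_sum, he1, map_one])
  have hel : e l ≠ 0 := by
    intro h
    apply hl
    rw [h]; simp
  obtain ⟨i, hi1, hi2, hi3⟩ := exists_primitive_lift
    (fun P hP => ValuationSubring.splits_of_monic A P hP) (hee l) hel (hep l)
  have hres : residueMap A G (incl A C i) = incl κ C (e l) := by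
    rw [← hi1]
    generalize i = a
    induction a using MonoidAlgebra.induction_linear with
    | zero => simp
    | add a b ha hb => rw [map_add, map_add, map_add, map_add, ha, hb]
    | single g r => simp
  have hinc : incl A C i * incl A C i = incl A C i := by rw [← map_mul, hi2]
  have hinc' : incl κ C (e l) * incl κ C (e l) = incl κ C (e l) := by rw [← map_mul, hee]
  obtain ⟨w, hw⟩ := residueMap_surjective (A := A) (y * u')
  set v := incl A C i * w * incl A C i with hv
  have hrv : residueMap A G v = incl κ C (e l) * y * (u' * incl κ C (e l)) := by
    rw [hv, map_mul, map_mul, hres, hw]; simp only [mul_assoc]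
  obtain ⟨s, hs, hs0⟩ := exists_idempotent_of_not_isNilpotent
    (fun P hP => ValuationSubring.splits_of_monic A P hP) (v := v)
    (Algebra.IsIntegral.isIntegral v) (residueMap A G) (fun a ha => residueMap_algebraMap ha) (by
      rw [hrv, mul_assoc]
      intro h
      apply hl
      have := isNilpotent_mul_comm' h
      rwa [mul_assoc, mul_assoc, hinc'] at this)
  set f := Polynomial.aeval v s * v with hf
  have hcomm : f = v * Polynomial.aeval v s := by
    have := congrArg (Polynomial.aeval v) (mul_comm s Polynomial.X)
    rwa [map_mul, map_mul, Polynomial.aeval_X] at this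
  refine ⟨i, f, hi2, ?_, hi3, hs, hs0, ?_, ?_, ?_⟩
  · by_contra! h
    apply hel
    rw [← hi1]
    ext c
    rw [residueMap_coeff, (IsLocalRing.residue_eq_zero_iff _).mpr (h c)]
    rfl
  · rw [hcomm, hv]; simp only [← mul_assoc]; rw [hinc]
  · rw [hf, hv]; simp only [mul_assoc]; rw [hinc]
  · obtain ⟨b, hb⟩ := hpA.exists_left_inv
    have hid : (b • powSum A x p) * (b • powSum A x p) = b • powSum A x p := by
      rw [smul_mul_smul_comm, powSum_mul_powSum hx, smul_smul, mul_assoc, hb, mul_one]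
    intro a
    have hz := peirce_eq_zero (A := A) hid hs (fun a => by
      refine mem_smul_top_of_residueMap_eq_zero ?_
      rw [smul_mul_assoc, smul_mul_assoc, Algebra.smul_def, map_mul, map_mul, map_mul, hf,
        map_mul _ _ v, hrv, mapRingHom_powSum]
      have := hxu' (residueMap A G a * residueMap A G (Polynomial.aeval v s) *
        (incl κ C (e l) * y))
      have h2 : powSum κ x p * residueMap A G a * (residueMap A G (Polynomial.aeval v s) *
        (incl κ C (e l) * y * (u' * incl κ C (e l)))) = (powSum κ x p *
        (residueMap A G a * residueMap A G (Polynomial.aeval v s) *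
        (incl κ C (e l) * y)) * u') * incl κ C (e l) := by
        simp only [mul_assoc]
      rw [h2, this, zero_mul, mul_zero]) a
    calc powSum A x p * a * f = (b * (p : A)) • (powSum A x p * a * f) := by rw [hb, one_smul]
      _ = (p : A) • (b • powSum A x p * a * f) := by
        rw [mul_comm, mul_smul, smul_mul_assoc, smul_mul_assoc]
      _ = 0 := by rw [hz, smul_zero]

end Incl

section Blocks

variable {k : Type*} [Field k] {H : Type*} [Group H]

/-- Twisting a group algebra by a linear character. -/
noncomputable def twistHom (χ : H →* kˣ) : MonoidAlgebra k H →ₐ[k] MonoidAlgebra k H :=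
  MonoidAlgebra.lift k _ H
    { toFun := fun h => (χ h : k) • MonoidAlgebra.of k H h
      map_one' := by simp [MonoidAlgebra.one_def]
      map_mul' := fun a b => by
        rw [map_mul, map_mul, Units.val_mul, smul_mul_smul_comm] }

theorem twistHom_single (χ : H →* kˣ) (h : H) (r : k) :
    twistHom χ (MonoidAlgebra.single h r) = MonoidAlgebra.single h (χ h * r) := by
  simp [twistHom, mul_comm]

/-- The action of linear characters on a group algebra by twisting. -/
noncomputable def twist : (H →* kˣ) →* (MonoidAlgebra k H ≃ₐ[k] MonoidAlgebra k H) where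
  toFun χ := AlgEquiv.ofAlgHom (twistHom χ) (twistHom χ⁻¹)
    (by ext; simp [twistHom_single]) (by ext; simp [twistHom_single])
  map_one' := by
    ext a : 1
    induction a using MonoidAlgebra.induction_linear with
    | zero => simp
    | add a b ha hb => rw [map_add, ha, hb, map_add]
    | single h r => simp [twistHom_single]
  map_mul' χ ψ := by
    ext a : 1
    induction a using MonoidAlgebra.induction_linear with
    | zero => simp
    | add a b ha hb => rw [map_add, ha, hb, map_add]
    | single h r => simp [twistHom_single, mul_assoc]

@[simp]
theorem twist_single (χ : H →* kˣ) (h : H) (r : k) :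
    twist χ (MonoidAlgebra.single h r) = MonoidAlgebra.single h (χ h * r) :=
  twistHom_single χ h r

theorem twist_coeff (χ : H →* kˣ) (a : MonoidAlgebra k H) (h : H) :
    (twist χ a).coeff h = χ h * a.coeff h := by
  classical
  induction a using MonoidAlgebra.induction_linear with
  | zero => simp
  | add a b ha hb => simp only [map_add, MonoidAlgebra.coeff_add, Finsupp.add_apply, ha, hb, mul_add]
  | single g r =>
    rw [twist_single]
    by_cases hg : g = h
    · subst hg; simp
    · simp [hg]

/-- The action of group automorphisms on a group algebra. -/
noncomputable abbrev autAct : MulAut H →* (MonoidAlgebra k H ≃ₐ[k] MonoidAlgebra k H) :=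
  MonoidAlgebra.domCongrAut

theorem autAct_coeff (φ : MulAut H) (a : MonoidAlgebra k H) (h : H) :
    (autAct φ a).coeff h = a.coeff (φ.symm h) := by
  simp

theorem autAct_twist (φ : MulAut H) (χ : H →* kˣ) (a : MonoidAlgebra k H) :
    autAct φ (twist χ a) = twist (χ.comp φ.symm.toMonoidHom) (autAct φ a) := by
  ext h
  simp [twist_coeff]

theorem autAct_conj (c : H) (a : MonoidAlgebra k H) : autAct (MulAut.conj c) a = gconj c a := by
  ext h
  rw [gconj_coeff, autAct_coeff]
  simp

theorem gconj_eq_self_of_central {a : MonoidAlgebra k H} (ha : ∀ b, b * a = a * b) (c : H) :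
    gconj c a = a := by
  rw [gconj_apply, ha, mul_assoc, ← map_mul, mul_inv_cancel, map_one, mul_one]

/-- Primitive central idempotents. -/
structure IsBlock (E : MonoidAlgebra k H) : Prop where
  central : ∀ a, a * E = E * a
  idem : E * E = E
  ne_zero : E ≠ 0
  prim : ∀ z, (∀ a, a * z = z * a) → z * z = z → z * E = 0 ∨ z * E = E

theorem IsBlock.map {E : MonoidAlgebra k H} (hE : IsBlock E)
    (Φ : MonoidAlgebra k H ≃ₐ[k] MonoidAlgebra k H) : IsBlock (Φ E) where
  central a := by
    have := congrArg Φ (hE.central (Φ.symm a))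
    simpa using this
  idem := by rw [← map_mul, hE.idem]
  ne_zero := by simpa using hE.ne_zero
  prim z hz hzz := by
    have h := hE.prim (Φ.symm z) (fun a => by
      have := congrArg Φ.symm (hz (Φ a))
      simpa using this) (by rw [← map_mul, hzz])
    refine h.imp (fun h => ?_) fun h => ?_
    · have := congrArg Φ h
      simpa using this
    · have := congrArg Φ h
      simpa using this

theorem IsBlock.mul_eq_zero {E E' : MonoidAlgebra k H} (hE : IsBlock E) (hE' : IsBlock E')
    (h : E ≠ E') : E * E' = 0 := by
  rcases hE'.prim E hE.central hE.idem with h1 | h1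
  · exact h1
  rcases hE.prim E' hE'.central hE'.idem with h2 | h2
  · rw [← hE.central, h2]
  · exact absurd (by rw [← h2, hE.central, h1]) h

theorem central_of_gconj_eq_self {a : MonoidAlgebra k H} (ha : ∀ g : H, gconj g a = a) (b) :
    b * a = a * b := by
  induction b using MonoidAlgebra.induction_linear with
  | zero => simp
  | add b c hb hc => rw [add_mul, mul_add, hb, hc]
  | single g r =>
    have : MonoidAlgebra.single g r = r • MonoidAlgebra.of k H g := by simp
    rw [this, smul_mul_assoc, mul_smul_comm]
    congr 1
    conv_rhs => rw [← ha g, gconj_apply, mul_assoc, ← map_mul, inv_mul_cancel, map_one, mul_one]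

variable [Fintype H]

/-- The sum of the conjugates of an element of a group algebra. -/
noncomputable def conjSum (i : MonoidAlgebra k H) : MonoidAlgebra k H := ∑ c : H, gconj c i

theorem gconj_conjSum (g : H) (i : MonoidAlgebra k H) : gconj g (conjSum i) = conjSum i := by
  rw [conjSum, map_sum]
  exact Fintype.sum_equiv (Equiv.mulLeft g) _ _ fun c => (gconj_mul g c i).symm

theorem conjSum_central (i b : MonoidAlgebra k H) : b * conjSum i = conjSum i * b :=
  central_of_gconj_eq_self (fun g => gconj_conjSum g i) b

theorem coeff_one_mul_conjSum (a i : MonoidAlgebra k H) :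
    (a * conjSum i).coeff 1 = blockForm a i := by
  rw [conjSum, Finset.mul_sum, blockForm, MonoidAlgebra.coeff_sum, Finsupp.finsetSum_apply]

theorem blockForm_self_eq_one {i : MonoidAlgebra k H} (hi : i * i = i) (hi0 : i ≠ 0)
    (hprim : ∀ a, ∃ r : k, i * a * i = r • i) : blockForm i i = 1 := by
  rw [← trace_mulLeftRight_eq_blockForm]
  choose r hr using hprim
  have hlin : ∃ φ : MonoidAlgebra k H →ₗ[k] k, ∀ a, i * a * i = φ a • i := by
    have hinj : ∀ a b : k, a • i = b • i → a = b := fun a b h => smul_left_injective _ hi0 h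
    refine ⟨⟨⟨r, fun a b => hinj _ _ ?_⟩, fun c a => hinj _ _ ?_⟩, hr⟩
    · rw [← hr, add_smul, ← hr, ← hr]; noncomm_ring
    · rw [← hr, RingHom.id_apply, smul_eq_mul, mul_smul, ← hr, mul_smul_comm, smul_mul_assoc]
  obtain ⟨φ, hφ⟩ := hlin
  have : LinearMap.mulLeft k i ∘ₗ LinearMap.mulRight k i = φ.smulRight i := by
    refine LinearMap.ext fun a => ?_
    rw [LinearMap.smulRight_apply, ← hφ, mul_assoc]
    rfl
  rw [this, LinearMap.trace_smulRight]
  have h := hφ i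
  rw [hi, hi] at h
  exact smul_left_injective _ hi0 (by simpa using h.symm)

theorem exists_mul_conjSum_eq {i : MonoidAlgebra k H} (hi : i * i = i) (hi0 : i ≠ 0)
    (hprim : ∀ a, ∃ r : k, i * a * i = r • i) :
    ∃ l : k, i * conjSum i = l • i ∧ l * i.coeff 1 = 1 := by
  obtain ⟨l, hl⟩ := hprim (conjSum i)
  have h : i * conjSum i = l • i := by
    rw [← hl, mul_assoc, ← conjSum_central, ← mul_assoc, hi]
  refine ⟨l, h, ?_⟩
  have := coeff_one_mul_conjSum i i
  rw [blockForm_self_eq_one hi hi0 hprim, h] at this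
  simpa using this

/-- The block containing a primitive idempotent. -/
noncomputable def blockOf (i : MonoidAlgebra k H) : MonoidAlgebra k H := i.coeff 1 • conjSum i

theorem mul_blockOf {i : MonoidAlgebra k H} (hi : i * i = i) (hi0 : i ≠ 0)
    (hprim : ∀ a, ∃ r : k, i * a * i = r • i) : i * blockOf i = i := by
  obtain ⟨l, h1, h2⟩ := exists_mul_conjSum_eq hi hi0 hprim
  rw [blockOf, mul_smul_comm, h1, smul_smul, mul_comm, h2, one_smul]

theorem isBlock_blockOf {i : MonoidAlgebra k H} (hi : i * i = i) (hi0 : i ≠ 0)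
    (hprim : ∀ a, ∃ r : k, i * a * i = r • i) : IsBlock (blockOf i) := by
  have hc : ∀ a, a * blockOf i = blockOf i * a := fun a => by
    rw [blockOf, mul_smul_comm, smul_mul_assoc, conjSum_central]
  have hm := mul_blockOf hi hi0 hprim
  have key : ∀ z : MonoidAlgebra k H, (∀ a, a * z = z * a) → ∀ r : k, z * i = r • i →
      z * blockOf i = r • blockOf i := by
    intro z hz r hr
    rw [blockOf, conjSum, mul_smul_comm, smul_comm r]
    congr 1
    rw [Finset.mul_sum, Finset.smul_sum]
    refine Finset.sum_congr rfl fun c _ => ?_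
    rw [← map_smul, ← hr, map_mul, gconj_eq_self_of_central hz]
  refine ⟨hc, ?_, ?_, fun z hz hzz => ?_⟩
  · have := key (blockOf i) hc 1 (by rw [← hc, hm, one_smul])
    rwa [one_smul] at this
  · intro h
    rw [h, mul_zero] at hm
    exact hi0 hm.symm
  · obtain ⟨r, hr⟩ := hprim z
    have h1 : z * i = r • i := by rw [← hr, hz, mul_assoc, hi]
    have h2 : r * r = r := by
      apply smul_left_injective k hi0
      change (r * r) • i = r • i
      rw [← h1, mul_smul, ← h1, ← mul_smul_comm, ← h1, ← mul_assoc, hzz]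
    rw [key z hz r h1]
    by_cases h0 : r = 0
    · left; rw [h0, zero_smul]
    · right; rw [mul_left_cancel₀ h0 (by rw [h2, mul_one] : r * r = r * 1), one_smul]

end Blocks

section Equivariance

variable {k : Type*} [Field k] {H : Type*} [Group H]

theorem autAct_gconj (φ : MulAut H) (c : H) (a : MonoidAlgebra k H) :
    autAct φ (gconj c a) = gconj (φ c) (autAct φ a) := by
  rw [← autAct_conj, ← autAct_conj, ← AlgEquiv.mul_apply, ← map_mul, ← AlgEquiv.mul_apply, ← map_mul]
  congr 2
  ext h
  simp

theorem twist_gconj (χ : H →* kˣ) (c : H) (a : MonoidAlgebra k H) :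
    twist χ (gconj c a) = gconj c (twist χ a) := by
  ext h
  rw [twist_coeff, gconj_coeff, gconj_coeff, twist_coeff]
  congr 2
  rw [map_mul, map_mul, mul_comm (χ _), mul_assoc, ← map_mul, mul_comm, ← map_mul, mul_assoc]
  simp

theorem twist_mul (χ ψ : H →* kˣ) (a : MonoidAlgebra k H) :
    twist (χ * ψ) a = twist χ (twist ψ a) := by
  rw [map_mul]; rfl

variable [Fintype H]

theorem autAct_conjSum (φ : MulAut H) (a : MonoidAlgebra k H) :
    autAct φ (conjSum a) = conjSum (autAct φ a) := by
  rw [conjSum, conjSum, map_sum]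
  exact Fintype.sum_equiv φ.toEquiv _ _ fun c => autAct_gconj φ c a

theorem twist_conjSum (χ : H →* kˣ) (a : MonoidAlgebra k H) :
    twist χ (conjSum a) = conjSum (twist χ a) := by
  rw [conjSum, conjSum, map_sum]
  exact Finset.sum_congr rfl fun c _ => twist_gconj χ c a

end Equivariance

/-- A primitive idempotent of a group algebra, a group of linear characters to twist with, and a
group of automorphisms, whose action on a central element of prime order is tracked. -/
structure TwistData (k H Γ : Type*) [Field k] [Group H] [Fintype H] [Group Γ] [Fintype Γ] where
  act : Γ →* MulAut H
  inc : H →* Γ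
  inc_injective : Function.Injective inc
  act_inc : ∀ c, act (inc c) = MulAut.conj c
  M : Subgroup (H →* kˣ)
  finite_M : Finite M
  comp_mem : ∀ γ, ∀ χ ∈ M, χ.comp (act γ).symm.toMonoidHom ∈ M
  x : H
  x_comm : ∀ h, x * h = h * x
  p : ℕ
  hp : p.Prime
  x_pow : x ^ p = 1
  exists_pow : ∀ γ, ∃ e : ℕ, act γ x = x ^ e
  mem_range : ∀ γ, act γ x = x → γ ∈ inc.range
  i : MonoidAlgebra k H
  idem : i * i = i
  ne_zero : i ≠ 0
  prim : ∀ a, ∃ r : k, i * a * i = r • i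

namespace TwistData

variable {k H Γ : Type*} [Field k] [Group H] [Fintype H] [Group Γ] [Fintype Γ]
  (D : TwistData k H Γ)

/-- The twisted primitive idempotents. -/
noncomputable def idp (χ : H →* kˣ) : MonoidAlgebra k H := twist χ D.i

/-- The twisted blocks. -/
noncomputable def blk (χ : H →* kˣ) : MonoidAlgebra k H := twist χ (blockOf D.i)

/-- The action of the automorphism group on the group algebra. -/
noncomputable def α : Γ →* (MonoidAlgebra k H ≃ₐ[k] MonoidAlgebra k H) := autAct.comp D.act

theorem isBlock_blk (χ : H →* kˣ) : IsBlock (D.blk χ) :=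
  (isBlock_blockOf D.idem D.ne_zero D.prim).map _

theorem idp_mul_blk (χ : H →* kˣ) : D.idp χ * D.blk χ = D.idp χ := by
  rw [idp, blk, ← map_mul, mul_blockOf D.idem D.ne_zero D.prim]

theorem idp_coeff_one (χ : H →* kˣ) : (D.idp χ).coeff 1 = D.i.coeff 1 := by
  rw [idp, twist_coeff, map_one, Units.val_one, one_mul]

theorem blk_eq_smul_conjSum (χ : H →* kˣ) : D.blk χ = D.i.coeff 1 • conjSum (D.idp χ) := by
  rw [blk, blockOf, map_smul, twist_conjSum]; rfl

theorem α_blk (γ : Γ) (χ : H →* kˣ) :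
    D.α γ (D.blk χ) = D.i.coeff 1 • conjSum (D.α γ (D.idp χ)) := by
  rw [blk_eq_smul_conjSum, map_smul]
  congr 1
  exact autAct_conjSum _ _

theorem coeff_one_ne_zero : D.i.coeff 1 ≠ 0 := by
  obtain ⟨l, -, h⟩ := exists_mul_conjSum_eq D.idem D.ne_zero D.prim
  exact right_ne_zero_of_mul_eq_one h

theorem α_inc (c : H) (a : MonoidAlgebra k H) : D.α (D.inc c) a = gconj c a := by
  rw [← autAct_conj, ← D.act_inc]; rfl

theorem α_mul (γ δ : Γ) (a : MonoidAlgebra k H) : D.α (γ * δ) a = D.α γ (D.α δ a) := by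
  rw [map_mul]; rfl

/-- The pairs of twisted blocks related by a given automorphism. -/
def Rel (γ : Γ) (χ ψ : H →* kˣ) : Prop := D.blk χ = D.α γ (D.blk ψ)

variable {D}

theorem Rel.symm {γ : Γ} {χ ψ : H →* kˣ} (h : D.Rel γ χ ψ) : D.Rel γ⁻¹ ψ χ := by
  rw [Rel, h, ← α_mul, inv_mul_cancel, map_one]; rfl

theorem Rel.trans {γ δ : Γ} {χ ψ θ : H →* kˣ} (h : D.Rel γ χ ψ) (h' : D.Rel δ ψ θ) :
    D.Rel (γ * δ) χ θ := by
  rw [Rel, h, h', ← α_mul]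

theorem rel_inc (c : H) (χ : H →* kˣ) : D.Rel (D.inc c) χ χ := by
  rw [Rel, α_inc, gconj_eq_self_of_central (D.isBlock_blk χ).central]

variable (D)

theorem exists_eig : ∃ r : k, MonoidAlgebra.of k H D.x * D.i = r • D.i := by
  obtain ⟨r, hr⟩ := D.prim (MonoidAlgebra.of k H D.x)
  refine ⟨r, ?_⟩
  have hc : ∀ a, a * MonoidAlgebra.of k H D.x = MonoidAlgebra.of k H D.x * a :=
    central_of_gconj_eq_self fun g => by simp [gconj_single, ← D.x_comm]
  rw [← hr, hc, mul_assoc, D.idem]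

/-- The scalar by which the distinguished central element acts on a twisted block. -/
noncomputable def eig (χ : H →* kˣ) : k := D.exists_eig.choose * ((χ D.x)⁻¹ : kˣ)

theorem of_mul_of_comm (a) :
    a * MonoidAlgebra.of k H D.x = MonoidAlgebra.of k H D.x * a :=
  central_of_gconj_eq_self (fun g => by simp [gconj_single, ← D.x_comm]) a

theorem of_mul_twist {a : MonoidAlgebra k H}
    (h : MonoidAlgebra.of k H D.x * a = D.exists_eig.choose • a) (χ : H →* kˣ) :
    MonoidAlgebra.of k H D.x * twist χ a = D.eig χ • twist χ a := by
  have h1 := congrArg (twist χ) h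
  rw [map_mul, map_smul] at h1
  have h2 : twist χ (MonoidAlgebra.of k H D.x) = (χ D.x : k) • MonoidAlgebra.of k H D.x := by simp
  rw [h2, smul_mul_assoc] at h1
  rw [eig, mul_comm, mul_smul, ← h1, smul_smul, ← Units.val_mul, inv_mul_cancel, Units.val_one,
    one_smul]

theorem of_mul_idp (χ : H →* kˣ) : MonoidAlgebra.of k H D.x * D.idp χ = D.eig χ • D.idp χ :=
  D.of_mul_twist D.exists_eig.choose_spec χ

theorem of_mul_blk (χ : H →* kˣ) : MonoidAlgebra.of k H D.x * D.blk χ = D.eig χ • D.blk χ := by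
  refine D.of_mul_twist ?_ χ
  rw [blockOf, conjSum, mul_smul_comm, smul_comm _ (D.i.coeff 1), Finset.mul_sum]
  congr 1
  rw [Finset.smul_sum]
  refine Finset.sum_congr rfl fun c _ => ?_
  rw [← map_smul, ← D.exists_eig.choose_spec, map_mul, gconj_eq_self_of_central D.of_mul_of_comm]

theorem of_pow_mul_blk (χ : H →* kˣ) (e : ℕ) :
    MonoidAlgebra.of k H (D.x ^ e) * D.blk χ = D.eig χ ^ e • D.blk χ := by
  induction e with
  | zero => rw [pow_zero, map_one, one_mul, pow_zero, one_smul]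
  | succ e ih => rw [pow_succ, map_mul, mul_assoc, of_mul_blk, mul_smul_comm, ih, smul_smul, pow_succ']

theorem eig_pow (χ : H →* kˣ) : D.eig χ ^ D.p = 1 := by
  have h := D.of_pow_mul_blk χ D.p
  rw [D.x_pow, map_one, one_mul] at h
  exact smul_left_injective k (D.isBlock_blk χ).ne_zero (by simpa using h.symm)

variable {D}

theorem Rel.eig_eq {γ : Γ} {χ ψ : H →* kˣ} (h : D.Rel γ χ ψ) {e : ℕ} (he : D.act γ D.x = D.x ^ e) :
    D.eig ψ = D.eig χ ^ e := by
  have h1 := congrArg (D.α γ) (D.of_mul_blk ψ)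
  rw [map_mul, map_smul, ← h] at h1
  have h2 : D.α γ (MonoidAlgebra.of k H D.x) = MonoidAlgebra.of k H (D.x ^ e) := by
    rw [← he]
    simp [α]
  rw [h2, of_pow_mul_blk] at h1
  exact (smul_left_injective k (D.isBlock_blk χ).ne_zero h1).symm

theorem Rel.eig_eq_one_iff {γ : Γ} {χ ψ : H →* kˣ} (h : D.Rel γ χ ψ) :
    D.eig χ = 1 ↔ D.eig ψ = 1 := by
  have key : ∀ {γ : Γ} {χ ψ : H →* kˣ}, D.Rel γ χ ψ → D.eig χ = 1 → D.eig ψ = 1 := by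
    intro γ χ ψ h h1
    obtain ⟨e, he⟩ := D.exists_pow γ
    rw [h.eig_eq he, h1, one_pow]
  exact ⟨key h, key h.symm⟩

theorem Rel.mem_range {γ : Γ} {χ : H →* kˣ} (h : D.Rel γ χ χ) (hχ : D.eig χ ≠ 1) :
    γ ∈ D.inc.range := by
  obtain ⟨e, he⟩ := D.exists_pow γ
  have h1 := h.eig_eq he
  refine D.mem_range γ ?_
  have : Fact D.p.Prime := ⟨D.hp⟩
  have ho : orderOf (D.eig χ) = D.p := orderOf_eq_prime (D.eig_pow χ) hχ
  have h2 : 1 ≡ e [MOD D.p] := by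
    have hf : IsOfFinOrder (D.eig χ) := isOfFinOrder_iff_pow_eq_one.mpr ⟨_, D.hp.pos, D.eig_pow χ⟩
    rw [← ho, ← hf.pow_eq_pow_iff_modEq, pow_one]; exact h1
  rw [he]
  conv_rhs => rw [← pow_one D.x]
  exact (pow_eq_pow_iff_modEq.mpr (h2.of_dvd (orderOf_dvd_of_pow_eq_one D.x_pow))).symm

variable (D)

open Classical in
/-- The automorphisms relating two twisted blocks. -/
noncomputable def relSet (χ ψ : H →* kˣ) : Finset Γ := {γ | D.Rel γ χ ψ}

theorem mem_relSet {χ ψ : H →* kˣ} {γ : Γ} : γ ∈ D.relSet χ ψ ↔ D.Rel γ χ ψ := by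
  simp [relSet]

variable {D} in
theorem Rel.card_relSet {γ : Γ} {χ ψ : H →* kˣ} (h : D.Rel γ χ ψ) (hχ : D.eig χ ≠ 1) :
    (D.relSet χ ψ).card = Fintype.card H := by
  classical
  rw [← Finset.card_univ, ← Finset.card_image_of_injective (Finset.univ : Finset H)
    (f := fun c => D.inc c * γ) (fun a b hab => D.inc_injective (mul_right_cancel hab))]
  congr 1
  ext δ
  rw [mem_relSet, Finset.mem_image]
  constructor
  · intro hδ
    obtain ⟨c, hc⟩ := (hδ.trans h.symm).mem_range hχ
    exact ⟨c, Finset.mem_univ _, by rw [hc, inv_mul_cancel_right]⟩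
  · rintro ⟨c, -, rfl⟩
    exact (rel_inc c χ).trans h

theorem card_mul_sum_coeff_one (χ ψ : H →* kˣ) :
    (Fintype.card H : k) * ∑ γ, (D.idp χ * D.α γ (D.idp ψ)).coeff 1 = (D.relSet χ ψ).card := by
  classical
  have h1 : ∀ c : H, ∑ γ, (D.idp χ * D.α γ (D.idp ψ)).coeff 1 =
      ∑ γ, (D.idp χ * gconj c (D.α γ (D.idp ψ))).coeff 1 := by
    intro c
    refine (Fintype.sum_equiv (Equiv.mulLeft (D.inc c)) _ _ fun γ => ?_).symm
    rw [Equiv.coe_mulLeft, α_mul, α_inc]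
  have h2 : (Fintype.card H : k) * ∑ γ, (D.idp χ * D.α γ (D.idp ψ)).coeff 1 =
      ∑ γ, (D.idp χ * conjSum (D.α γ (D.idp ψ))).coeff 1 := by
    rw [← nsmul_eq_mul, ← Finset.card_univ, ← Finset.sum_const, Finset.sum_congr rfl fun c _ => h1 c,
      Finset.sum_comm]
    refine Finset.sum_congr rfl fun γ _ => ?_
    rw [conjSum, Finset.mul_sum, MonoidAlgebra.coeff_sum, Finsupp.finsetSum_apply]
  rw [h2, relSet, Finset.card_filter, Nat.cast_sum]
  refine Finset.sum_congr rfl fun γ _ => ?_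
  have h3 : D.i.coeff 1 * (D.idp χ * conjSum (D.α γ (D.idp ψ))).coeff 1 =
      (D.idp χ * D.α γ (D.blk ψ)).coeff 1 := by
    rw [α_blk, mul_smul_comm, MonoidAlgebra.coeff_smul, Finsupp.smul_apply, smul_eq_mul]
  apply mul_left_cancel₀ D.coeff_one_ne_zero
  rw [h3]
  by_cases h : D.Rel γ χ ψ
  · rw [if_pos h, ← h, idp_mul_blk, idp_coeff_one]; simp
  · rw [if_neg h, ← idp_mul_blk, mul_assoc,
      (D.isBlock_blk χ).mul_eq_zero ((D.isBlock_blk ψ).map _) h]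
    simp

end TwistData

namespace TwistData

variable {k H Γ : Type*} [Field k] [Group H] [Fintype H] [Group Γ] [Fintype Γ]
  (D : TwistData k H Γ)

/-- Systems of representatives, containing the trivial character, of the characters whose twisted
blocks are moved by the distinguished central element. -/
structure IsTransversal (J : Finset D.M) : Prop where
  one_mem : 1 ∈ J
  eig_ne_one : ∀ χ ∈ J, D.eig χ ≠ 1
  eq_of_rel : ∀ χ ∈ J, ∀ ψ ∈ J, ∀ γ, D.Rel γ χ ψ → χ = ψ
  exists_rel : ∀ ψ : D.M, D.eig ψ ≠ 1 → ∃ χ ∈ J, ∃ γ, D.Rel γ ψ χ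

theorem exists_isTransversal (h : D.eig 1 ≠ 1) : ∃ J, D.IsTransversal J := by
  classical
  have := D.finite_M
  let Pr : Finset D.M → Prop := fun J => 1 ∈ J ∧ (∀ χ ∈ J, D.eig χ ≠ 1) ∧
    ∀ χ ∈ J, ∀ ψ ∈ J, ∀ γ, D.Rel γ χ ψ → χ = ψ
  obtain ⟨J, -, hJ⟩ := (Set.toFinite {J | Pr J}).exists_le_maximal (a := {1})
    ⟨by simp, by simpa using h, by simp⟩
  obtain ⟨h1, h2, h3⟩ := hJ.prop
  refine ⟨J, h1, h2, h3, fun ψ hψ => ?_⟩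
  by_contra! hno
  have hins : Pr (insert ψ J) := by
    refine ⟨Finset.mem_insert_of_mem h1, ?_, ?_⟩
    · intro χ hχ
      rcases Finset.mem_insert.mp hχ with rfl | hχ
      · exact hψ
      · exact h2 χ hχ
    · intro χ hχ θ hθ γ hγ
      rcases Finset.mem_insert.mp hχ with h4 | h4 <;> rcases Finset.mem_insert.mp hθ with h5 | h5
      · rw [h4, h5]
      · exact absurd (h4 ▸ hγ) (hno θ h5 γ)
      · exact absurd (h5 ▸ hγ.symm) (hno χ h4 γ⁻¹)
      · exact h3 χ h4 θ h5 γ hγ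
  have hmem : ψ ∈ J := hJ.le_of_ge hins (Finset.subset_insert _ _) (Finset.mem_insert_self _ _)
  refine hno ψ hmem 1 ?_
  rw [Rel, map_one]; rfl

variable {D}

open Classical in
theorem IsTransversal.card_relSet {J : Finset D.M} (hJ : D.IsTransversal J) {χ ψ : D.M}
    (hχ : χ ∈ J) (hψ : ψ ∈ J) :
    (D.relSet χ ψ).card = if χ = ψ then Fintype.card H else 0 := by
  split_ifs with h
  · subst h
    refine Rel.card_relSet (γ := 1) ?_ (hJ.eig_ne_one χ hχ)
    rw [Rel, map_one]; rfl
  · rw [Finset.card_eq_zero, Finset.eq_empty_iff_forall_notMem]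
    intro γ hγ
    exact h (hJ.eq_of_rel χ hχ ψ hψ γ (D.mem_relSet.mp hγ))

theorem card_relSet_eq_zero {χ ψ : H →* kˣ} (h : ¬ (D.eig χ = 1 ↔ D.eig ψ = 1)) :
    (D.relSet χ ψ).card = 0 := by
  rw [Finset.card_eq_zero, Finset.eq_empty_iff_forall_notMem]
  intro γ hγ
  exact h (D.mem_relSet.mp hγ).eig_eq_one_iff

theorem card_relSet_le {χ ψ : H →* kˣ} (hχ : D.eig χ ≠ 1) :
    (D.relSet χ ψ).card ≤ Fintype.card H := by
  rcases (D.relSet χ ψ).eq_empty_or_nonempty with h | ⟨γ, hγ⟩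
  · simp [h]
  · exact (Rel.card_relSet (D.mem_relSet.mp hγ) hχ).le

variable (D) in
/-- The action of an automorphism on the characters. -/
def move (γ : Γ) (χ : D.M) : D.M := ⟨_, D.comp_mem γ χ χ.2⟩

variable (D) in
theorem α_twist (γ : Γ) (χ : D.M) (a : MonoidAlgebra k H) :
    D.α γ (twist (χ : H →* kˣ) a) = twist (D.move γ χ : H →* kˣ) (D.α γ a) :=
  autAct_twist _ _ _

theorem Rel.move {γ : Γ} {c : D.M} (h : D.Rel γ c c) (χ : D.M) :
    D.Rel γ ↑(D.move γ (χ * c⁻¹) * c) χ := by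
  rw [Rel, blk, Subgroup.coe_mul, twist_mul]
  change twist _ (D.blk c) = _
  rw [h, ← α_twist]
  congr 1
  rw [blk, blk, ← twist_mul, ← Subgroup.coe_mul, inv_mul_cancel_right]

theorem IsTransversal.card_mul_card_relSet_le [Fintype D.M] {J : Finset D.M}
    (hJ : D.IsTransversal J) {c : D.M} (hc : D.eig c = 1) :
    J.card * (D.relSet c c).card ≤ Fintype.card H * (Fintype.card D.M - 1) := by
  classical
  have hcard : (Finset.univ.erase c).card = Fintype.card D.M - 1 := by
    rw [Finset.card_erase_of_mem (Finset.mem_univ _), Finset.card_univ]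
  rw [← Finset.card_product, ← hcard]
  refine Finset.card_le_mul_card_image_of_maps_to
    (f := fun z => D.move z.2 (z.1 * c⁻¹) * c) ?_ _ ?_
  · rintro ⟨χ, γ⟩ hz
    obtain ⟨hχ, hγ⟩ := Finset.mem_product.mp hz
    refine Finset.mem_erase.mpr ⟨fun h => ?_, Finset.mem_univ _⟩
    have h1 := ((D.mem_relSet.mp hγ).move χ).eig_eq_one_iff
    rw [h] at h1
    exact hJ.eig_ne_one χ hχ (h1.mp hc)
  · intro s _
    set F := ({z ∈ J ×ˢ D.relSet c c | D.move z.2 (z.1 * c⁻¹) * c = s} : Finset (D.M × Γ)) with hF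
    have hprop : ∀ z ∈ F, z.1 ∈ J ∧ D.Rel z.2 s z.1 := by
      intro z hz
      obtain ⟨hz1, hz2⟩ := Finset.mem_filter.mp hz
      obtain ⟨hχ, hγ⟩ := Finset.mem_product.mp hz1
      exact ⟨hχ, hz2 ▸ (D.mem_relSet.mp hγ).move z.1⟩
    rcases F.eq_empty_or_nonempty with h | ⟨z₀, hz₀⟩
    · rw [h]; simp
    · obtain ⟨hJ0, hr0⟩ := hprop z₀ hz₀
      have hfst : ∀ z ∈ F, z.1 = z₀.1 := fun z hz =>
        hJ.eq_of_rel _ (hprop z hz).1 _ hJ0 _ ((hprop z hz).2.symm.trans hr0)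
      refine le_trans (Finset.card_le_card_of_injOn (t := D.relSet s z₀.1) Prod.snd ?_ ?_)
        (card_relSet_le fun h => hJ.eig_ne_one _ hJ0 (hr0.eig_eq_one_iff.mp h))
      · intro z hz
        rw [Finset.mem_coe, mem_relSet, ← hfst z hz]
        exact (hprop z hz).2
      · intro z hz w hw hzw
        exact Prod.ext ((hfst z hz).trans (hfst w hw).symm) hzw

variable (D)

theorem α_of {γ : Γ} {e : ℕ} (he : D.act γ D.x = D.x ^ e) :
    D.α γ (MonoidAlgebra.of k H D.x) = MonoidAlgebra.of k H (D.x ^ e) := by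
  rw [← he]; simp [α]

theorem eig_eq_one_iff_of_mul (γ : Γ) (χ : D.M) :
    D.eig χ = 1 ↔ MonoidAlgebra.of k H D.x * D.α γ (D.blk χ) = D.α γ (D.blk χ) := by
  constructor
  · intro h
    obtain ⟨e, he⟩ := D.exists_pow γ⁻¹
    apply (D.α γ⁻¹).injective
    rw [map_mul, D.α_of he, ← α_mul, inv_mul_cancel, map_one, AlgEquiv.one_apply,
      of_pow_mul_blk, h, one_pow, one_smul]
  · intro h
    obtain ⟨e, he⟩ := D.exists_pow γ
    have h1 : ∀ n : ℕ, MonoidAlgebra.of k H (D.x ^ n) * D.α γ (D.blk χ) = D.α γ (D.blk χ) := by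
      intro n
      induction n with
      | zero => rw [pow_zero, map_one, one_mul]
      | succ n ih => rw [pow_succ, map_mul, mul_assoc, h, ih]
    have h2 := congrArg (D.α γ) (D.of_mul_blk χ)
    rw [map_mul, D.α_of he, h1, map_smul] at h2
    exact smul_left_injective k ((D.isBlock_blk χ).map (D.α γ)).ne_zero
      (by simpa using h2.symm)

open Classical in
/-- The orbit of a block under twists and automorphisms. -/
noncomputable def orb [Fintype D.M] : Finset (MonoidAlgebra k H) :=
  Finset.univ.image fun z : Γ × D.M => D.α z.1 (D.blk z.2)

variable [Fintype D.M]

theorem mem_orb {b : MonoidAlgebra k H} : b ∈ D.orb ↔ ∃ γ, ∃ χ : D.M, D.α γ (D.blk χ) = b := by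
  simp [orb]

theorem isBlock_of_mem_orb {b : MonoidAlgebra k H} (h : b ∈ D.orb) : IsBlock b := by
  obtain ⟨γ, χ, rfl⟩ := D.mem_orb.mp h
  exact (D.isBlock_blk χ).map _

theorem α_mem_orb (γ : Γ) {b : MonoidAlgebra k H} (h : b ∈ D.orb) : D.α γ b ∈ D.orb := by
  obtain ⟨δ, χ, rfl⟩ := D.mem_orb.mp h
  exact D.mem_orb.mpr ⟨γ * δ, χ, by rw [α_mul]⟩

theorem twist_mem_orb (ψ : D.M) {b : MonoidAlgebra k H} (h : b ∈ D.orb) :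
    twist (ψ : H →* kˣ) b ∈ D.orb := by
  obtain ⟨δ, χ, rfl⟩ := D.mem_orb.mp h
  refine D.mem_orb.mpr ⟨δ, D.move δ⁻¹ ψ * χ, ?_⟩
  rw [blk, Subgroup.coe_mul, twist_mul, α_twist]
  congr 2
  ext h
  simp [move]

/-- The sum of the blocks in an orbit. -/
noncomputable def orbSum : MonoidAlgebra k H := ∑ b ∈ D.orb, b

theorem map_orbSum (Φ : MonoidAlgebra k H ≃ₐ[k] MonoidAlgebra k H)
    (h : ∀ b ∈ D.orb, Φ b ∈ D.orb) : Φ D.orbSum = D.orbSum := by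
  classical
  have himg : D.orb.image Φ = D.orb := by
    refine Finset.eq_of_subset_of_card_le ?_ (Finset.card_image_of_injective _ Φ.injective).ge
    intro b hb
    obtain ⟨c, hc, rfl⟩ := Finset.mem_image.mp hb
    exact h c hc
  rw [orbSum, map_sum]
  conv_rhs => rw [← himg, Finset.sum_image fun a _ b _ hab => Φ.injective hab]

theorem α_orbSum (γ : Γ) : D.α γ D.orbSum = D.orbSum :=
  D.map_orbSum _ fun _ hb => D.α_mem_orb γ hb

theorem orbSum_coeff_eq_zero {h : H} (χ : D.M) (hχ : (χ : H →* kˣ) h ≠ 1) :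
    D.orbSum.coeff h = 0 := by
  have h1 := congrArg (fun a => a.coeff h) (D.map_orbSum (twist χ) fun _ hb => D.twist_mem_orb χ hb)
  simp only [twist_coeff] at h1
  by_contra h0
  exact hχ (Units.ext (mul_right_cancel₀ h0 (by rw [h1, Units.val_one, one_mul])))

theorem orbSum_mul_of_mem {b : MonoidAlgebra k H} (hb : b ∈ D.orb) : D.orbSum * b = b := by
  rw [orbSum, Finset.sum_mul, Finset.sum_eq_single b, (D.isBlock_of_mem_orb hb).idem]
  · intro c hc hcb
    exact (D.isBlock_of_mem_orb hc).mul_eq_zero (D.isBlock_of_mem_orb hb) hcb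
  · exact fun h => absurd hb h

theorem orbSum_idem : D.orbSum * D.orbSum = D.orbSum := by
  have h : D.orbSum * D.orbSum = ∑ b ∈ D.orb, D.orbSum * b := by
    rw [← Finset.mul_sum]; rfl
  rw [h, Finset.sum_congr rfl fun b hb => D.orbSum_mul_of_mem hb]
  rfl

theorem orbSum_mul_i : D.orbSum * D.i = D.i := by
  have hb : D.blk 1 ∈ D.orb := D.mem_orb.mpr ⟨1, 1, by rw [map_one]; rfl⟩
  have h1 : D.blk 1 * D.i = D.i := by
    rw [← (D.isBlock_blk 1).central]
    have := D.idp_mul_blk 1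
    rwa [idp, map_one] at this
  rw [← h1, ← mul_assoc, D.orbSum_mul_of_mem hb]

variable {D}

open Classical in
theorem IsTransversal.card_smul_sum {J : Finset D.M} (hJ : D.IsTransversal J)
    {A : Type*} [AddCommMonoid A] (F : MonoidAlgebra k H → A) :
    Fintype.card H • ∑ b ∈ D.orb with MonoidAlgebra.of k H D.x * b ≠ b, F b =
      ∑ γ, ∑ χ ∈ J, F (D.α γ (D.blk χ)) := by
  rw [← Finset.sum_product', Finset.smul_sum]
  rw [← Finset.sum_fiberwise_of_maps_to (s := Finset.univ ×ˢ J)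
    (t := D.orb.filter fun b => MonoidAlgebra.of k H D.x * b ≠ b)
    (g := fun z : Γ × D.M => D.α z.1 (D.blk z.2))]
  · refine Finset.sum_congr rfl fun b hb => ?_
    obtain ⟨hb1, hb2⟩ := Finset.mem_filter.mp hb
    obtain ⟨γ, ψ, rfl⟩ := D.mem_orb.mp hb1
    obtain ⟨χ, hχ, δ, hδ⟩ := hJ.exists_rel ψ fun h => hb2 ((D.eig_eq_one_iff_of_mul γ ψ).mp h)
    have hrel : D.α γ (D.blk ψ) = D.α (γ * δ) (D.blk χ) := by rw [hδ, α_mul]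
    rw [Finset.sum_congr rfl (g := fun _ => F (D.α γ (D.blk ψ)))
      (fun z hz => by rw [(Finset.mem_filter.mp hz).2]), Finset.sum_const]
    congr 1
    rw [← Finset.card_univ, ← Finset.card_image_of_injective (Finset.univ : Finset H)
      (f := fun c => (γ * δ * D.inc c, χ)) (fun a b hab => D.inc_injective
        (mul_left_cancel (Prod.mk.inj hab).1))]
    congr 1
    ext ⟨ε, θ⟩
    simp only [Finset.mem_image, Finset.mem_univ, true_and, Finset.mem_filter,
      Finset.mem_product]
    constructor
    · rintro ⟨c, hc⟩
      obtain ⟨rfl, rfl⟩ := Prod.mk.inj hc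
      refine ⟨hχ, ?_⟩
      rw [hrel, α_mul _ (γ * δ)]
      exact congrArg _ (Eq.symm (rel_inc c (χ : H →* kˣ)))
    · rintro ⟨hθ, h⟩
      have h1 : D.Rel ((γ * δ)⁻¹ * ε) χ θ := by
        rw [Rel, α_mul, h, hrel, ← α_mul, inv_mul_cancel, map_one]; rfl
      have h2 := hJ.eq_of_rel χ hχ θ hθ _ h1
      subst h2
      obtain ⟨c, hc⟩ := h1.mem_range (hJ.eig_ne_one χ hχ)
      exact ⟨c, by rw [hc, mul_inv_cancel_left]⟩
  · rintro ⟨γ, χ⟩ hz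
    obtain ⟨-, hχ⟩ := Finset.mem_product.mp hz
    exact Finset.mem_filter.mpr ⟨D.mem_orb.mpr ⟨γ, χ, rfl⟩, fun h =>
      hJ.eig_ne_one χ hχ ((D.eig_eq_one_iff_of_mul γ χ).mpr h)⟩

end TwistData

section Dichotomy

variable {A : Type*} [CommRing A] [IsLocalRing A] {O : Type*} [Ring O] [Algebra A O]
  [Module.Finite A O] {G : Type*} [Group G]

theorem eq_zero_of_eq_conjTrace {p : ℕ} (hp : p.Prime) (hodd : Odd p)
    (hpA : (p : A) ∈ IsLocalRing.maximalIdeal A) (σ : G →* O) {x : G} (hx : x ^ p = 1)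
    (hsum : ∑ j ∈ Finset.range p, σ (x ^ j) = 0) {e u : O} (he : e * e = e)
    (hc : Commute (σ x) e) (hu : e = conjTrace σ x p u) : e = 0 := by
  have hsum' : ∑ j ∈ Finset.range p, σ (x ^ j)⁻¹ = 0 := by
    rw [← Finset.sum_range_reflect] at hsum
    rw [← mul_zero (σ x), ← hsum, Finset.mul_sum]
    refine Finset.sum_congr rfl fun j hj => ?_
    rw [← map_mul]
    congr 1
    rw [inv_eq_iff_mul_eq_one, ← mul_assoc, mul_assoc (x ^ j), ← pow_succ', ← pow_add, ← hx]
    congr 1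
    have := Finset.mem_range.mp hj
    omega
  have hfac : ∀ j : ℕ, ∃ w, σ (x ^ j) - 1 = (σ x - 1) * w := fun j => by
    rw [map_pow]
    exact ⟨_, (mul_geom_sum (σ x) j).symm⟩
  choose w hw using hfac
  have hone : ∃ v, e = (σ x - 1) * v := by
    refine ⟨∑ j ∈ Finset.range p, w j * u * σ (x ^ j)⁻¹, ?_⟩
    rw [hu, Finset.mul_sum, conjTrace]
    rw [← sub_zero (∑ j ∈ Finset.range p, _), ← mul_zero u, ← hsum', Finset.mul_sum,
      ← Finset.sum_sub_distrib]
    refine Finset.sum_congr rfl fun j _ => ?_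
    rw [← mul_assoc, ← mul_assoc, ← hw, sub_mul, sub_mul, one_mul]
  obtain ⟨v, hv⟩ := hone
  have hc1 : Commute e (σ x - 1) := (hc.sub_left (Commute.one_left e)).symm
  have hpow : ∀ m : ℕ, ∃ v, e = (σ x - 1) ^ m * v := by
    intro m
    induction m with
    | zero => exact ⟨e, by simp⟩
    | succ m ih =>
      obtain ⟨v', hv'⟩ := ih
      refine ⟨v * v', ?_⟩
      calc e = e * e := he.symm
        _ = e * ((σ x - 1) ^ m * v') := by rw [← hv']
        _ = (σ x - 1) ^ m * (e * v') := by rw [← mul_assoc, (hc1.pow_right m).eq, mul_assoc]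
        _ = (σ x - 1) ^ (m + 1) * (v * v') := by rw [hv, pow_succ]; simp only [mul_assoc]
  obtain ⟨v', hv'⟩ := hpow p
  have hneg : Commute (σ x) (-1 : O) := (Commute.one_right (σ x)).neg_right
  obtain ⟨r, hr⟩ := hneg.exists_add_pow_prime_eq hp
  rw [← sub_eq_add_neg, ← map_pow, hx, map_one, hodd.neg_one_pow, add_neg_cancel, zero_add] at hr
  refine eq_zero_of_mem_smul_top (A := A) he ?_
  have : e = (p : A) • (σ x * (-1) * r * v') := by
    rw [hv', hr, Nat.cast_smul_eq_nsmul, nsmul_eq_mul]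
    simp only [mul_assoc]
  rw [this]
  exact Submodule.smul_mem_smul hpA Submodule.mem_top

theorem eq_zero_or_eq_one_of_central [Finite G] {p : ℕ} (hp : p.Prime) (hodd : Odd p)
    (hpA : (p : A) ∈ IsLocalRing.maximalIdeal A) (σ : G →* O) {x : G} (hx : x ^ p = 1)
    (hsum : ∑ j ∈ Finset.range p, σ (x ^ j) = 0) {K : Subgroup G} (hxK : x ∈ K)
    (hK : ∀ g, g⁻¹ * x * g ∈ K → g ∈ K) {e : O} (he : e * e = e)
    (hc : ∀ k ∈ K, Commute (σ k) e)
    (hcen : ∀ z, (∀ g, Commute (σ g) z) → ∃ l : A, z = l • 1) : e = 0 ∨ e = 1 := by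
  classical
  have := Fintype.ofFinite (G ⧸ K)
  let F : G ⧸ K → O := fun t => σ t.out * e * σ t.out⁻¹
  have hFmk : ∀ g : G, F (QuotientGroup.mk g) = σ g * e * σ g⁻¹ := by
    intro g
    obtain ⟨k, hk⟩ := QuotientGroup.mk_out_eq_mul K g
    have h2 := (commute_map_inv σ (hc k k.2)).eq
    simp only [F]
    rw [hk, map_mul, mul_inv_rev, map_mul, mul_assoc (σ g), (hc k k.2).eq]
    simp only [← mul_assoc]
    rw [mul_assoc (σ g * e), map_mul_map_inv, mul_one]
  have hFs : ∀ (g : G) (t : G ⧸ K), F (g • t) = σ g * F t * σ g⁻¹ := by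
    intro g t
    obtain ⟨h, rfl⟩ := QuotientGroup.mk_surjective t
    rw [MulAction.Quotient.smul_mk, hFmk, hFmk, smul_eq_mul, map_mul, mul_inv_rev, map_mul]
    simp only [mul_assoc]
  obtain ⟨a, ha⟩ := sum_eq_sum_fixed_add_conjTrace σ x hp (MulAction.toPermHom G (G ⧸ K) x)
    (by rw [← map_pow, hx, map_one]) F fun t => hFs x t
  have hfix : (Finset.univ.filter fun t : G ⧸ K => MulAction.toPermHom G (G ⧸ K) x t = t) =
      {QuotientGroup.mk 1} := by
    ext t
    obtain ⟨g, rfl⟩ := QuotientGroup.mk_surjective t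
    simp only [Finset.mem_filter, Finset.mem_univ, true_and, Finset.mem_singleton,
      MulAction.toPermHom_apply, MulAction.toPerm_apply, MulAction.Quotient.smul_mk, smul_eq_mul]
    rw [QuotientGroup.eq, QuotientGroup.eq, mul_one]
    constructor
    · intro h
      refine inv_mem (hK g ?_)
      simpa [mul_assoc] using inv_mem h
    · intro h
      rw [mul_inv_rev]
      exact mul_mem (mul_mem h (inv_mem hxK)) (by simpa using inv_mem h)
  rw [hfix, Finset.sum_singleton, hFmk, inv_one, map_one, one_mul, mul_one] at ha
  have hxe := hc x hxK
  obtain ⟨l, hl⟩ := hcen (∑ t, F t) fun g => by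
    have h1 : σ g * (∑ t, F t) * σ g⁻¹ = ∑ t, F t := by
      rw [Finset.mul_sum, Finset.sum_mul]
      exact Fintype.sum_equiv (MulAction.toPerm g) _ _ fun t => (hFs g t).symm
    have h2 := congrArg (· * σ g) h1
    simp only [mul_assoc, map_inv_mul_map, mul_one] at h2
    have h3 : σ g * ∑ t, F t = (∑ t, F t) * σ g := by simpa [mul_assoc] using h2
    exact h3
  rw [hl] at ha
  have hx1e : Commute (σ x) (1 - e) := (Commute.one_right _).sub_right hxe
  have h1e : (1 - e) * (1 - e) = 1 - e := by noncomm_ring; rw [he]; abel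
  have hsm : ∀ (r : A) (b : O), r • conjTrace σ x p b = conjTrace σ x p (r • b) := fun r b => by
    simp [conjTrace, Finset.smul_sum]
  rcases IsLocalRing.isUnit_or_isUnit_one_sub_self l with hu | hu
  · right
    obtain ⟨r, hr⟩ := hu.exists_left_inv
    have h2 : 1 - e = conjTrace σ x p (r • ((1 - e) * a)) := by
      rw [← hsm, ← mul_conjTrace σ p a hx1e, ← sub_eq_iff_eq_add'.mpr ha, mul_sub, sub_mul 1 e e,
        one_mul, he, sub_self, sub_zero, mul_smul_comm, mul_one, smul_smul, hr, one_smul]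
    exact (sub_eq_zero.mp (eq_zero_of_eq_conjTrace hp hodd hpA σ hx hsum h1e hx1e h2)).symm
  · left
    obtain ⟨r, hr⟩ := hu.exists_left_inv
    have h2 : e = conjTrace σ x p ((-r) • (e * a)) := by
      rw [← hsm, ← mul_conjTrace σ p a hxe, ← sub_eq_iff_eq_add'.mpr ha, mul_sub, he,
        mul_smul_comm, mul_one]
      conv_lhs => rw [← one_smul A e, ← hr]
      module
    exact eq_zero_of_eq_conjTrace hp hodd hpA σ hx hsum he hxe h2

end Dichotomy

section Integrality

variable {k : Type*} [Field k] [IsAlgClosed k]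

theorem Matrix.isIntegral_trace_of_pow_eq {n : Type*} [Fintype n] [DecidableEq n] {N : Matrix n n k}
    {m : ℕ} (hm : m ≠ 0) (h : N ^ (m + 1) = N) : IsIntegral ℤ N.trace := by
  rw [Matrix.trace_eq_sum_roots_charpoly]
  refine IsIntegral.multiset_sum fun r hr => ?_
  have h1 := Matrix.mem_spectrum_iff_isRoot_charpoly.mpr (Polynomial.isRoot_of_mem_roots hr)
  rw [← Matrix.spectrum_toLin', ← Module.End.hasEigenvalue_iff_mem_spectrum] at h1
  obtain ⟨v, hv⟩ := h1.exists_hasEigenvector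
  have h2 : r ^ (m + 1) = r := by
    have h3 := (hv.pow_apply (m + 1))
    rw [← Matrix.toLin'_pow, h, hv.apply_eq_smul] at h3
    exact (smul_left_injective k hv.2 h3).symm
  rcases eq_or_ne r 0 with rfl | h0
  · exact isIntegral_zero
  · have h4 : r ^ m = 1 := mul_right_cancel₀ h0 (by rw [← pow_succ, h2, one_mul])
    exact IsIntegral.of_pow (Nat.pos_of_ne_zero hm) (h4 ▸ isIntegral_one)

theorem isIntegral_card_mul_coeff_one {G : Type*} [Group G] [Fintype G] {a : MonoidAlgebra k G}
    {m : ℕ} (hm : m ≠ 0) (h : a ^ (m + 1) = a) : IsIntegral ℤ ((Fintype.card G : k) * a.coeff 1) := by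
  classical
  let B : Module.Basis G k (MonoidAlgebra k G) := ⟨MonoidAlgebra.coeffLinearEquiv k⟩
  have h1 : LinearMap.trace k (MonoidAlgebra k G) (LinearMap.mulLeft k a) =
      (Fintype.card G : k) * a.coeff 1 := by
    have := trace_mulLeftRight_eq_blockForm a (1 : MonoidAlgebra k G)
    rw [LinearMap.mulRight_one, LinearMap.comp_id] at this
    rw [this, blockForm]
    simp
  rw [← h1, LinearMap.trace_eq_matrix_trace k B]
  refine Matrix.isIntegral_trace_of_pow_eq hm ?_
  have : LinearMap.toMatrix B B (LinearMap.mulLeft k a) = Algebra.leftMulMatrix B a := rfl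
  rw [this, ← map_pow, h]

theorem isIntegral_card_mul_coeff {G : Type*} [Group G] [Fintype G] {e : MonoidAlgebra k G}
    (he : e * e = e) (hc : ∀ a, a * e = e * a) (g : G) :
    IsIntegral ℤ ((Fintype.card G : k) * e.coeff g) := by
  have h1 : e.coeff g = (MonoidAlgebra.of k G g⁻¹ * e).coeff 1 := by
    rw [MonoidAlgebra.of_apply, MonoidAlgebra.coeff_single_mul_apply]; simp
  rw [h1]
  refine isIntegral_card_mul_coeff_one (m := Fintype.card G) Fintype.card_ne_zero ?_
  have hpow : ∀ n, (MonoidAlgebra.of k G g⁻¹ * e) ^ (n + 1) = MonoidAlgebra.of k G (g⁻¹ ^ (n + 1)) * e := by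
    intro n
    induction n with
    | zero => simp
    | succ n ih =>
      rw [pow_succ, ih, mul_assoc, ← mul_assoc e, ← hc, mul_assoc, he, ← mul_assoc, ← map_mul,
        ← pow_succ]
  rw [hpow, pow_succ, pow_card_eq_one, one_mul]

/-- A central idempotent supported on a subgroup has coefficients which become integral after
multiplication by the order of the subgroup. -/
theorem isIntegral_card_subgroup_mul_coeff {G : Type*} [Group G] [Fintype G] (D : Subgroup G)
    [Fintype D] {e : MonoidAlgebra k G} (he : e * e = e) (hc : ∀ a, a * e = e * a)
    (hD : ∀ g, g ∉ D → e.coeff g = 0) (g : G) :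
    IsIntegral ℤ ((Fintype.card D : k) * e.coeff g) := by
  classical
  by_cases hg : g ∈ D
  swap
  · rw [hD g hg, mul_zero]; exact isIntegral_zero
  let e' : MonoidAlgebra k D := ∑ d : D, MonoidAlgebra.single d (e.coeff d)
  have hinj : Function.Injective (incl k D) := MonoidAlgebra.mapDomain_injective Subtype.val_injective
  have h1 : incl k D e' = e := by
    have h0 : incl k D e' = ∑ d : D, MonoidAlgebra.single (d : G) (e.coeff d) := by
      simp only [e', map_sum]
      exact Finset.sum_congr rfl fun d _ => by simp
    rw [h0]
    ext g'
    rw [MonoidAlgebra.coeff_sum, Finsupp.finsetSum_apply]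
    by_cases hg' : g' ∈ D
    · rw [Finset.sum_eq_single ⟨g', hg'⟩]
      · simp
      · intro b _ hb
        have : (b : G) ≠ g' := fun h => hb (Subtype.ext h)
        simp [this]
      · simp
    · rw [hD g' hg']
      refine Finset.sum_eq_zero fun b _ => ?_
      have : (b : G) ≠ g' := fun h => hg' (h ▸ b.2)
      simp [this]
  have h2 : e'.coeff ⟨g, hg⟩ = e.coeff g := by
    simp only [e']
    rw [MonoidAlgebra.coeff_sum, Finsupp.finsetSum_apply, Finset.sum_eq_single ⟨g, hg⟩]
    · simp
    · intro b _ hb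
      simp [hb]
    · simp
  rw [← h2]
  refine isIntegral_card_mul_coeff ?_ ?_ _
  · apply hinj; rw [map_mul, h1, he]
  · intro a; apply hinj; rw [map_mul, map_mul, h1, hc]

end Integrality

section Incl

variable {k : Type*} [CommRing k] {G : Type*} [Group G] (C : Subgroup G)

theorem incl_coeff (a : MonoidAlgebra k C) (c : C) : (incl k C a).coeff (c : G) = a.coeff c :=
  Finsupp.mapDomain_apply Subtype.val_injective a.coeff c

theorem incl_coeff_of_notMem (a : MonoidAlgebra k C) {g : G} (hg : g ∉ C) :
    (incl k C a).coeff g = 0 :=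
  Finsupp.mapDomain_of_notMem_range a.coeff g (by rintro ⟨c, rfl⟩; exact hg c.2)

theorem incl_of (c : C) : incl k C (MonoidAlgebra.of k C c) = MonoidAlgebra.of k G (c : G) := by
  simp

theorem blockForm_gconj [Fintype G] (a b : MonoidAlgebra k G) (g : G) :
    blockForm (gconj g a) b = blockForm a b := by
  rw [blockForm, blockForm]
  refine Fintype.sum_equiv (Equiv.mulLeft g⁻¹) _ _ fun h => ?_
  rw [Equiv.coe_mulLeft, ← gconj_coeff_one g (a * _), map_mul, ← gconj_mul, mul_inv_cancel_left]

theorem blockForm_one_left [Fintype G] (a : MonoidAlgebra k G) :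
    blockForm 1 a = Fintype.card G * a.coeff 1 := by
  simp [blockForm, gconj_coeff_one]

theorem blockForm_sum_left [Fintype G] {ι : Type*} (s : Finset ι) (a : ι → MonoidAlgebra k G)
    (b : MonoidAlgebra k G) : blockForm (∑ j ∈ s, a j) b = ∑ j ∈ s, blockForm (a j) b := by
  simp only [blockForm, Finset.sum_mul, MonoidAlgebra.coeff_sum, Finsupp.finsetSum_apply]
  exact Finset.sum_comm

theorem blockForm_smul_left [Fintype G] (r : k) (a b : MonoidAlgebra k G) :
    blockForm (r • a) b = r * blockForm a b := by
  simp [blockForm, Finset.mul_sum]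

end Incl

theorem Matrix.eq_zero_of_forall_mul_mul_eq_zero {k n : Type*} [Field k] [Fintype n]
    [DecidableEq n] {X F : Matrix n n k} (hF : F ≠ 0) (h : ∀ N, X * N * F = 0) : X = 0 := by
  by_contra hX
  obtain ⟨i, j, hij⟩ : ∃ i j, X i j ≠ 0 := by
    by_contra! h0; exact hX (Matrix.ext h0)
  obtain ⟨s, t, hst⟩ : ∃ i j, F i j ≠ 0 := by
    by_contra! h0; exact hF (Matrix.ext h0)
  have h1 := congrFun (congrFun (h (Matrix.single j s 1)) i) t
  rw [Matrix.mul_apply, Finset.sum_eq_single s] at h1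
  · simp [hij, hst] at h1
  · intro b _ hb
    rw [Matrix.mul_single_apply_of_ne (hbj := hb), zero_mul]
  · simp

/-- Subgroups `C ≤ K` of `G` where twisting data for `C` come from conjugation by elements of `K`,
and elements of `C` on which the twisting characters are nontrivial are only fused by elements of
`K`. -/
structure LocalTwistData (k : Type*) [Field k] {G : Type*} [Group G] (C K : Subgroup G)
    [Fintype C] [Fintype K] extends TwistData k C K where
  coe_act : ∀ (γ : K) (c : C), ((act γ c : C) : G) = γ * c * (γ : G)⁻¹
  mem_of_conj_mem : ∀ χ ∈ M, ∀ h : C, χ h ≠ 1 → ∀ g : G, g⁻¹ * h * g ∈ C → g ∈ K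

namespace LocalTwistData

variable {k : Type*} [Field k] {G : Type*} [Group G] {C K : Subgroup G}
    [Fintype C] [Fintype K] (D : LocalTwistData k C K)

theorem gconj_incl (γ : K) (a : MonoidAlgebra k C) :
    gconj (γ : G) (incl k C a) = incl k C (D.α γ a) := by
  induction a using MonoidAlgebra.induction_linear with
  | zero => simp
  | add a b ha hb => simp only [map_add, ha, hb]
  | single c r =>
    have h1 : D.α γ (MonoidAlgebra.single c r) = MonoidAlgebra.single (D.act γ c) r := by
      simp [TwistData.α, autAct]
    rw [h1]
    simp [gconj_single, D.coe_act]

variable [Fintype G]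

theorem blockForm_incl_sub (χ ψ : D.M) (b : MonoidAlgebra k C) :
    blockForm (incl k C (D.idp χ - D.idp ψ)) (incl k C b) =
      ∑ γ : K, ((D.idp χ - D.idp ψ) * D.α γ b).coeff 1 := by
  rw [blockForm]
  refine (Fintype.sum_of_injective (fun γ : K => (γ : G)) Subtype.val_injective _ _ ?_ ?_).symm
  · intro g hg
    have hgK : g ∉ K := fun h => hg ⟨⟨g, h⟩, rfl⟩
    rw [coeff_mul_one_eq_sum]
    refine Finset.sum_eq_zero fun h _ => ?_
    by_contra hne
    have hC : h ∈ C := by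
      by_contra hC
      rw [incl_coeff_of_notMem C _ hC, zero_mul] at hne
      exact hne rfl
    refine hgK (D.mem_of_conj_mem ((χ : C →* kˣ) * (ψ : C →* kˣ)⁻¹) (D.M.mul_mem χ.2 (D.M.inv_mem ψ.2))
      ⟨h, hC⟩ ?_ g ?_)
    · intro h1
      rw [MonoidHom.mul_apply, MonoidHom.inv_apply, mul_inv_eq_one] at h1
      apply hne
      have := incl_coeff C (D.idp χ - D.idp ψ) ⟨h, hC⟩
      simp only [] at this
      rw [this, MonoidAlgebra.coeff_sub, Finsupp.sub_apply, TwistData.idp, TwistData.idp,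
        twist_coeff, twist_coeff, h1, sub_self, zero_mul]
    · by_contra hn
      rw [gconj_coeff, incl_coeff_of_notMem C b, mul_zero] at hne
      · exact hne rfl
      · intro h2
        apply hn
        simpa [mul_assoc] using inv_mem h2
  · intro γ
    rw [gconj_incl, ← map_mul]
    exact (incl_coeff C _ 1).symm

theorem card_mul_blockForm (χ ψ χ' ψ' : D.M) :
    (Fintype.card C : k) * blockForm (incl k C (D.idp χ - D.idp ψ)) (incl k C (D.idp χ' - D.idp ψ')) =
      (D.relSet χ χ').card - (D.relSet ψ χ').card - (D.relSet χ ψ').card + (D.relSet ψ ψ').card := by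
  simp only [← TwistData.card_mul_sum_coeff_one]
  rw [blockForm_incl_sub, ← mul_sub, ← mul_sub, ← mul_add]
  simp only [← Finset.sum_sub_distrib, ← Finset.sum_add_distrib]
  congr 1
  refine Finset.sum_congr rfl fun γ _ => ?_
  simp only [map_sub, sub_mul, mul_sub, MonoidAlgebra.coeff_sub, Finsupp.sub_apply]
  ring

end LocalTwistData

theorem powSum_mul_of_of_mul {k : Type*} [CommRing k] {G : Type*} [Group G] {x : G}
    {a : MonoidAlgebra k G} (h : MonoidAlgebra.of k G x * a = a) (n : ℕ) :
    powSum k x n * a = (n : k) • a := by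
  have h1 : ∀ j : ℕ, MonoidAlgebra.of k G (x ^ j) * a = a := by
    intro j
    induction j with
    | zero => rw [pow_zero, map_one, one_mul]
    | succ j ih => rw [pow_succ, map_mul, mul_assoc, h, ih]
  rw [powSum, Finset.sum_mul, Finset.sum_congr rfl fun j _ => h1 j, Finset.sum_const,
    Finset.card_range, Nat.cast_smul_eq_nsmul]

namespace LocalTwistData

variable {k : Type*} [Field k] {G : Type*} [Group G] {C K : Subgroup G}
    [Fintype C] [Fintype K] (D : LocalTwistData k C K)

theorem idp_one : D.idp 1 = D.i := by rw [TwistData.idp, map_one]; rfl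

variable [CharZero k]

theorem eig_one_ne_one {f : MonoidAlgebra k G} (hf0 : f ≠ 0) (hif : incl k C D.i * f = f)
    (hX : ∀ a, powSum k (D.x : G) D.p * a * f = 0) : D.eig 1 ≠ 1 := by
  intro h
  have h1 := D.of_mul_idp 1
  rw [h, one_smul, idp_one] at h1
  have h2 := congrArg (incl k C) h1
  rw [map_mul, incl_of] at h2
  have h3 := hX (incl k C D.i)
  rw [powSum_mul_of_of_mul h2, smul_mul_assoc, hif, smul_eq_zero] at h3
  exact h3.elim (fun h => D.hp.ne_zero (by exact_mod_cast h)) hf0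

variable [Fintype G] [Fintype D.M] {m : ℕ} {d : Fin m → ℕ}

theorem sum_mul_le_card (Φ : MonoidAlgebra k G ≃ₐ[k] Π i, Matrix (Fin (d i)) (Fin (d i)) k)
    {f : MonoidAlgebra k G} (hf : f * f = f) (hif : incl k C D.i * f = f)
    (hfi : f * incl k C D.i = f) (hX : ∀ a, powSum k (D.x : G) D.p * a * f = 0)
    {J : Finset D.M} (hJ : D.IsTransversal J) {c : D.M} (hc : D.eig c = 1)
    (w : D.M → Fin m → ℕ) (hw : ∀ χ : D.M, ∀ j, (Φ (incl k C (D.idp χ)) j).trace = w χ j)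
    (a : Fin m → ℕ) (ha : ∀ j, (Φ f j).trace = a j) :
    ∑ χ ∈ J, ∑ j, w χ j * a j ≤ Fintype.card D.M := by
  classical
  have h_integral : ∀ χ ψ χ' ψ' : D.M, (Fintype.card C : ℤ) *
      ∑ j, ((w χ j : ℤ) - w ψ j) * ((w χ' j : ℤ) - w ψ' j) =
      (D.relSet χ χ').card - (D.relSet ψ χ').card - (D.relSet χ ψ').card +
        (D.relSet ψ ψ').card := by
    intro χ ψ χ' ψ'
    have h := D.card_mul_blockForm χ ψ χ' ψ'
    rw [← sum_trace_mul_trace Φ] at h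
    simp only [map_sub, Pi.sub_apply, Matrix.trace_sub, hw] at h
    exact_mod_cast h
  have hle : ∀ j, a j ≤ w 1 j := by
    intro j
    have h1 : (Φ (incl k C D.i - f) j) * (Φ (incl k C D.i - f) j) = Φ (incl k C D.i - f) j := by
      rw [← Pi.mul_apply, ← map_mul, sub_mul, mul_sub, mul_sub, hif, hfi, hf, ← map_mul, D.idem]
      simp
    obtain ⟨b, hb, -⟩ := Matrix.exists_nat_trace_of_isIdempotentElem h1
    have h2 := hw 1 j
    rw [OneMemClass.coe_one, idp_one] at h2
    rw [map_sub, Pi.sub_apply, Matrix.trace_sub, h2, ha, sub_eq_iff_eq_add'] at hb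
    have hb' : w 1 j = a j + b := by exact_mod_cast hb
    omega
  have hc0 : ∀ j, a j ≠ 0 → w c j = 0 := by
    intro j hj
    have h1 : Φ f j ≠ 0 := by
      intro h
      have := ha j
      rw [h, Matrix.trace_zero] at this
      exact hj (by exact_mod_cast this.symm)
    have h2 : Φ (powSum k (D.x : G) D.p) j = 0 := by
      refine Matrix.eq_zero_of_forall_mul_mul_eq_zero h1 fun N => ?_
      have h3 := congrFun (congrArg Φ (hX (Φ.symm (Pi.single j N)))) j
      simpa [map_mul] using h3
    have h4 := D.of_mul_idp c
    rw [hc, one_smul] at h4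
    have h5 := congrArg (incl k C) h4
    rw [map_mul, incl_of] at h5
    have h6 := congrFun (congrArg Φ (powSum_mul_of_of_mul h5 D.p)) j
    rw [map_mul, Pi.mul_apply, h2, zero_mul, map_smul, Pi.smul_apply, eq_comm, smul_eq_zero] at h6
    have h7 := h6.resolve_left (by exact_mod_cast D.hp.ne_zero)
    have h8 := hw c j
    rw [h7, Matrix.trace_zero] at h8
    exact_mod_cast h8.symm
  have hcard : (0 : ℤ) < Fintype.card C := by exact_mod_cast Fintype.card_pos
  have hdiff : ∀ χ ∈ J, ∀ j, |(w 1 j : ℤ) - w χ j| ≤ 1 := by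
    intro χ hχ j
    by_cases h1 : 1 = χ
    · rw [← h1]; simp
    have h := h_integral 1 χ 1 χ
    rw [hJ.card_relSet hJ.one_mem hJ.one_mem, hJ.card_relSet hJ.one_mem hχ,
      hJ.card_relSet hχ hJ.one_mem, hJ.card_relSet hχ hχ, if_pos rfl, if_pos rfl, if_neg h1,
      if_neg (Ne.symm h1)] at h
    have h2 : ∑ j, ((w 1 j : ℤ) - w χ j) * ((w 1 j : ℤ) - w χ j) = 2 := by
      apply mul_left_cancel₀ hcard.ne'
      rw [h]; push_cast; ring
    have h3 := Finset.single_le_sum (f := fun j => ((w 1 j : ℤ) - w χ j) * ((w 1 j : ℤ) - w χ j))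
      (fun j _ => mul_self_nonneg _) (Finset.mem_univ j)
    rw [h2] at h3
    rw [abs_le]
    constructor <;> nlinarith
  have hterm : ∀ χ ∈ J, ∀ j, ((w χ j * a j : ℕ) : ℤ) ≤
      ((w 1 j : ℤ) - w c j) * ((w χ j : ℤ) - w c j) := by
    intro χ hχ j
    have h1 := abs_le.mp (hdiff χ hχ j)
    by_cases h0 : a j = 0
    · rw [h0, mul_zero, Nat.cast_zero]
      rcases le_total ((w 1 j : ℤ) - w c j) 0 with h | h
      · rcases h.eq_or_lt with h | h
        · rw [h, zero_mul]
        · exact mul_nonneg_of_nonpos_of_nonpos h.le (by omega)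
      · rcases h.eq_or_lt with h | h
        · rw [← h, zero_mul]
        · exact mul_nonneg h.le (by omega)
    · rw [hc0 j h0]
      have := hle j
      push_cast
      have : (a j : ℤ) ≤ w 1 j := by exact_mod_cast hle j
      nlinarith [(Nat.cast_nonneg (w χ j) : (0 : ℤ) ≤ w χ j)]
  have hrel : ∀ χ ∈ J, (Fintype.card C : ℤ) *
      ∑ j, ((w 1 j : ℤ) - w c j) * ((w χ j : ℤ) - w c j) =
      (if 1 = χ then (Fintype.card C : ℤ) else 0) + (D.relSet c c).card := by
    intro χ hχ
    rw [h_integral 1 c χ c, hJ.card_relSet hJ.one_mem hχ, TwistData.card_relSet_eq_zero,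
      TwistData.card_relSet_eq_zero]
    · push_cast; ring
    · intro h; exact hJ.eig_ne_one 1 hJ.one_mem (h.mpr hc)
    · intro h; exact hJ.eig_ne_one χ hχ (h.mp hc)
  have hfin := hJ.card_mul_card_relSet_le hc
  have hMpos : 1 ≤ Fintype.card D.M := Fintype.card_pos
  have htot : (Fintype.card C : ℤ) * ((∑ χ ∈ J, ∑ j, w χ j * a j : ℕ) : ℤ) ≤
      Fintype.card C + J.card * (D.relSet c c).card := by
    calc (Fintype.card C : ℤ) * ((∑ χ ∈ J, ∑ j, w χ j * a j : ℕ) : ℤ)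
        ≤ ∑ χ ∈ J, (Fintype.card C : ℤ) * ∑ j, ((w 1 j : ℤ) - w c j) * ((w χ j : ℤ) - w c j) := by
          rw [← Finset.mul_sum]
          refine mul_le_mul_of_nonneg_left ?_ hcard.le
          rw [Nat.cast_sum]
          refine Finset.sum_le_sum fun χ hχ => ?_
          rw [Nat.cast_sum]
          exact Finset.sum_le_sum fun j _ => hterm χ hχ j
      _ = Fintype.card C + J.card * (D.relSet c c).card := by
          rw [Finset.sum_congr rfl hrel, Finset.sum_add_distrib, Finset.sum_ite_eq,
            if_pos hJ.one_mem, Finset.sum_const, nsmul_eq_mul]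
  have h1 : (Fintype.card C : ℤ) * ((∑ χ ∈ J, ∑ j, w χ j * a j : ℕ) : ℤ) ≤
      Fintype.card C * Fintype.card D.M := by
    have h2 : ((J.card * (D.relSet c c).card : ℕ) : ℤ) ≤
      ((Fintype.card C * (Fintype.card D.M - 1) : ℕ) : ℤ) := by exact_mod_cast hfin
    rw [Nat.cast_mul, Nat.cast_mul, Nat.cast_sub hMpos] at h2
    push_cast at h2 htot ⊢
    linarith
  exact_mod_cast le_of_mul_le_mul_left h1 hcard

theorem card_mul_coeff_one (Φ : MonoidAlgebra k G ≃ₐ[k] Π i, Matrix (Fin (d i)) (Fin (d i)) k)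
    {f : MonoidAlgebra k G} (hif : incl k C D.i * f = f)
    (hX : ∀ a, powSum k (D.x : G) D.p * a * f = 0)
    {J : Finset D.M} (hJ : D.IsTransversal J)
    (w : D.M → Fin m → ℕ) (hw : ∀ χ : D.M, ∀ j, (Φ (incl k C (D.idp χ)) j).trace = w χ j)
    (a : Fin m → ℕ) (ha : ∀ j, (Φ f j).trace = a j)
    (hdich : ∀ j, Φ (powSum k (D.x : G) D.p) j = 0 →
      Φ (incl k C D.orbSum) j = 0 ∨ Φ (incl k C D.orbSum) j = 1) :
    (Fintype.card G : k) * f.coeff 1 =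
      Fintype.card K * D.i.coeff 1 * ((∑ χ ∈ J, ∑ j, w χ j * a j : ℕ) : k) := by
  classical
  have hX0 : ∀ j, Φ f j ≠ 0 → Φ (powSum k (D.x : G) D.p) j = 0 := by
    intro j hj
    refine Matrix.eq_zero_of_forall_mul_mul_eq_zero hj fun N => ?_
    have h3 := congrFun (congrArg Φ (hX (Φ.symm (Pi.single j N)))) j
    simpa [map_mul] using h3
  have hεf : incl k C D.orbSum * f = f := by
    rw [← hif, ← mul_assoc, ← map_mul, D.orbSum_mul_i]
  have h1 : blockForm (incl k C D.orbSum) f = blockForm 1 f := by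
    rw [← sum_trace_mul_trace Φ, ← sum_trace_mul_trace Φ]
    refine Finset.sum_congr rfl fun j _ => ?_
    by_cases hj : Φ f j = 0
    · rw [hj, Matrix.trace_zero, mul_zero, mul_zero]
    · congr 2
      rw [map_one, Pi.one_apply]
      refine (hdich j (hX0 j hj)).resolve_left fun h => hj ?_
      rw [← hεf, map_mul, Pi.mul_apply, h, zero_mul]
  have h2 : ∀ b : MonoidAlgebra k C, MonoidAlgebra.of k C D.x * b = b →
      blockForm (incl k C b) f = 0 := by
    intro b hb
    have h5 := congrArg (incl k C) hb
    rw [map_mul, incl_of] at h5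
    rw [← sum_trace_mul_trace Φ]
    refine Finset.sum_eq_zero fun j _ => ?_
    by_cases hj : Φ f j = 0
    · rw [hj, Matrix.trace_zero, mul_zero]
    · have h6 := congrFun (congrArg Φ (powSum_mul_of_of_mul h5 D.p)) j
      rw [map_mul, Pi.mul_apply, hX0 j hj, zero_mul, map_smul, Pi.smul_apply, eq_comm,
        smul_eq_zero] at h6
      rw [h6.resolve_left (by exact_mod_cast D.hp.ne_zero), Matrix.trace_zero, zero_mul]
  have h3 : blockForm (incl k C D.orbSum) f =
      ∑ b ∈ D.orb with MonoidAlgebra.of k C D.x * b ≠ b, blockForm (incl k C b) f := by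
    rw [TwistData.orbSum, map_sum, blockForm_sum_left, Finset.sum_filter_of_ne]
    exact fun b _ h h' => h (h2 b h')
  have h4 := hJ.card_smul_sum fun b => blockForm (incl k C b) f
  have h5 : ∀ χ : D.M, blockForm (incl k C (D.blk χ)) f =
      D.i.coeff 1 * (Fintype.card C * ((∑ j, w χ j * a j : ℕ) : k)) := by
    intro χ
    rw [TwistData.blk_eq_smul_conjSum, map_smul, blockForm_smul_left, conjSum, map_sum,
      blockForm_sum_left]
    congr 1
    rw [Finset.sum_congr rfl (g := fun _ => blockForm (incl k C (D.idp χ)) f), Finset.sum_const,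
      Finset.card_univ, nsmul_eq_mul, ← sum_trace_mul_trace Φ]
    · simp only [hw, ha]; push_cast; rfl
    · intro c _
      rw [← blockForm_gconj (incl k C (D.idp χ)) f c]
      congr 1
      rw [gconj_apply, gconj_apply, map_mul, map_mul, incl_of, incl_of]
      simp
  replace h4 : Fintype.card C • blockForm (incl k C D.orbSum) f =
      ∑ γ, ∑ χ ∈ J, blockForm (incl k C (D.α γ (D.blk χ))) f := by
    rw [h3]; convert h4
  rw [h1, blockForm_one_left, nsmul_eq_mul] at h4
  have h6 : ∀ γ : K, ∑ χ ∈ J, blockForm (incl k C (D.α γ (D.blk χ))) f =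
      D.i.coeff 1 * (Fintype.card C * ((∑ χ ∈ J, ∑ j, w χ j * a j : ℕ) : k)) := by
    intro γ
    rw [Nat.cast_sum, Finset.mul_sum, Finset.mul_sum]
    refine Finset.sum_congr rfl fun χ _ => ?_
    rw [← gconj_incl, blockForm_gconj, h5]
  rw [Finset.sum_congr rfl fun γ _ => h6 γ, Finset.sum_const, Finset.card_univ, nsmul_eq_mul] at h4
  have hC0 : (Fintype.card C : k) ≠ 0 := by exact_mod_cast Fintype.card_ne_zero
  apply mul_left_cancel₀ hC0
  rw [h4]; ring

/-- The comparison of the coefficient at the identity of an idempotent of the group algebra with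
that of a primitive idempotent of a local subgroup. -/
theorem exists_card_mul_coeff_one
    (Φ : MonoidAlgebra k G ≃ₐ[k] Π i, Matrix (Fin (d i)) (Fin (d i)) k)
    {f : MonoidAlgebra k G} (hf : f * f = f) (hf0 : f ≠ 0) (hif : incl k C D.i * f = f)
    (hfi : f * incl k C D.i = f) (hX : ∀ a, powSum k (D.x : G) D.p * a * f = 0)
    {c : D.M} (hc : D.eig c = 1)
    (hdich : ∀ j, Φ (powSum k (D.x : G) D.p) j = 0 →
      Φ (incl k C D.orbSum) j = 0 ∨ Φ (incl k C D.orbSum) j = 1) :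
    ∃ T : ℕ, 0 < T ∧ T ≤ Fintype.card D.M ∧
      (Fintype.card G : k) * f.coeff 1 = Fintype.card K * D.i.coeff 1 * T := by
  classical
  obtain ⟨J, hJ⟩ := D.exists_isTransversal (D.eig_one_ne_one hf0 hif hX)
  have hmat : ∀ e : MonoidAlgebra k G, e * e = e → ∀ j, ∃ n : ℕ, (Φ e j).trace = n ∧
      (n = 0 → Φ e j = 0) := fun e he j =>
    Matrix.exists_nat_trace_of_isIdempotentElem (by rw [← Pi.mul_apply, ← map_mul, he])
  have hidp : ∀ χ : D.M, incl k C (D.idp χ) * incl k C (D.idp χ) = incl k C (D.idp χ) := fun χ => by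
    rw [← map_mul, TwistData.idp, ← map_mul, D.idem]
  choose w hw _ using fun χ : D.M => hmat _ (hidp χ)
  choose a ha ha0 using hmat f hf
  have h := D.card_mul_coeff_one Φ hif hX hJ w hw a ha hdich
  refine ⟨_, Nat.pos_of_ne_zero fun h0 => ?_, D.sum_mul_le_card Φ hf hif hfi hX hJ hc w hw a ha, h⟩
  rw [h0, Nat.cast_zero, mul_zero, ← blockForm_one_left, ← sum_trace_mul_trace Φ] at h
  have h1 : ∀ j, a j = 0 := by
    have h2 : ∑ j, d j * a j = 0 := by
      have : ((∑ j, d j * a j : ℕ) : k) = 0 := by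
        rw [← h]; push_cast
        refine Finset.sum_congr rfl fun j _ => ?_
        rw [ha, map_one, Pi.one_apply, Matrix.trace_one, Fintype.card_fin]
      exact_mod_cast this
    intro j
    have h3 := (Finset.sum_eq_zero_iff.mp h2) j (Finset.mem_univ j)
    rcases mul_eq_zero.mp h3 with h4 | h4
    · have : (Φ f j).trace = 0 := by
        have : IsEmpty (Fin (d j)) := by rw [h4]; infer_instance
        simp [Matrix.trace]
      rw [ha] at this
      exact_mod_cast this
    · exact h4
  apply hf0
  apply Φ.injective
  rw [map_zero]
  exact funext fun j => ha0 j (h1 j)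

end LocalTwistData

section RegularTrivial

variable (k : Type*) [Field k] (p : ℕ) (H : Type*) [Group H]

/-- The linear characters which are trivial on the elements of order prime to `p`. -/
def trivialOnRegular : Subgroup (H →* kˣ) where
  carrier := {χ | ∀ h, ¬ p ∣ orderOf h → χ h = 1}
  mul_mem' := fun ha hb h hh => by rw [MonoidHom.mul_apply, ha h hh, hb h hh, mul_one]
  one_mem' := fun _ _ => rfl
  inv_mem' := fun ha h hh => by rw [MonoidHom.inv_apply, ha h hh, inv_one]

variable {k p H} [Finite H]

theorem exists_mul_zpow_regular {p n : ℕ} (hp : p.Prime) {x : H} (hxn : orderOf x = p ^ n)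
    (π : H →* Subgroup.zpowers x) (hπ : ∀ g, π g = 1 ↔ ¬ p ∣ orderOf g) (c : H) :
    ∃ (d : H) (j : ℕ), ¬ p ∣ orderOf d ∧ c = d * x ^ j := by
  have hinj : Function.Injective (π.comp (Subgroup.zpowers x).subtype) := by
    rw [injective_iff_map_eq_one]
    rintro ⟨u, hu⟩ h
    have h1 : ¬ p ∣ orderOf u := (hπ u).mp h
    obtain ⟨j, rfl⟩ := mem_powers_iff_mem_zpowers.mpr hu
    have h2 : orderOf (x ^ j) ∣ p ^ n := hxn ▸ orderOf_pow_dvd j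
    obtain ⟨m, -, hm⟩ := (Nat.dvd_prime_pow hp).mp h2
    have : m = 0 := by
      by_contra h0
      exact h1 (hm ▸ dvd_pow_self p h0)
    rw [this, pow_zero, orderOf_eq_one_iff] at hm
    exact Subtype.ext hm
  have hsurj := Finite.surjective_of_injective hinj
  obtain ⟨⟨u, hu⟩, hc⟩ := hsurj (π c)
  obtain ⟨j, rfl⟩ := mem_powers_iff_mem_zpowers.mpr hu
  refine ⟨c * (x ^ j)⁻¹, j, ?_, by simp⟩
  rw [← hπ, map_mul, map_inv, ← hc]
  simp

theorem finite_trivialOnRegular {p n : ℕ} (hp : p.Prime) {x : H} (hxn : orderOf x = p ^ n)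
    (π : H →* Subgroup.zpowers x) (hπ : ∀ g, π g = 1 ↔ ¬ p ∣ orderOf g) :
    Finite (trivialOnRegular k p H) ∧ Nat.card (trivialOnRegular k p H) ≤ orderOf x := by
  have : NeZero (orderOf x) := ⟨(orderOf_pos x).ne'⟩
  let F : trivialOnRegular k p H → rootsOfUnity (orderOf x) k := fun χ =>
    ⟨(χ : H →* kˣ) x, by rw [mem_rootsOfUnity, ← map_pow, pow_orderOf_eq_one, map_one]⟩
  have hF : Function.Injective F := by
    intro χ ψ h
    refine Subtype.ext (MonoidHom.ext fun c => ?_)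
    obtain ⟨d, j, hd, rfl⟩ := exists_mul_zpow_regular hp hxn π hπ c
    rw [map_mul, map_mul, map_pow, map_pow, χ.2 d hd, ψ.2 d hd, (Subtype.mk.inj h : _ = _)]
  exact ⟨Finite.of_injective F hF,
    (Nat.card_le_card_of_injective F hF).trans (card_rootsOfUnity k (orderOf x))⟩

theorem exists_mem_trivialOnRegular [IsAlgClosed k] [CharZero k] {p : ℕ} {x : H}
    (π : H →* Subgroup.zpowers x) (hπ : ∀ g, π g = 1 ↔ ¬ p ∣ orderOf g) :
    ∃ μ ∈ trivialOnRegular k p H, ∀ h, μ h = 1 ↔ ¬ p ∣ orderOf h := by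
  have : NeZero (orderOf x) := ⟨(orderOf_pos x).ne'⟩
  have h1 : Nat.card (Subgroup.zpowers x) = Nat.card (rootsOfUnity (orderOf x) k) := by
    rw [Nat.card_zpowers]
    obtain ⟨ζ, hζ⟩ := HasEnoughRootsOfUnity.exists_primitiveRoot k (orderOf x)
    rw [hζ.card_rootsOfUnity]
  let e := mulEquivOfCyclicCardEq h1
  have h2 : ∀ h, ((rootsOfUnity (orderOf x) k).subtype.comp (e.toMonoidHom.comp π)) h = 1 ↔
      ¬ p ∣ orderOf h := by
    intro h
    rw [← hπ]
    simp
  exact ⟨_, fun h hh => (h2 h).mpr hh, h2⟩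

end RegularTrivial

section Local

variable {G : Type*} [Group G] [Finite G]

theorem mem_normalizer_zpowers {x g : G} (h : g * x * g⁻¹ ∈ Subgroup.zpowers x) :
    g ∈ Subgroup.normalizer (Subgroup.zpowers x : Set G) := by
  refine Subgroup.mem_normalizer_fintype fun n hn => ?_
  obtain ⟨j, rfl⟩ := Subgroup.mem_zpowers_iff.mp hn
  rw [← conj_zpow]
  exact Subgroup.zpow_mem _ h j

omit [Finite G] in
theorem conj_mem_zpowers {x g : G} (hg : g ∈ Subgroup.normalizer (Subgroup.zpowers x : Set G)) :
    g * x * g⁻¹ ∈ Subgroup.zpowers x :=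
  (Subgroup.mem_normalizer_iff.mp hg x).mp (Subgroup.mem_zpowers x)

theorem IsSylowGen.mem_normalizer_of_conj_mem {p : ℕ} [Fact p.Prime] {x : G} (hx : IsSylowGen p x)
    {u : G} (hu : orderOf u = p) {h g : G} (hh : Commute h u) (hp : p ∣ orderOf h)
    (hg : Commute (g⁻¹ * h * g) u) : g ∈ Subgroup.normalizer (Subgroup.zpowers u : Set G) := by
  have hpp : p.Prime := Fact.out
  have key : ∀ v, orderOf v = p → Commute v u → v ∈ Subgroup.zpowers u := fun v hv hc =>
    hx.mem_zpowers_of_normalizes hu hv (by rw [hc.eq, mul_inv_cancel_right]; exact Subgroup.mem_zpowers u)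
  set v := h ^ (orderOf h / p)
  have hv : orderOf v = p := orderOf_pow_div hpp hp
  have hvu := key v hv (hh.pow_left _)
  have hgv : g⁻¹ * v * g = (g⁻¹ * h * g) ^ (orderOf h / p) := by
    have := conj_pow (i := orderOf h / p) (a := g⁻¹) (b := h)
    rw [inv_inv] at this
    exact this.symm
  have hv' : orderOf (g⁻¹ * v * g) = p := by
    have := orderOf_conj v g⁻¹
    rw [inv_inv] at this
    rw [this, hv]
  have hgvu := key (g⁻¹ * v * g) hv' (hgv ▸ hg.pow_left _)
  have huv : u ∈ Subgroup.zpowers v := mem_zpowers_symm_of_orderOf_eq (hv.trans hu.symm) hvu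
  have hinv : g⁻¹ ∈ Subgroup.normalizer (Subgroup.zpowers u : Set G) := by
    apply mem_normalizer_zpowers
    obtain ⟨j, hj⟩ := Subgroup.mem_zpowers_iff.mp huv
    rw [← hj, ← conj_zpow, hj]
    refine Subgroup.zpow_mem _ ?_ j
    rw [inv_inv]; exact hgvu
  simpa using inv_mem hinv

theorem IsSylowGen.exists_transfer_centralizer {p : ℕ} [Fact p.Prime] {x : G} (hx : IsSylowGen p x)
    {u : G} {m : ℕ} (hu : u = x ^ m) (hup : orderOf u = p) :
    ∃ (hxC : x ∈ Subgroup.centralizer {u})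
      (π : Subgroup.centralizer {u} →* Subgroup.zpowers (⟨x, hxC⟩ : Subgroup.centralizer {u})),
      IsSylowGen p (⟨x, hxC⟩ : Subgroup.centralizer {u}) ∧ ∀ g, π g = 1 ↔ ¬ p ∣ orderOf g := by
  have hxC : x ∈ Subgroup.centralizer {u} := by
    rw [Subgroup.mem_centralizer_singleton_iff, hu]
    exact (Commute.refl x).pow_right _
  have hx' : IsSylowGen p (⟨x, hxC⟩ : Subgroup.centralizer {u}) := hx.subgroup
  obtain ⟨π, -, hπ⟩ := hx'.exists_transfer (by
    intro n j hn
    have h1 : (n : G) * x * (n : G)⁻¹ = x ^ j := congrArg Subtype.val hn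
    obtain ⟨n, hnC⟩ := n
    have h3 : n * u * n⁻¹ = u := by
      rw [mul_inv_eq_iff_eq_mul]
      exact Subgroup.mem_centralizer_singleton_iff.mp hnC
    have h2 : u ^ j = u := by
      refine Eq.trans ?_ h3
      rw [hu, ← conj_pow, h1, ← pow_mul, ← pow_mul, mul_comm]
    have h4 : u ^ j = u ^ 1 := by rw [h2, pow_one]
    rwa [pow_eq_pow_iff_modEq, hup] at h4)
  exact ⟨hxC, π, hx', hπ⟩

variable {k : Type*} [Field k] [IsAlgClosed k] [CharZero k]

omit [Finite G] in
theorem conj_mem_centralizer {u γ c : G}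
    (hγ : γ ∈ Subgroup.normalizer (Subgroup.zpowers u : Set G))
    (hc : c ∈ Subgroup.centralizer {u}) : γ * c * γ⁻¹ ∈ Subgroup.centralizer {u} := by
  have h1 : γ⁻¹ * u * γ ∈ Subgroup.zpowers u := by
    have := (Subgroup.mem_normalizer_iff.mp (inv_mem hγ) u).mp (Subgroup.mem_zpowers u)
    rwa [inv_inv] at this
  obtain ⟨j, hj⟩ := Subgroup.mem_zpowers_iff.mp h1
  have h2 : Commute c (γ⁻¹ * u * γ) := by
    rw [← hj]
    exact (show Commute c u from Subgroup.mem_centralizer_singleton_iff.mp hc).zpow_right j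
  rw [Subgroup.mem_centralizer_singleton_iff]
  have h3 := h2.eq
  calc γ * c * γ⁻¹ * u = γ * (c * (γ⁻¹ * u * γ)) * γ⁻¹ := by group
    _ = u * (γ * c * γ⁻¹) := by rw [h3]; group

/-- The conjugation action of the normalizer of `⟨u⟩` on the centralizer of `u`. -/
def conjCentralizer (u : G) : Subgroup.normalizer (Subgroup.zpowers u : Set G) →*
    MulAut (Subgroup.centralizer {u}) where
  toFun γ :=
    { toFun := fun c => ⟨γ * c * (γ : G)⁻¹, conj_mem_centralizer γ.2 c.2⟩
      invFun := fun c => ⟨(γ : G)⁻¹ * c * γ, by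
        have := conj_mem_centralizer (inv_mem γ.2) c.2
        rwa [inv_inv] at this⟩
      left_inv := fun c => Subtype.ext (by simp [mul_assoc])
      right_inv := fun c => Subtype.ext (by simp [mul_assoc])
      map_mul' := fun c d => Subtype.ext (by simp [mul_assoc]) }
  map_one' := by ext c; simp
  map_mul' γ δ := by ext c; simp [mul_assoc]

theorem IsSylowGen.exists_localTwistData {p : ℕ} [Fact p.Prime] {x : G} (hx : IsSylowGen p x)
    (hpx : p ∣ orderOf x) {u : G} (hu : u = x ^ (orderOf x / p))
    [Fintype (Subgroup.centralizer {u})] [Fintype (Subgroup.normalizer (Subgroup.zpowers u : Set G))]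
    {i : MonoidAlgebra k (Subgroup.centralizer {u})} (hi : i * i = i) (hi0 : i ≠ 0)
    (hprim : ∀ a, ∃ r : k, i * a * i = r • i) :
    ∃ D : LocalTwistData k (Subgroup.centralizer {u})
        (Subgroup.normalizer (Subgroup.zpowers u : Set G)),
      D.i = i ∧ (D.x : G) = u ∧ D.p = p ∧ Nat.card D.M ≤ orderOf x ∧
      (∃ c : D.M, D.eig c = 1) ∧
      (∀ h : Subgroup.centralizer {u}, p ∣ orderOf h → ∃ χ ∈ D.M, χ h ≠ 1) ∧
      ∃ R : Subgroup (Subgroup.centralizer {u}), ∀ h, h ∈ R ↔ ¬ p ∣ orderOf h := by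
  have hpp : p.Prime := Fact.out
  have hup : orderOf u = p := hu ▸ orderOf_pow_div hpp hpx
  have huC : u ∈ Subgroup.centralizer {u} := Subgroup.mem_centralizer_singleton_iff.mpr rfl
  obtain ⟨hxC, π, hx', hπ⟩ := hx.exists_transfer_centralizer hu hup
  have hxo : orderOf (⟨x, hxC⟩ : Subgroup.centralizer {u}) = p ^ _ := hx'
  have hxo' : orderOf (⟨x, hxC⟩ : Subgroup.centralizer {u}) = orderOf x := Subgroup.orderOf_mk x hxC
  obtain ⟨hfin, hcard⟩ := finite_trivialOnRegular (k := k) hpp hxo π hπ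
  obtain ⟨μ, hμM, hμ⟩ := exists_mem_trivialOnRegular (k := k) π hπ
  have hsing : ∀ χ ∈ trivialOnRegular k p (Subgroup.centralizer {u}), ∀ h, χ h ≠ 1 →
      p ∣ orderOf h := fun χ hχ h hh => by
    by_contra h1
    exact hh (hχ h h1)
  have huo : orderOf (⟨u, huC⟩ : Subgroup.centralizer {u}) = p :=
    (Subgroup.orderOf_mk u huC).trans hup
  let D : LocalTwistData k (Subgroup.centralizer {u})
      (Subgroup.normalizer (Subgroup.zpowers u : Set G)) :=
    { act := conjCentralizer u
      inc := Subgroup.inclusion (fun c hc => mem_normalizer_zpowers (by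
        rw [Subgroup.mem_centralizer_singleton_iff.mp hc, mul_inv_cancel_right]
        exact Subgroup.mem_zpowers u))
      inc_injective := Subgroup.inclusion_injective _
      act_inc := fun c => by ext d; rfl
      M := trivialOnRegular k p (Subgroup.centralizer {u})
      finite_M := hfin
      comp_mem := fun γ χ hχ h hh => hχ _ (by
        have := MulEquiv.orderOf_eq (conjCentralizer u γ).symm h
        change ¬ p ∣ orderOf ((conjCentralizer u γ).symm h)
        rwa [this])
      x := ⟨u, huC⟩
      x_comm := fun h => Subtype.ext (Subgroup.mem_centralizer_singleton_iff.mp h.2).symm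
      p := p
      hp := hpp
      x_pow := by rw [← orderOf_dvd_iff_pow_eq_one, huo]
      exists_pow := fun γ => by
        obtain ⟨e, he⟩ := mem_powers_iff_mem_zpowers.mpr (conj_mem_zpowers γ.2)
        exact ⟨e, Subtype.ext he.symm⟩
      mem_range := fun γ hγ => by
        have h1 : (γ : G) * u * (γ : G)⁻¹ = u := congrArg Subtype.val hγ
        rw [mul_inv_eq_iff_eq_mul] at h1
        exact ⟨⟨γ, Subgroup.mem_centralizer_singleton_iff.mpr h1⟩, rfl⟩
      i := i
      idem := hi
      ne_zero := hi0
      prim := hprim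
      coe_act := fun γ c => rfl
      mem_of_conj_mem := fun χ hχ h hh g hg =>
        hx.mem_normalizer_of_conj_mem hup
          (Subgroup.mem_centralizer_singleton_iff.mp h.2)
          (by rw [Subgroup.orderOf_coe]; exact hsing χ hχ h hh)
          (Subgroup.mem_centralizer_singleton_iff.mp hg) }
  refine ⟨D, rfl, rfl, rfl, hxo' ▸ hcard, ?_, fun h hh => ⟨μ, hμM, fun h1 => (hμ h).mp h1 hh⟩,
    π.ker, hπ⟩
  have hν : D.exists_eig.choose ^ p = 1 := by
    have := D.eig_pow 1
    rwa [TwistData.eig, MonoidHom.one_apply, inv_one, Units.val_one, mul_one] at this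
  have hprimroot : IsPrimitiveRoot (μ ⟨u, huC⟩) p := by
    rw [IsPrimitiveRoot.iff_orderOf]
    refine orderOf_eq_prime ?_ ?_
    · rw [← map_pow, ← huo, pow_orderOf_eq_one, map_one]
    · rw [Ne, hμ, huo]; simp
  have hne : NeZero p := ⟨hpp.ne_zero⟩
  obtain ⟨j, -, hj⟩ := (IsPrimitiveRoot.coe_units_iff.mpr hprimroot).eq_pow_of_pow_eq_one hν
  refine ⟨⟨μ ^ j, pow_mem hμM j⟩, ?_⟩
  rw [TwistData.eig, ← hj]
  change _ * (((μ ⟨u, huC⟩ ^ j)⁻¹ : kˣ) : k) = 1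
  rw [← Units.val_pow_eq_pow_val, Units.mul_inv]

end Local

section MatrixDichotomy

variable {k : Type*} [Field k] (A : ValuationSubring k) {G : Type*} [Group G] [Finite G]

theorem MonoidAlgebra.map_mem_range_lift {d : ℕ}
    (Θ : MonoidAlgebra k G →ₐ[k] Matrix (Fin d) (Fin d) k) {e : MonoidAlgebra k G}
    (he : ∀ g, e.coeff g ∈ A) :
    Θ e ∈ (MonoidAlgebra.lift A (Matrix (Fin d) (Fin d) k) G
      ((Θ : MonoidAlgebra k G →* Matrix (Fin d) (Fin d) k).comp (MonoidAlgebra.of k G))).range := by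
  cases nonempty_fintype G
  have h1 : e = ∑ g, e.coeff g • MonoidAlgebra.of k G g := by
    conv_lhs => rw [← MonoidAlgebra.sum_coeff_single e]
    rw [Finsupp.sum_fintype _ _ (fun g => by simp)]
    refine Finset.sum_congr rfl fun g _ => ?_
    simp
  rw [h1, map_sum]
  refine Subalgebra.sum_mem _ fun g _ => ?_
  have h2 : Θ (e.coeff g • MonoidAlgebra.of k G g) =
      (⟨e.coeff g, he g⟩ : A) • Θ (MonoidAlgebra.of k G g) := by
    rw [map_smul]; rfl
  rw [h2]
  exact Subalgebra.smul_mem _ ((AlgHom.mem_range _).mpr ⟨MonoidAlgebra.of A G g, by simp⟩) _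

theorem eq_zero_or_eq_one_of_matrix {p : ℕ} (hp : p.Prime) (hodd : Odd p)
    (hpA : (p : A) ∈ IsLocalRing.maximalIdeal A) {d : ℕ}
    (Θ : MonoidAlgebra k G →ₐ[k] Matrix (Fin d) (Fin d) k) (hΘ : Function.Surjective Θ)
    {x : G} (hx : x ^ p = 1) (hsum : Θ (powSum k x p) = 0) {K : Subgroup G} (hxK : x ∈ K)
    (hK : ∀ g, g⁻¹ * x * g ∈ K → g ∈ K) {e : MonoidAlgebra k G} (he : e * e = e)
    (heA : ∀ g, e.coeff g ∈ A) (hc : ∀ g ∈ K, Commute (MonoidAlgebra.of k G g) e) :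
    Θ e = 0 ∨ Θ e = 1 := by
  set ψ := MonoidAlgebra.lift A (Matrix (Fin d) (Fin d) k) G
    ((Θ : MonoidAlgebra k G →* Matrix (Fin d) (Fin d) k).comp (MonoidAlgebra.of k G)) with hψ
  have hfin0 : Module.Finite A (MonoidAlgebra A G) :=
    Module.Finite.equiv (MonoidAlgebra.coeffLinearEquiv A).symm
  have hfin : Module.Finite A ψ.range :=
    Module.Finite.of_surjective ψ.rangeRestrict.toLinearMap ψ.rangeRestrict_surjective
  let σ : G →* ψ.range := (ψ.rangeRestrict : MonoidAlgebra A G →* ψ.range).comp (MonoidAlgebra.of A G)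
  have hσ : ∀ g, (σ g : Matrix (Fin d) (Fin d) k) = Θ (MonoidAlgebra.of k G g) := by
    intro g
    change ψ (MonoidAlgebra.of A G g) = _
    simp [hψ]
  have hmain := eq_zero_or_eq_one_of_central (A := A) hp hodd hpA σ hx ?_ hxK hK
    (e := ⟨Θ e, MonoidAlgebra.map_mem_range_lift A Θ heA⟩) ?_ ?_ ?_
  · rcases hmain with h | h
    · exact Or.inl (congrArg Subtype.val h)
    · exact Or.inr (congrArg Subtype.val h)
  · apply Subtype.ext
    rw [powSum, map_sum] at hsum
    rw [AddSubmonoidClass.coe_finsetSum, Finset.sum_congr rfl fun j _ => hσ (x ^ j)]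
    exact hsum
  · apply Subtype.ext
    simp [← map_mul, he]
  · intro g hg
    apply Subtype.ext
    have := (hc g hg).map Θ
    simpa [hσ] using this.eq
  · rintro ⟨z, hz⟩ hcz
    have hz1 : ∀ N, Commute N z := by
      intro N
      obtain ⟨a, rfl⟩ := hΘ N
      induction a using MonoidAlgebra.induction_linear with
      | zero => simp
      | add a b ha hb => rw [map_add]; exact ha.add_left hb
      | single g r =>
        have h1 : MonoidAlgebra.single g r = r • MonoidAlgebra.of k G g := by simp
        rw [h1, map_smul]
        have h2 := congrArg Subtype.val (hcz g).eq
        refine Commute.smul_left ?_ r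
        rw [← hσ]
        exact h2
    obtain ⟨c, rfl⟩ := Matrix.mem_range_scalar_of_commute_single (fun i j _ => hz1 _)
    rcases isEmpty_or_nonempty (Fin d) with hd | hd
    · exact ⟨0, Subtype.ext (Subsingleton.elim _ _)⟩
    have h_integral : IsIntegral A (algebraMap k (Matrix (Fin d) (Fin d) k) c) := by
      have h1 : IsIntegral A (⟨Matrix.scalar (Fin d) c, hz⟩ : ψ.range) := IsIntegral.of_finite A _
      exact h1.map ψ.range.val
    have h_integral' : IsIntegral A c :=
      (isIntegral_algebraMap_iff (algebraMap k (Matrix (Fin d) (Fin d) k)).injective).mp h_integral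
    obtain ⟨l, hl⟩ := IsIntegrallyClosed.isIntegral_iff.mp h_integral'
    refine ⟨l, Subtype.ext ?_⟩
    subst hl
    change Matrix.scalar (Fin d) (algebraMap A k l) = l • (1 : Matrix (Fin d) (Fin d) k)
    ext i j
    simp [Matrix.scalar_apply, Matrix.diagonal_apply, Matrix.one_apply, Algebra.smul_def]

end MatrixDichotomy

section ValuationSubring

variable {k : Type*} [Field k] (A : ValuationSubring k)

theorem ValuationSubring.mem_of_isIntegral_int {z : k} (hz : IsIntegral ℤ z) : z ∈ A := by
  have h1 : IsIntegral A z := hz.tower_top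
  obtain ⟨l, hl⟩ := IsIntegrallyClosed.isIntegral_iff.mp h1
  rw [← hl]
  exact l.2

theorem isUnit_natCast_of_not_dvd {R : Type*} [CommRing R] [IsLocalRing R] {p n : ℕ} (hp : p.Prime)
    (hpA : (p : R) ∈ IsLocalRing.maximalIdeal R) (hn : ¬ p ∣ n) : IsUnit (n : R) := by
  by_contra h
  have h1 : (n : R) ∈ IsLocalRing.maximalIdeal R := h
  have h2 : IsCoprime (p : ℤ) (n : ℤ) :=
    Nat.isCoprime_iff_coprime.mpr ((Nat.Prime.coprime_iff_not_dvd hp).mpr hn)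
  obtain ⟨a, b, hab⟩ := h2
  have h3 := congrArg (Int.cast : ℤ → R) hab
  push_cast at h3
  refine (Ideal.ne_top_iff_one _).mp (IsLocalRing.maximalIdeal.isMaximal R).ne_top ?_
  rw [← h3]
  exact add_mem (Ideal.mul_mem_left _ _ hpA) (Ideal.mul_mem_left _ _ h1)

end ValuationSubring

namespace LocalTwistData

variable {k : Type*} [Field k] [IsAlgClosed k] {G : Type*} [Group G] {C K : Subgroup G}
  [Fintype C] [Fintype K] (D : LocalTwistData k C K) [Fintype D.M]

theorem orbSum_coeff_mem [CharZero k] (A : ValuationSubring k) (hpA : (D.p : A) ∈ IsLocalRing.maximalIdeal A)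
    (R : Subgroup C) (hR : ∀ h, h ∈ R ↔ ¬ D.p ∣ orderOf h)
    (hM : ∀ h : C, D.p ∣ orderOf h → ∃ χ ∈ D.M, χ h ≠ 1) (h : C) : D.orbSum.coeff h ∈ A := by
  classical
  have h1 : IsIntegral ℤ ((Fintype.card R : k) * D.orbSum.coeff h) := by
    refine isIntegral_card_subgroup_mul_coeff R D.orbSum_idem ?_ ?_ h
    · intro a
      rw [TwistData.orbSum, Finset.mul_sum, Finset.sum_mul]
      exact Finset.sum_congr rfl fun b hb => (D.isBlock_of_mem_orb hb).central a
    · intro g hg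
      rw [hR, not_not] at hg
      obtain ⟨χ, hχ, hne⟩ := hM g hg
      exact D.orbSum_coeff_eq_zero ⟨χ, hχ⟩ hne
  have h2 : ¬ D.p ∣ Fintype.card R := by
    intro hdvd
    have : Fact D.p.Prime := ⟨D.hp⟩
    obtain ⟨r, hr⟩ := exists_prime_orderOf_dvd_card D.p hdvd
    refine (hR r).mp r.2 ?_
    rw [Subgroup.orderOf_coe, hr]
  obtain ⟨u, hu⟩ := isUnit_natCast_of_not_dvd D.hp hpA h2
  have h3 := A.mem_of_isIntegral_int h1
  have h4 : D.orbSum.coeff h = ((u⁻¹ : Aˣ) : A) * ((Fintype.card R : k) * D.orbSum.coeff h) := by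
    have h5 : (((u⁻¹ : Aˣ) : A) : k) * (Fintype.card R : k) = 1 := by
      have := congrArg (Subtype.val) u.inv_mul
      rw [hu] at this
      simpa using this
    rw [← mul_assoc, h5, one_mul]
  rw [h4]
  exact A.mul_mem _ _ (SetLike.coe_mem _) h3

theorem map_orbSum_eq_zero_or_eq_one [CharZero k] [Finite G] (A : ValuationSubring k)
    (hpA : (D.p : A) ∈ IsLocalRing.maximalIdeal A) (hodd : Odd D.p)
    (R : Subgroup C) (hR : ∀ h, h ∈ R ↔ ¬ D.p ∣ orderOf h)
    (hM : ∀ h : C, D.p ∣ orderOf h → ∃ χ ∈ D.M, χ h ≠ 1)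
    (hxK : (D.x : G) ∈ K) (hK : ∀ g : G, g⁻¹ * D.x * g ∈ K → g ∈ K) {d : ℕ}
    (Θ : MonoidAlgebra k G →ₐ[k] Matrix (Fin d) (Fin d) k) (hΘ : Function.Surjective Θ)
    (hsum : Θ (powSum k (D.x : G) D.p) = 0) :
    Θ (incl k C D.orbSum) = 0 ∨ Θ (incl k C D.orbSum) = 1 := by
  refine eq_zero_or_eq_one_of_matrix A D.hp hodd hpA Θ hΘ ?_ hsum hxK hK ?_ ?_ ?_
  · have := congrArg (Subtype.val) D.x_pow
    simpa using this
  · rw [← map_mul, D.orbSum_idem]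
  · intro g
    by_cases hg : g ∈ C
    · have := incl_coeff C D.orbSum ⟨g, hg⟩
      rw [this]
      exact D.orbSum_coeff_mem A hpA R hR hM _
    · rw [incl_coeff_of_notMem C _ hg]
      exact A.zero_mem
  · intro g hg
    have h1 := D.gconj_incl ⟨g, hg⟩ D.orbSum
    rw [D.α_orbSum, gconj_apply] at h1
    have h2 : MonoidAlgebra.of k G g⁻¹ * MonoidAlgebra.of k G g = 1 := by
      rw [← map_mul, inv_mul_cancel, map_one]
    have h3 := congrArg (· * MonoidAlgebra.of k G g) h1
    simp only [mul_assoc, h2, mul_one] at h3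
    exact h3

end LocalTwistData

section BaseChange

variable {R k : Type*} [CommRing R] [Field k] {G : Type*} [Group G]

theorem mapRingHom_of (φ : R →+* k) (g : G) :
    MonoidAlgebra.mapRingHom G φ (MonoidAlgebra.of R G g) = MonoidAlgebra.of k G g := by
  simp

theorem mapRingHom_smul (φ : R →+* k) (r : R) (a : MonoidAlgebra R G) :
    MonoidAlgebra.mapRingHom G φ (r • a) = φ r • MonoidAlgebra.mapRingHom G φ a := by
  ext g
  simp [MonoidAlgebra.coeff_mapRingHom]

theorem mapRingHom_gconj (φ : R →+* k) (g : G) (a : MonoidAlgebra R G) :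
    MonoidAlgebra.mapRingHom G φ (gconj g a) = gconj g (MonoidAlgebra.mapRingHom G φ a) := by
  rw [gconj_apply, gconj_apply, map_mul, map_mul, mapRingHom_of, mapRingHom_of]

theorem mapRingHom_sum_gconj [Fintype G] (φ : R →+* k) (a : MonoidAlgebra R G) :
    MonoidAlgebra.mapRingHom G φ (∑ g, gconj g a) = conjSum (MonoidAlgebra.mapRingHom G φ a) := by
  simp only [conjSum, map_sum, mapRingHom_gconj]

theorem mapRingHom_incl (φ : R →+* k) (C : Subgroup G) (a : MonoidAlgebra R C) :
    MonoidAlgebra.mapRingHom G φ (incl R C a) = incl k C (MonoidAlgebra.mapRingHom C φ a) := by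
  induction a using MonoidAlgebra.induction_linear with
  | zero => simp
  | add a b ha hb => simp only [map_add, ha, hb]
  | single c r => simp

theorem single_eq_smul_mapRingHom (φ : R →+* k) (g : G) (r : k) :
    MonoidAlgebra.single g r = r • MonoidAlgebra.mapRingHom G φ (MonoidAlgebra.of R G g) := by
  simp

theorem exists_mapRingHom_mul_mul (φ : R →+* k) {i : MonoidAlgebra R G}
    (hprim : ∀ a, ∃ r : R, i * a * i = r • i) (a : MonoidAlgebra k G) :
    ∃ r : k, MonoidAlgebra.mapRingHom G φ i * a * MonoidAlgebra.mapRingHom G φ i =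
      r • MonoidAlgebra.mapRingHom G φ i := by
  induction a using MonoidAlgebra.induction_linear with
  | zero => exact ⟨0, by simp⟩
  | add a b ha hb =>
    obtain ⟨r, hr⟩ := ha
    obtain ⟨s, hs⟩ := hb
    exact ⟨r + s, by rw [mul_add, add_mul, hr, hs, add_smul]⟩
  | single g s =>
    obtain ⟨r, hr⟩ := hprim (MonoidAlgebra.of R G g)
    refine ⟨s * φ r, ?_⟩
    rw [single_eq_smul_mapRingHom φ, mul_smul_comm, smul_mul_assoc, ← map_mul, ← map_mul, hr,
      mapRingHom_smul, smul_smul]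

theorem mapRingHom_mul_mul_eq_zero (φ : R →+* k) {u f : MonoidAlgebra R G}
    (h : ∀ a, u * a * f = 0) (a : MonoidAlgebra k G) :
    MonoidAlgebra.mapRingHom G φ u * a * MonoidAlgebra.mapRingHom G φ f = 0 := by
  induction a using MonoidAlgebra.induction_linear with
  | zero => simp
  | add a b ha hb => rw [mul_add, add_mul, ha, hb, add_zero]
  | single g s =>
    rw [single_eq_smul_mapRingHom φ, mul_smul_comm, smul_mul_assoc, ← map_mul, ← map_mul, h,
      map_zero, smul_zero]

theorem pow_dvd_of_natCast_eq_mul [IsLocalRing R] [IsDomain R] [CharZero R] {q : ℕ} (hq : q.Prime)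
    (hqR : (q : R) ∈ IsLocalRing.maximalIdeal R) (a T : ℕ) (z : R) (h : (T : R) = q ^ a * z) :
    q ^ a ∣ T := by
  induction a generalizing T with
  | zero => simp
  | succ a ih =>
    have h1 : q ∣ T := by
      by_contra hT
      have h2 : (T : R) ∈ IsLocalRing.maximalIdeal R := by
        rw [h, pow_succ', mul_assoc]
        exact Ideal.mul_mem_right _ _ hqR
      exact h2 (isUnit_natCast_of_not_dvd hq hqR hT)
    obtain ⟨T', rfl⟩ := h1
    rw [pow_succ']
    refine Nat.mul_dvd_mul_left q (ih T' ?_)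
    refine mul_left_cancel₀ (Nat.cast_ne_zero.mpr hq.ne_zero : (q : R) ≠ 0) ?_
    rw [← mul_assoc, ← pow_succ', ← h, Nat.cast_mul]

theorem exists_mul_coeff_one_eq_one [CharZero k] [IsAlgClosed k] {H : Type*} [Group H]
    [Fintype H] (φ : R →+* k)
    {i : MonoidAlgebra R H} (hi : i * i = i)
    (hiu : ∃ c, IsUnit (i.coeff c)) (hprim : ∀ a, ∃ r : R, i * a * i = r • i) :
    ∃ l : R, φ l * φ (i.coeff 1) = 1 := by
  obtain ⟨c, u, hu⟩ := hiu
  have hR : Nontrivial R := φ.domain_nontrivial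
  have hi0 : MonoidAlgebra.mapRingHom H φ i ≠ 0 := by
    intro h
    have h1 := congrArg (fun a => a.coeff c) h
    simp only [MonoidAlgebra.coeff_mapRingHom, ← hu] at h1
    exact (u.isUnit.map φ).ne_zero h1
  obtain ⟨l, hl, hl1⟩ := exists_mul_conjSum_eq (i := MonoidAlgebra.mapRingHom H φ i)
    (by rw [← map_mul, hi]) hi0 (exists_mapRingHom_mul_mul φ hprim)
  have h2 := congrArg (fun a => a.coeff c) hl
  rw [← mapRingHom_sum_gconj, ← map_mul] at h2
  simp only [MonoidAlgebra.coeff_mapRingHom, MonoidAlgebra.coeff_smul, Finsupp.smul_apply,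
    smul_eq_mul] at h2
  rw [← hu] at h2
  refine ⟨(i * ∑ g, gconj g i).coeff c * ((u⁻¹ : Rˣ) : R), ?_⟩
  have h4 : φ u * φ ((u⁻¹ : Rˣ) : R) = 1 := by rw [← map_mul, Units.mul_inv, map_one]
  rw [map_mul, h2, mul_assoc l, h4, mul_one, ← hl1, MonoidAlgebra.coeff_mapRingHom]

end BaseChange

section Nilpotence

variable {G : Type*} [Group G] [Finite G]

theorem LocalTwistData.pow_factorization_le [Fintype G] {k : Type*} [Field k] [IsAlgClosed k] [CharZero k]
    {C K : Subgroup G} [Fintype C] [Fintype K] (D : LocalTwistData k C K) [Fintype D.M]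
    {q : ℕ} (hq : q.Prime) (A B : ValuationSubring k)
    (hqA : (q : A) ∈ IsLocalRing.maximalIdeal A) (hpB : (D.p : B) ∈ IsLocalRing.maximalIdeal B)
    (hodd : Odd D.p) (R : Subgroup C) (hR : ∀ h, h ∈ R ↔ ¬ D.p ∣ orderOf h)
    (hM : ∀ h : C, D.p ∣ orderOf h → ∃ χ ∈ D.M, χ h ≠ 1)
    (hxK : (D.x : G) ∈ K) (hK : ∀ g : G, g⁻¹ * D.x * g ∈ K → g ∈ K)
    (hqK : ¬ q ∣ Fintype.card K) {c : D.M} (hc : D.eig c = 1)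
    {i : MonoidAlgebra A C} {f : MonoidAlgebra A G}
    (hDi : D.i = MonoidAlgebra.mapRingHom C (algebraMap A k) i) (hi : i * i = i)
    (hiu : ∃ c, IsUnit (i.coeff c)) (hprim : ∀ a, ∃ r : A, i * a * i = r • i)
    (hf : f * f = f) (hf0 : f ≠ 0) (hif : incl A C i * f = f) (hfi : f * incl A C i = f)
    (hX : ∀ a, powSum A (D.x : G) D.p * a * f = 0) :
    q ^ (Fintype.card G).factorization q ≤ Fintype.card D.M := by
  set φ := algebraMap A k
  have hφ : Function.Injective φ := FaithfulSMul.algebraMap_injective A k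
  have hne : NeZero (Nat.card G : k) := ⟨Nat.cast_ne_zero.mpr Nat.card_pos.ne'⟩
  obtain ⟨m, d, -, ⟨Φ⟩⟩ := IsSemisimpleRing.exists_algEquiv_pi_matrix_of_isAlgClosed
    (F := k) (R := MonoidAlgebra k G)
  have hf0' : MonoidAlgebra.mapRingHom G φ f ≠ 0 := by
    intro h
    refine hf0 (MonoidAlgebra.ext (Finsupp.ext fun g => hφ ?_))
    have h1 := congrArg (fun a => a.coeff g) h
    simpa only [MonoidAlgebra.coeff_mapRingHom, MonoidAlgebra.coeff_zero, Finsupp.coe_zero,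
      Pi.zero_apply, map_zero] using h1
  obtain ⟨T, hT0, hTM, hT⟩ := D.exists_card_mul_coeff_one Φ
    (f := MonoidAlgebra.mapRingHom G φ f) (by rw [← map_mul, hf]) hf0'
    (by rw [hDi, ← mapRingHom_incl, ← map_mul, hif])
    (by rw [hDi, ← mapRingHom_incl, ← map_mul, hfi])
    (by
      have := mapRingHom_mul_mul_eq_zero φ hX
      rwa [mapRingHom_powSum] at this) hc
    (fun j hj => D.map_orbSum_eq_zero_or_eq_one B hpB hodd R hR hM hxK hK
      ((Pi.evalAlgHom k (fun j => Matrix (Fin (d j)) (Fin (d j)) k) j).comp Φ.toAlgHom)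
      ((Function.surjective_eval j).comp Φ.surjective) hj)
  obtain ⟨l, hl⟩ := exists_mul_coeff_one_eq_one φ hi hiu hprim
  obtain ⟨v, hv⟩ := isUnit_natCast_of_not_dvd hq hqA hqK
  rw [hDi, MonoidAlgebra.coeff_mapRingHom, MonoidAlgebra.coeff_mapRingHom] at hT
  have h1 : (Fintype.card G : A) * f.coeff 1 * l = Fintype.card K * T := by
    apply hφ
    simp only [map_mul, map_natCast]
    linear_combination φ l * hT + (Fintype.card K : k) * T * hl
  refine (Nat.le_of_dvd hT0 ?_).trans hTM
  obtain ⟨s, hs⟩ := Nat.ordProj_dvd (Fintype.card G) q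
  refine pow_dvd_of_natCast_eq_mul hq hqA _ T (((v⁻¹ : Aˣ) : A) * (s * f.coeff 1 * l)) ?_
  have h2 : (Fintype.card G : A) = (q : A) ^ (Fintype.card G).factorization q * s := by
    conv_lhs => rw [hs]
    push_cast; rfl
  have h3 : ((v⁻¹ : Aˣ) : A) * (Fintype.card K : A) = 1 := by rw [← hv, Units.inv_mul]
  rw [h2] at h1
  linear_combination (-(T : A)) * h3 + ((v⁻¹ : Aˣ) : A) * (-h1)

/-- A left annihilation condition over `𝔽_q` forces nilpotence. -/
theorem IsSylowGen.isNilpotent_of_powSum_mul_eq_zero {p q : ℕ} [Fact p.Prime] [Fact q.Prime]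
    (hpq : p ≠ q) (hodd : Odd p) {x : G} (hx : IsSylowGen p x) (hpx : p ∣ orderOf x) {u : G}
    (hu : u = x ^ (orderOf x / p))
    (hK : ¬ q ∣ Nat.card (Subgroup.normalizer (Subgroup.zpowers u : Set G)))
    (hlt : orderOf x < q ^ (Nat.card G).factorization q) {w : MonoidAlgebra (ZMod q) G}
    (hw : ∀ g, powSum (ZMod q) u p * MonoidAlgebra.of (ZMod q) G g * w = 0) : IsNilpotent w := by
  classical
  by_contra hwn
  have hpp : p.Prime := Fact.out
  have hqp : q.Prime := Fact.out
  have hup : orderOf u = p := hu ▸ orderOf_pow_div hpp hpx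
  obtain ⟨A, hqA⟩ := exists_valuationSubring (AlgebraicClosure ℚ) q
  obtain ⟨B, hpB⟩ := exists_valuationSubring (AlgebraicClosure ℚ) p
  have hCK : Subgroup.centralizer {u} ≤ Subgroup.normalizer (Subgroup.zpowers u : Set G) :=
    fun c hc => mem_normalizer_zpowers (by
      rw [Subgroup.mem_centralizer_singleton_iff.mp hc, mul_inv_cancel_right]
      exact Subgroup.mem_zpowers u)
  have hpA : IsUnit (p : A) := isUnit_natCast_of_not_dvd hqp hqA fun h =>
    hpq ((Nat.prime_dvd_prime_iff_eq hqp hpp).mp h).symm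
  obtain ⟨i, f, hi, hiu, hprim, hf, hf0, hif, hfi, hX⟩ := exists_primitive_and_idempotent A hqA
    (Subgroup.centralizer {u}) (fun h => hK (h.trans (Subgroup.card_dvd_of_le hCK)))
    (by rw [← hup, pow_orderOf_eq_one]) hpA hwn hw
  cases nonempty_fintype G
  set φ := algebraMap A (AlgebraicClosure ℚ)
  have hφ : Function.Injective φ := FaithfulSMul.algebraMap_injective A _
  obtain ⟨D, hDi, hDx, hDp, hDM, ⟨c, hc⟩, hM, R, hR⟩ := hx.exists_localTwistData
    (k := AlgebraicClosure ℚ) hpx hu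
    (i := MonoidAlgebra.mapRingHom (Subgroup.centralizer {u}) φ i)
    (by rw [← map_mul, hi])
    (by
      obtain ⟨c, hc⟩ := hiu
      intro h
      have h1 := congrArg (fun a => a.coeff c) h
      simp only [MonoidAlgebra.coeff_mapRingHom] at h1
      exact (hc.map φ).ne_zero h1)
    (exists_mapRingHom_mul_mul φ hprim)
  have := D.finite_M
  let _ : Fintype D.M := Fintype.ofFinite D.M
  have h := D.pow_factorization_le hqp A B hqA (by rw [hDp]; exact hpB) (by rw [hDp]; exact hodd) R
    (by rw [hDp]; exact hR) (by rw [hDp]; exact hM)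
    (by rw [hDx]; exact Subgroup.le_normalizer (Subgroup.mem_zpowers u))
    (by
      rw [hDx]
      intro g hg
      have h1 : g⁻¹ * u * g ∈ Subgroup.zpowers u :=
        hx.mem_zpowers_of_normalizes hup (by
          have := orderOf_conj u g⁻¹
          rw [inv_inv] at this
          rw [this, hup]) (conj_mem_zpowers hg)
      have h2 := mem_normalizer_zpowers (g := g⁻¹) (by rwa [inv_inv])
      simpa using inv_mem h2)
    (by rwa [← Nat.card_eq_fintype_card]) hc hDi hi hiu hprim hf hf0 hif hfi
    (by rw [hDx, hDp]; exact hX)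
  rw [← Nat.card_eq_fintype_card, ← Nat.card_eq_fintype_card] at h
  exact absurd (hlt.trans_le (h.trans hDM)) (lt_irrefl _)

end Nilpotence

section SylowTrace

variable {G A : Type*} [Group G] [Finite G] [Ring A]

theorem IsSylowGen.not_dvd_index {q : ℕ} [Fact q.Prime] {y : G} (hy : IsSylowGen q y) :
    ¬ q ∣ (Subgroup.zpowers y).index := by
  obtain ⟨Y, hY⟩ := hy.exists_sylow
  rw [← hY]
  exact Y.not_dvd_index

theorem IsSylowGen.exists_sum_conj_of_conjTrace [Fintype G] {q : ℕ} [Fact q.Prime]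
    [Algebra (ZMod q) A] (σ : G →* A) {y : G} (hy : IsSylowGen q y) (hqy : q ∣ orderOf y) {π φ : A}
    (hπ : π * π = π) (hc : ∀ g, Commute (σ g) π)
    (h : π = conjTrace σ (y ^ (orderOf y / q)) q φ) : ∃ φ', π = ∑ g, σ g * φ' * σ g⁻¹ := by
  have hq : q.Prime := Fact.out
  have h0 := hy
  rw [IsSylowGen] at h0
  obtain ⟨b, hb⟩ : ∃ b, orderOf y = q ^ (b + 1) := by
    rcases hn : (Nat.card G).factorization q with _ | b
    · rw [hn, pow_zero] at h0
      rw [h0] at hqy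
      exact absurd (Nat.dvd_one.mp hqy) hq.ne_one
    · exact ⟨b, by rw [h0, hn]⟩
  rw [hb, pow_succ, Nat.mul_div_cancel _ hq.pos] at h
  obtain ⟨φ', h'⟩ := idempotent_eq_conjTrace σ q b y π φ hπ (hc y) h
  rw [← hb] at h'
  exact _root_.exists_sum_conj_of_conjTrace q σ y π φ' hc h' hy.not_dvd_index

theorem conjTrace_congr (σ : G →* A) {q : ℕ} {y z : G} (hy : orderOf y = q) (hz : orderOf z = q)
    (h : z ∈ Subgroup.zpowers y) (a : A) : conjTrace σ z q a = conjTrace σ y q a := by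
  classical
  cases nonempty_fintype G
  have h1 : Subgroup.zpowers z = Subgroup.zpowers y :=
    le_antisymm (by simpa using h)
      (by simpa using mem_zpowers_symm_of_orderOf_eq (hz.trans hy.symm) h)
  have h2 := sum_zpowers_eq_sum_range z (fun g => σ g * a * σ g⁻¹)
  have h3 := sum_zpowers_eq_sum_range y (fun g => σ g * a * σ g⁻¹)
  rw [hz] at h2
  rw [hy] at h3
  rw [conjTrace, conjTrace, ← h2, ← h3]
  refine Fintype.sum_equiv (Equiv.setCongr (congrArg (fun H : Subgroup G => (H : Set G)) h1)) _ _ ?_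
  intro l
  rfl

end SylowTrace

section FixedPointFree

variable {G : Type*} [Group G] [Finite G] {p q : ℕ} [Fact p.Prime] [Fact q.Prime]
  {V : Type*} [AddCommGroup V] [Module (ZMod q) V] (ρ : Representation (ZMod q) G V)

theorem natCast_zmod_ne_zero (hpq : p ≠ q) : ((p : ℕ) : ZMod q) ≠ 0 := by
  rw [Ne, ZMod.natCast_eq_zero_iff]
  exact fun h => hpq ((Nat.prime_dvd_prime_iff_eq Fact.out Fact.out).mp h).symm

theorem natCast_zmod_ne_zero_of_not_dvd {n : ℕ} (h : ¬ q ∣ n) : ((n : ℕ) : ZMod q) ≠ 0 := by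
  rwa [Ne, ZMod.natCast_eq_zero_iff]

omit [Finite G] in
theorem normZero_of_fixed {s : G} (hs : s ≠ 1) {n : ℕ} (hn : s ^ p ^ n = 1)
    (fix : ∀ s : G, s ≠ 1 → (∃ a : ℕ, orderOf s = p ^ a) → ∀ v : V, ρ s v = v → v = 0) :
    NormZero ρ s (p ^ n) := by
  refine normZero_of_fixed_eq_zero ρ s _ hn (fix s hs ?_)
  obtain ⟨m, -, hm⟩ := (Nat.dvd_prime_pow Fact.out).mp (orderOf_dvd_of_pow_eq_one hn)
  exact ⟨m, hm⟩

theorem exists_isSylowGen {G : Type} [Group G] [Finite G] [Nontrivial V]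
    (ρ : Representation (ZMod q) G V) (hpq : p ≠ q) (hodd : Odd p)
    (fix : ∀ s : G, s ≠ 1 → (∃ a : ℕ, orderOf s = p ^ a) → ∀ v : V, ρ s v = v → v = 0) :
    ∃ x : G, IsSylowGen p x := by
  have hp : p.Prime := Fact.out
  obtain ⟨X⟩ : Nonempty (Sylow p G) := inferInstance
  have hcyc : IsCyclic X := by
    refine isCyclic_of_commuting_dependent p hp hodd _ X X.card_eq_multiplicity ?_
    intro u v hu hv huv
    refine mem_zpowers_of_normZero (ρ.comp (X : Subgroup G).subtype) hp (natCast_zmod_ne_zero hpq)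
      ?_ hu hv huv
    intro s hs hsp w
    have h1 := normZero_of_fixed (p := p) ρ (s := (s : G)) (by simpa using hs) (n := 1)
      (by rw [pow_one]; exact_mod_cast congrArg Subtype.val hsp) fix w
    rw [pow_one] at h1
    simpa using h1
  obtain ⟨⟨x, hx⟩, hgen⟩ := hcyc.exists_generator
  refine ⟨x, IsSylowGen.of_sylow (X := X) (le_antisymm (fun g hg => ?_) (by simpa using hx))⟩
  obtain ⟨j, hj⟩ := Subgroup.mem_zpowers_iff.mp (hgen ⟨g, hg⟩)
  exact Subgroup.mem_zpowers_iff.mpr ⟨j, by simpa using congrArg Subtype.val hj⟩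

/-- With nonvanishing `H²`, the identity is not a trace from a subgroup of order `q`. -/
theorem IsSylowGen.conjTrace_ne_one (hH : ¬ H2Trivial ρ) {y : G} (hy : IsSylowGen q y) {z : G}
    (hz : orderOf z = q) (φ : Module.End (ZMod q) V) :
    conjTrace (ρ : G →* Module.End (ZMod q) V) z q φ ≠ 1 := by
  intro h
  cases nonempty_fintype G
  have hq : q.Prime := Fact.out
  obtain ⟨g, hg⟩ := hy.exists_conj_mem_of_orderOf (n := 1) (hz.trans (pow_one q).symm)
  have hqy : q ∣ orderOf y := by
    rw [← hz, ← orderOf_conj z g]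
    obtain ⟨j, hj⟩ := Subgroup.mem_zpowers_iff.mp hg
    rw [← hj]
    exact orderOf_dvd_of_mem_zpowers (Subgroup.zpow_mem_zpowers y j)
  have hy1 : orderOf (y ^ (orderOf y / q)) = q := orderOf_pow_div hq hqy
  have hmem : g * z * g⁻¹ ∈ Subgroup.zpowers (y ^ (orderOf y / q)) :=
    mem_zpowers_of_mem_zpowers_of_orderOf_eq hq (Subgroup.npow_mem_zpowers y _) hg hy1
      (by rw [orderOf_conj, hz])
  have h1 : conjTrace (ρ : G →* Module.End (ZMod q) V) (g * z * g⁻¹) q (ρ g * φ * ρ g⁻¹) = 1 := by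
    have h2 : ∀ j : ℕ, ρ ((g * z * g⁻¹) ^ j) * (ρ g * φ * ρ g⁻¹) * ρ ((g * z * g⁻¹) ^ j)⁻¹ =
        ρ g * (ρ (z ^ j) * φ * ρ (z ^ j)⁻¹) * ρ g⁻¹ := by
      intro j
      have e1 : ρ ((g * z * g⁻¹) ^ j) * ρ g = ρ g * ρ (z ^ j) := by
        rw [← map_mul, ← map_mul, conj_pow]; congr 1; group
      have e2 : ρ g⁻¹ * ρ ((g * z * g⁻¹) ^ j)⁻¹ = ρ (z ^ j)⁻¹ * ρ g⁻¹ := by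
        rw [← map_mul, ← map_mul, conj_pow]; congr 1; group
      calc _ = (ρ ((g * z * g⁻¹) ^ j) * ρ g) * φ * (ρ g⁻¹ * ρ ((g * z * g⁻¹) ^ j)⁻¹) := by
            simp only [mul_assoc]
        _ = _ := by rw [e1, e2]; simp only [mul_assoc]
    rw [conjTrace, Finset.sum_congr rfl fun j _ => h2 j, ← Finset.sum_mul, ← Finset.mul_sum]
    change ρ g * conjTrace _ z q φ * ρ g⁻¹ = 1
    rw [h, mul_one, ← map_mul, mul_inv_cancel, map_one]
  rw [conjTrace_congr _ hy1 (by rw [orderOf_conj, hz]) hmem] at h1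
  obtain ⟨φ', h'⟩ := hy.exists_sum_conj_of_conjTrace (ρ : G →* Module.End (ZMod q) V) hqy
    (mul_one 1) (fun g => Commute.one_right _) h1.symm
  exact hH (h2Trivial_of_trace ρ φ' h'.symm)

end FixedPointFree

section ConjPerm

variable {G : Type*} [Group G] [Finite G]

/-- Conjugation by an element normalizing a subgroup, as a permutation of the subgroup. -/
noncomputable def conjPerm (L : Subgroup G) (z : G) (h : ∀ l ∈ L, z * l * z⁻¹ ∈ L) : Equiv.Perm L :=
  Equiv.ofBijective (fun l => ⟨z * l * z⁻¹, h l l.2⟩) (Finite.injective_iff_bijective.mp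
    fun a b hab => Subtype.ext (by simpa using congrArg Subtype.val hab))

theorem coe_conjPerm (L : Subgroup G) (z : G) (h : ∀ l ∈ L, z * l * z⁻¹ ∈ L) (l : L) :
    (conjPerm L z h l : G) = z * l * z⁻¹ := rfl

theorem coe_conjPerm_pow (L : Subgroup G) (z : G) (h : ∀ l ∈ L, z * l * z⁻¹ ∈ L) (j : ℕ) (l : L) :
    ((conjPerm L z h ^ j) l : G) = z ^ j * l * (z ^ j)⁻¹ := by
  induction j with
  | zero => simp
  | succ j ih =>
    rw [pow_succ', Equiv.Perm.mul_apply, coe_conjPerm, ih]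
    group

theorem sum_subgroup_eq_sum_centralizer_add_conjTrace {A : Type*} [Ring A] (σ : G →* A) {q : ℕ}
    (hq : q.Prime) {z : G} (hz : z ^ q = 1) (L : Subgroup G) (h : ∀ l ∈ L, z * l * z⁻¹ ∈ L)
    [Fintype L] [Fintype ↥(L ⊓ Subgroup.centralizer {z})] :
    ∃ a, ∑ l : L, σ l =
      ∑ l : ↥(L ⊓ Subgroup.centralizer {z}), σ l + conjTrace σ z q a := by
  classical
  obtain ⟨a, ha⟩ := sum_eq_sum_fixed_add_conjTrace σ z hq (conjPerm L z h)
    (Equiv.ext fun l => Subtype.ext (by rw [coe_conjPerm_pow, hz]; simp)) (fun l => σ l)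
    (fun l => by rw [coe_conjPerm, map_mul, map_mul])
  refine ⟨a, ?_⟩
  rw [ha]
  congr 1
  refine Finset.sum_bij' (fun l hl => ⟨l, l.2, ?_⟩) (fun l _ => ⟨l, l.2.1⟩) ?_ ?_ ?_ ?_ ?_
  · have h1 := congrArg Subtype.val (Finset.mem_filter.mp hl).2
    rw [coe_conjPerm, mul_inv_eq_iff_eq_mul] at h1
    exact Subgroup.mem_centralizer_singleton_iff.mpr h1.symm
  · exact fun _ _ => Finset.mem_univ _
  · intro l _
    refine Finset.mem_filter.mpr ⟨Finset.mem_univ _, Subtype.ext ?_⟩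
    rw [coe_conjPerm, mul_inv_eq_iff_eq_mul]
    exact (Subgroup.mem_centralizer_singleton_iff.mp l.2.2).symm
  · exact fun _ _ => rfl
  · exact fun _ _ => rfl
  · exact fun _ _ => rfl

theorem card_eq_card_centralizer_zmod {q : ℕ} (hq : q.Prime) {z : G} (hz : z ^ q = 1)
    (L : Subgroup G) (h : ∀ l ∈ L, z * l * z⁻¹ ∈ L) [Fintype L]
    [Fintype ↥(L ⊓ Subgroup.centralizer {z})] :
    (Fintype.card L : ZMod q) = Fintype.card ↥(L ⊓ Subgroup.centralizer {z}) := by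
  obtain ⟨a, ha⟩ := sum_subgroup_eq_sum_centralizer_add_conjTrace (1 : G →* ZMod q) hq hz L h
  simpa [conjTrace] using ha

end ConjPerm

section Normalizer

variable {G : Type*} [Group G] [Finite G] {p q : ℕ} [Fact p.Prime] [Fact q.Prime]
  {V : Type*} [AddCommGroup V] [Module (ZMod q) V] (ρ : Representation (ZMod q) G V)

theorem sum_zpowers_eq_zero {u : G} (hu : orderOf u = p)
    (fix : ∀ s : G, s ≠ 1 → (∃ a : ℕ, orderOf s = p ^ a) → ∀ v : V, ρ s v = v → v = 0) :
    ∑ j ∈ Finset.range p, (ρ (u ^ j) : Module.End (ZMod q) V) = 0 := by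
  have hp : p.Prime := Fact.out
  refine LinearMap.ext fun v => ?_
  have h1 := normZero_of_fixed (p := p) ρ (s := u)
    (fun h => hp.ne_one (by rw [← hu, h, orderOf_one])) (n := 1)
    (by rw [pow_one, ← hu, pow_orderOf_eq_one]) fix v
  rw [pow_one] at h1
  rw [LinearMap.sum_apply, h1]; rfl

theorem IsSylowGen.notMem_normalizer (hpq : p ≠ q) (hH : ¬ H2Trivial ρ) {y : G}
    (hy : IsSylowGen q y) (no_pq : ∀ s : G, ¬ p * q ∣ orderOf s)
    (fix : ∀ s : G, s ≠ 1 → (∃ a : ℕ, orderOf s = p ^ a) → ∀ v : V, ρ s v = v → v = 0)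
    {u z : G} (hu : orderOf u = p) (hz : orderOf z = q) :
    z ∉ Subgroup.normalizer (Subgroup.zpowers u : Set G) := by
  classical
  intro hn
  have hp : p.Prime := Fact.out
  have hq : q.Prime := Fact.out
  cases nonempty_fintype G
  obtain ⟨a, ha⟩ := sum_subgroup_eq_sum_centralizer_add_conjTrace
    (ρ : G →* Module.End (ZMod q) V) hq (z := z) (by rw [← hz, pow_orderOf_eq_one])
    (Subgroup.zpowers u) (fun l hl => (Subgroup.mem_normalizer_iff.mp hn l).mp hl)
  rw [sum_zpowers_eq_sum_range, hu, sum_zpowers_eq_zero ρ hu fix] at ha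
  have hbot : Subgroup.zpowers u ⊓ Subgroup.centralizer {z} = ⊥ := by
    rw [Subgroup.eq_bot_iff_forall]
    rintro w ⟨hw, hwz⟩
    by_contra hne
    have hw1 : orderOf w ∣ p := hu ▸ orderOf_dvd_of_mem_zpowers hw
    have hwp : orderOf w = p := ((Nat.dvd_prime hp).mp hw1).resolve_left
      (fun h => hne (orderOf_eq_one_iff.mp h))
    have hc : Commute w z := Subgroup.mem_centralizer_singleton_iff.mp hwz
    refine no_pq (w * z) ?_
    rw [hc.orderOf_mul_eq_mul_orderOf_of_coprime
      (by rw [hwp, hz]; exact (Nat.coprime_primes hp hq).mpr hpq), hwp, hz]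
  have h1 : ∑ l : ↥(Subgroup.zpowers u ⊓ Subgroup.centralizer {z}),
      (ρ (l : G) : Module.End (ZMod q) V) = 1 := by
    have : Unique ↥(Subgroup.zpowers u ⊓ Subgroup.centralizer {z}) := by
      rw [hbot]; infer_instance
    rw [Fintype.sum_unique]
    have h2 : ((default : ↥(Subgroup.zpowers u ⊓ Subgroup.centralizer {z})) : G) = 1 :=
      congrArg Subtype.val (Subsingleton.elim default
        (1 : ↥(Subgroup.zpowers u ⊓ Subgroup.centralizer {z})))
    rw [h2, map_one]
  refine hy.conjTrace_ne_one ρ hH hz (-a) ?_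
  rw [conjTrace_neg]
  have h3 : (0 : Module.End (ZMod q) V) = 1 + conjTrace (ρ : G →* Module.End (ZMod q) V) z q a := by
    rw [← h1]; exact ha
  exact (eq_neg_of_add_eq_zero_left h3.symm).symm

end Normalizer

section AugmentationQuotient

variable {G : Type*} [Group G] {k : Type*} [CommRing k]
  {V : Type*} [AddCommGroup V] [Module k V] (ρ : Representation k G V)

theorem out_inv_mul_mem {K : Subgroup G} (g : G) : ((g : G ⧸ K).out)⁻¹ * g ∈ K :=
  QuotientGroup.eq.mp (QuotientGroup.out_eq' (g : G ⧸ K))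

theorem conj_out_mem_iff {K B : Subgroup G} (h : ∀ a ∈ K, ∀ b ∈ B, a * b * a⁻¹ ∈ B) (t g : G) :
    ((t : G ⧸ K).out)⁻¹ * g * (t : G ⧸ K).out ∈ B ↔ t⁻¹ * g * t ∈ B := by
  have h1 := out_inv_mul_mem (K := K) t
  set s := (t : G ⧸ K).out
  constructor
  · intro h2
    have h3 := h _ (K.inv_mem h1) _ h2
    convert h3 using 1
    group
  · intro h2
    have h3 := h _ h1 _ h2
    convert h3 using 1
    group

open scoped Classical in
theorem sum_subgroup_conj [Fintype G] (B : Subgroup G) [Fintype B] (t : G) {M : Type*}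
    [AddCommMonoid M] (F : G → M) :
    ∑ b : B, F (t * b * t⁻¹) = ∑ g : G, if t⁻¹ * g * t ∈ B then F g else 0 := by
  rw [← Finset.sum_filter]
  refine Finset.sum_bij' (fun b _ => t * b * t⁻¹)
    (fun g hg => ⟨t⁻¹ * g * t, (Finset.mem_filter.mp hg).2⟩) ?_ ?_ ?_ ?_ ?_
  · intro b _
    refine Finset.mem_filter.mpr ⟨Finset.mem_univ _, ?_⟩
    convert b.2 using 1
    group
  · exact fun _ _ => Finset.mem_univ _
  · intro b _
    refine Subtype.ext ?_
    change t⁻¹ * (t * b * t⁻¹) * t = b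
    group
  · intro g _
    change t * (t⁻¹ * g * t) * t⁻¹ = g
    group
  · exact fun _ _ => rfl

theorem sum_conj_out_eq_smul_one [Finite V] [Fintype G]
    (hirr : ∀ W : Submodule k V, (∀ (s : G), ∀ v ∈ W, ρ s v ∈ W) → W = ⊥ ∨ W = ⊤)
    (hH : ¬ H2Trivial ρ) {K B : Subgroup G} [Fintype (G ⧸ K)] [Fintype B]
    (h : ∀ a ∈ K, ∀ b ∈ B, a * b * a⁻¹ ∈ B) :
    ∑ ω : G ⧸ K, ∑ b : B, (ρ (ω.out * b * ω.out⁻¹) : Module.End k V) =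
      ((Fintype.card (G ⧸ K) : k) * Fintype.card B) • 1 := by
  classical
  set c : G → k := fun g => ∑ ω : G ⧸ K, if ω.out⁻¹ * g * ω.out ∈ B then 1 else 0 with hcdef
  have hc : ∀ a g, c (a * g * a⁻¹) = c g := by
    intro a g
    refine (Fintype.sum_equiv (MulAction.toPerm a) _ _ fun ω => ?_).symm
    induction ω using QuotientGroup.induction_on with
    | H t =>
      have e : MulAction.toPerm a (t : G ⧸ K) = ((a * t : G) : G ⧸ K) := rfl
      rw [e]
      refine if_congr ?_ rfl rfl
      rw [conj_out_mem_iff h, conj_out_mem_iff h]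
      have : (a * t)⁻¹ * (a * g * a⁻¹) * (a * t) = t⁻¹ * g * t := by group
      rw [this]
  have hsum : ∑ g, c g = (Fintype.card (G ⧸ K) : k) * Fintype.card B := by
    rw [hcdef, Finset.sum_comm]
    have : ∀ ω : G ⧸ K, (∑ g : G, if ω.out⁻¹ * g * ω.out ∈ B then (1 : k) else 0) =
        Fintype.card B := fun ω => by
      have h2 := sum_subgroup_conj B ω.out (fun _ => (1 : k))
      rw [← h2]; simp
    simp only [this]
    simp
  refine LinearMap.ext fun v => ?_
  rw [LinearMap.smul_apply, Module.End.one_apply, ← hsum,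
    ← center_acts_as_augmentation ρ hirr hH c hc v]
  simp only [hcdef, Finset.sum_smul, LinearMap.sum_apply]
  conv_rhs => rw [Finset.sum_comm]
  refine Finset.sum_congr rfl fun ω _ => ?_
  refine (sum_subgroup_conj B ω.out (fun g => ρ g v)).trans ?_
  exact Finset.sum_congr rfl fun g _ => by split_ifs <;> simp

theorem sum_conj_out [Fintype G] {A : Type*} [AddCommMonoid A] (F : G → A) {K B : Subgroup G}
    [Fintype B] (h : ∀ a ∈ K, ∀ b ∈ B, a * b * a⁻¹ ∈ B) (t : G) :
    ∑ b : B, F ((t : G ⧸ K).out * b * (t : G ⧸ K).out⁻¹) = ∑ b : B, F (t * b * t⁻¹) := by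
  classical
  rw [sum_subgroup_conj, sum_subgroup_conj]
  exact Finset.sum_congr rfl fun g _ => by simp only [conj_out_mem_iff h]

end AugmentationQuotient

section OneSubAverage

variable {G : Type*} [Group G] [Finite G] {q : ℕ} [Fact q.Prime]

/-- The `q`-regular elements of the centralizer of an element of order `q` form a subgroup when the
Sylow `q`-subgroups are cyclic. -/
theorem IsSylowGen.exists_regular_centralizer {y : G} (hy : IsSylowGen q y) {u : G} {m : ℕ}
    (hu : u = y ^ m) (huq : orderOf u = q) :
    ∃ B : Subgroup G, (∀ g, g ∈ B ↔ g ∈ Subgroup.centralizer {u} ∧ ¬ q ∣ orderOf g) ∧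
      ¬ q ∣ Nat.card B := by
  have hq : q.Prime := Fact.out
  obtain ⟨hyC, π, -, hπ⟩ := hy.exists_transfer_centralizer hu huq
  have hmem : ∀ g, g ∈ π.ker.map (Subgroup.subtype _) ↔
      g ∈ Subgroup.centralizer {u} ∧ ¬ q ∣ orderOf g := by
    intro g
    constructor
    · rintro ⟨g, hg, rfl⟩
      refine ⟨g.2, ?_⟩
      have := (hπ g).mp hg
      rwa [← Subgroup.orderOf_coe] at this
    · rintro ⟨hg, h⟩
      refine ⟨⟨g, hg⟩, (hπ _).mpr ?_, rfl⟩
      rwa [Subgroup.orderOf_mk]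
  refine ⟨_, hmem, fun hdvd => ?_⟩
  obtain ⟨b, hb⟩ := exists_prime_orderOf_dvd_card' q hdvd
  refine ((hmem b).mp b.2).2 ?_
  rw [Subgroup.orderOf_coe, hb]

omit [Finite G] in
theorem conjTrace_smul {A : Type*} [Ring A] {k : Type*} [CommRing k] [Algebra k A] (σ : G →* A)
    (z : G) (n : ℕ) (c : k) (a : A) : conjTrace σ z n (c • a) = c • conjTrace σ z n a := by
  simp [conjTrace, Finset.smul_sum]

theorem IsSylowGen.one_sub_average_eq_conjTrace {V : Type*} [AddCommGroup V] [Module (ZMod q) V]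
    [Finite V] (ρ : Representation (ZMod q) G V)
    (hirr : ∀ W : Submodule (ZMod q) V, (∀ (s : G), ∀ v ∈ W, ρ s v ∈ W) → W = ⊥ ∨ W = ⊤)
    (hH : ¬ H2Trivial ρ) {y : G} (hy : IsSylowGen q y) {m : ℕ} {u : G} (hu : u = y ^ m)
    (huq : orderOf u = q) (L : Subgroup G) [Fintype L] (hL : ∀ l ∈ L, u * l * u⁻¹ ∈ L)
    (hLq : ¬ q ∣ Fintype.card L) :
    ∃ a, 1 - (Fintype.card L : ZMod q)⁻¹ • ∑ l : L, ρ (l : G) =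
      conjTrace (ρ : G →* Module.End (ZMod q) V) u q a := by
  classical
  cases nonempty_fintype G
  have hq : q.Prime := Fact.out
  have huq' : u ^ q = 1 := by rw [← huq, pow_orderOf_eq_one]
  obtain ⟨B, hB, hBq⟩ := hy.exists_regular_centralizer hu huq
  set K := Subgroup.normalizer (Subgroup.zpowers u : Set G)
  have hKB : ∀ a ∈ K, ∀ b ∈ B, a * b * a⁻¹ ∈ B := by
    intro a ha b hb
    obtain ⟨h1, h2⟩ := (hB b).mp hb
    exact (hB _).mpr ⟨conj_mem_centralizer ha h1, by rwa [orderOf_conj]⟩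
  have huK : u ∈ K := Subgroup.le_normalizer (Subgroup.mem_zpowers u)
  let T : G →* Module.End (ZMod q) V := ρ
  have hfix : ∀ ω : G ⧸ K, MulAction.toPerm u ω = ω ↔ ω = ((1 : G) : G ⧸ K) := by
    intro ω
    induction ω using QuotientGroup.induction_on with
    | H t =>
      have e : MulAction.toPerm u (t : G ⧸ K) = ((u * t : G) : G ⧸ K) := rfl
      rw [e, QuotientGroup.eq, QuotientGroup.eq]
      constructor
      · intro h1
        have h2 : t⁻¹ * u * t ∈ K := by
          convert K.inv_mem h1 using 1
          group
        have ho : orderOf (t⁻¹ * u * t) = q := by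
          have := orderOf_conj u t⁻¹
          rw [inv_inv] at this
          rw [this, huq]
        have h3 : t⁻¹ * u * t ∈ Subgroup.zpowers u :=
          hy.mem_zpowers_of_normalizes huq ho (conj_mem_zpowers h2)
        refine K.mul_mem (mem_normalizer_zpowers ?_) K.one_mem
        rwa [inv_inv]
      · intro h1
        have h2 : t ∈ K := by simpa using h1
        exact K.mul_mem (K.inv_mem (K.mul_mem huK h2)) h2
  have hperm : (MulAction.toPerm u : Equiv.Perm (G ⧸ K)) ^ q = 1 := by
    have h1 := map_pow (MulAction.toPermHom G (G ⧸ K)) u q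
    rw [huq', map_one] at h1
    exact h1.symm
  have hcard : (Fintype.card (G ⧸ K) : ZMod q) = 1 := by
    obtain ⟨a, ha⟩ := sum_eq_sum_fixed_add_conjTrace (1 : G →* ZMod q) u hq
      (MulAction.toPerm u : Equiv.Perm (G ⧸ K)) hperm (fun _ => 1) (fun _ => by simp)
    simp only [hfix] at ha
    simpa [conjTrace, Finset.filter_eq'] using ha
  obtain ⟨a, ha⟩ := sum_eq_sum_fixed_add_conjTrace T u hq
    (MulAction.toPerm u : Equiv.Perm (G ⧸ K)) hperm
    (fun ω => ∑ b : B, T (ω.out * b * ω.out⁻¹)) (fun ω => by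
      induction ω using QuotientGroup.induction_on with
      | H t =>
        have e : MulAction.toPerm u (t : G ⧸ K) = ((u * t : G) : G ⧸ K) := rfl
        rw [e]
        simp only [sum_conj_out (K := K) T hKB]
        rw [Finset.mul_sum, Finset.sum_mul]
        refine Finset.sum_congr rfl fun b _ => ?_
        rw [← map_mul, ← map_mul]
        congr 1
        group)
  have haug := sum_conj_out_eq_smul_one ρ hirr hH hKB
  rw [hcard, one_mul] at haug
  simp only [hfix, Finset.filter_eq', Finset.mem_univ, if_true, Finset.sum_singleton,
    sum_conj_out (K := K) T hKB, one_mul, inv_one, mul_one] at ha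
  have hE : (Fintype.card B : ZMod q) • (1 : Module.End (ZMod q) V) =
      ∑ b : B, T b + conjTrace T u q a := by
    rw [← haug]; exact ha
  obtain ⟨a', ha'⟩ := sum_subgroup_eq_sum_centralizer_add_conjTrace T hq huq' L hL
  have hcL := card_eq_card_centralizer_zmod hq huq' L hL
  set L₀ := L ⊓ Subgroup.centralizer {u}
  have hL₀ : ∀ l : L₀, (l : G) ∈ B := by
    intro l
    refine (hB _).mpr ⟨l.2.2, fun h => hLq ?_⟩
    have h1 : orderOf (⟨l, l.2.1⟩ : L) ∣ Fintype.card L := orderOf_dvd_card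
    rw [Subgroup.orderOf_mk] at h1
    exact h.trans h1
  have hmul : (∑ l : L₀, T l) * ∑ b : B, T b = (Fintype.card L : ZMod q) • ∑ b : B, T b := by
    rw [hcL, Finset.sum_mul]
    have : ∀ l : L₀, T l * ∑ b : B, T b = ∑ b : B, T b := by
      intro l
      rw [Finset.mul_sum]
      refine Fintype.sum_equiv (Equiv.mulLeft ⟨l, hL₀ l⟩) _ _ fun b => ?_
      rw [← map_mul]
      rfl
    rw [Finset.sum_congr rfl fun l _ => this l, Finset.sum_const, Finset.card_univ,
      Nat.cast_smul_eq_nsmul]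
  have hcomm : Commute (T u) (∑ l : L₀, T l) := by
    refine Commute.sum_right _ _ _ fun l _ => ?_
    have h1 : (l : G) * u = u * l := Subgroup.mem_centralizer_singleton_iff.mp l.2.2
    change T u * T l = T l * T u
    rw [← map_mul, ← map_mul, h1]
  have hfin := congrArg (fun w => (∑ l : L₀, T l) * w) hE
  simp only [mul_add, mul_conjTrace T q a hcomm, hmul, mul_smul_comm, mul_one] at hfin
  have hE' : ∑ b : B, T b = (Fintype.card B : ZMod q) • 1 - conjTrace T u q a :=
    eq_sub_of_add_eq hE.symm
  have hB0 : (Fintype.card B : ZMod q) ≠ 0 :=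
    natCast_zmod_ne_zero_of_not_dvd (by rwa [← Nat.card_eq_fintype_card])
  have hL0 : (Fintype.card L : ZMod q) ≠ 0 := natCast_zmod_ne_zero_of_not_dvd hLq
  refine ⟨-((Fintype.card L : ZMod q)⁻¹ • (a' + (Fintype.card B : ZMod q)⁻¹ •
    ((∑ l : L₀, T l) * a - (Fintype.card L : ZMod q) • a))), ?_⟩
  change 1 - _ • ∑ l : L, T l = conjTrace T u q _
  have hS : (∑ l : L₀, T l) = (Fintype.card L : ZMod q) • 1 + (Fintype.card B : ZMod q)⁻¹ •
      (conjTrace T u q ((∑ l : L₀, T l) * a) - (Fintype.card L : ZMod q) • conjTrace T u q a) := by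
    rw [hE'] at hfin
    have h1 : (∑ l : L₀, T l) =
        (Fintype.card B : ZMod q)⁻¹ • ((Fintype.card B : ZMod q) • ∑ l : L₀, T l) := by
      rw [smul_smul, inv_mul_cancel₀ hB0, one_smul]
    refine h1.trans ?_
    rw [hfin, smul_sub, smul_add, smul_sub, smul_sub, smul_comm (_ : ZMod q)⁻¹, smul_smul _⁻¹,
      inv_mul_cancel₀ hB0, one_smul]
    abel
  rw [conjTrace_neg, conjTrace_smul, conjTrace_add, conjTrace_smul, conjTrace_sub, conjTrace_smul,
    ha']
  conv_lhs => rw [hS]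
  rw [add_assoc, smul_add, smul_smul, inv_mul_cancel₀ hL0, one_smul, sub_add_eq_sub_sub, sub_self,
    zero_sub, add_comm (conjTrace T u q a')]

end OneSubAverage

section Nakayama

theorem mem_ringJacobson_of_isNilpotent {R : Type*} [Ring R] {x : R}
    (h : ∀ r : R, IsNilpotent (r * x)) : x ∈ Ring.jacobson R := by
  rw [← Ideal.jacobson_bot, Ideal.mem_jacobson_iff]
  intro r
  obtain ⟨u, hu⟩ := (h r).isUnit_one_add
  refine ⟨↑u⁻¹, ?_⟩
  have h1 : (↑u⁻¹ : R) * (1 + r * x) = 1 := by rw [← hu, Units.inv_mul]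
  rw [mul_add, mul_one, ← mul_assoc] at h1
  rw [Ideal.mem_bot, add_comm, h1, sub_self]

variable {H k V : Type*} [Group H] [Fintype H] [Field k] [AddCommGroup V] [Module k V] [Finite V]

/-- A trace idempotent vanishes if the annihilating two-sided ideal of the group algebra is nil. -/
theorem eq_zero_of_trace_of_nil (τ : Representation k H V) (z : MonoidAlgebra k H)
    (hz : τ.asAlgebraHom z = 0)
    (hnil : ∀ w, (∀ g, z * MonoidAlgebra.of k H g * w = 0) → IsNilpotent w)
    {π φ : Module.End k V} (hπ : π * π = π) (hc : ∀ g, Commute (τ g) π)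
    (h : π = ∑ g, τ g * φ * τ g⁻¹) : π = 0 := by
  classical
  have hnil' : ∀ w, (∀ a, z * a * w = 0) → w ∈ Ring.jacobson (MonoidAlgebra k H) := by
    intro w hw
    refine mem_ringJacobson_of_isNilpotent fun r => hnil _ fun g => ?_
    rw [← mul_assoc, mul_assoc z]
    exact hw _
  let β := Module.Free.chooseBasis k V
  let W : Module.Free.ChooseBasisIndex k V → V →ₗ[k] MonoidAlgebra k H := fun i =>
    ∑ g, (LinearMap.toSpanSingleton k _ (MonoidAlgebra.of k H g)) ∘ₗ β.coord i ∘ₗ φ ∘ₗ τ g⁻¹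
  have hW : ∀ i v, W i v = ∑ g, β.coord i (φ (τ g⁻¹ v)) • MonoidAlgebra.of k H g := by
    intro i v
    simp [W, LinearMap.sum_apply]
  have hWs : ∀ i (s : MonoidAlgebra k H) v, s * W i v = W i (τ.asAlgebraHom s v) := by
    intro i s v
    induction s using MonoidAlgebra.induction_linear with
    | zero => simp
    | add a b ha hb => rw [add_mul, ha, hb, map_add, LinearMap.add_apply, map_add]
    | single m r =>
      have e : MonoidAlgebra.single m r = r • MonoidAlgebra.of k H m := by simp
      rw [e, smul_mul_assoc, map_smul, LinearMap.smul_apply, map_smul, MonoidAlgebra.of_apply,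
        Representation.asAlgebraHom_single, one_smul, hW, hW, Finset.mul_sum]
      congr 1
      refine Fintype.sum_equiv (Equiv.mulLeft m) _ _ fun g => ?_
      have e2 : τ (m * g)⁻¹ (τ m v) = τ g⁻¹ v := by
        rw [← Module.End.mul_apply, ← map_mul]
        congr 2
        group
      rw [mul_smul_comm, ← MonoidAlgebra.of_apply, ← map_mul, Equiv.coe_mulLeft, e2]
  have hWj : ∀ i v, W i v ∈ Ring.jacobson (MonoidAlgebra k H) := by
    intro i v
    refine hnil' _ fun a => ?_
    rw [hWs, map_mul, hz, zero_mul, LinearMap.zero_apply, map_zero]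
  have hdec : ∀ v, π v = ∑ i, τ.asAlgebraHom (W i v) (β i) := by
    intro v
    simp only [hW, map_sum, LinearMap.sum_apply, map_smul, LinearMap.smul_apply]
    rw [Finset.sum_comm, h, LinearMap.sum_apply]
    refine Finset.sum_congr rfl fun g _ => ?_
    rw [Module.End.mul_apply, Module.End.mul_apply]
    conv_lhs => rw [← β.sum_repr (φ (τ g⁻¹ v)), map_sum]
    refine Finset.sum_congr rfl fun i _ => ?_
    rw [map_smul, MonoidAlgebra.of_apply, Representation.asAlgebraHom_single, one_smul]
    rfl
  have hcomm : ∀ (s : MonoidAlgebra k H) v, τ.asAlgebraHom s (π v) = π (τ.asAlgebraHom s v) := by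
    intro s v
    induction s using MonoidAlgebra.induction_linear with
    | zero => simp
    | add a b ha hb => rw [map_add, LinearMap.add_apply, ha, hb, LinearMap.add_apply, map_add]
    | single m r =>
      rw [Representation.asAlgebraHom_single, LinearMap.smul_apply, LinearMap.smul_apply, map_smul,
        ← Module.End.mul_apply, (hc m).eq, Module.End.mul_apply]
  have hidem : ∀ v, π (π v) = π v := fun v => by rw [← Module.End.mul_apply, hπ]
  let _ : Module (MonoidAlgebra k H) V := Module.compHom V (τ.asAlgebraHom).toRingHom
  have hsmul : ∀ (s : MonoidAlgebra k H) (v : V), s • v = τ.asAlgebraHom s v := fun _ _ => rfl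
  let N : Submodule (MonoidAlgebra k H) V :=
    { carrier := Set.range π
      add_mem' := by
        rintro _ _ ⟨a, rfl⟩ ⟨b, rfl⟩
        exact ⟨a + b, map_add _ _ _⟩
      zero_mem' := ⟨0, map_zero _⟩
      smul_mem' := by
        rintro s _ ⟨a, rfl⟩
        exact ⟨τ.asAlgebraHom s a, by rw [hsmul, hcomm]⟩ }
  have hbot : N = ⊥ := by
    have hNfin : Finite N := Subtype.finite
    refine Submodule.FG.eq_bot_of_le_jacobson_smul
      ((Submodule.fg_top N).mp (Module.finite_def.mp Module.Finite.of_finite)) ?_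
    rintro _ ⟨v, rfl⟩
    have h1 : π v = ∑ i, π (τ.asAlgebraHom (W i v) (β i)) := by rw [← map_sum, ← hdec, hidem]
    rw [h1]
    refine sum_mem fun i _ => ?_
    rw [← hcomm, ← hsmul]
    exact Submodule.smul_mem_smul (hWj i v) ⟨β i, rfl⟩
  refine LinearMap.ext fun v => ?_
  have : π v ∈ N := ⟨v, rfl⟩
  rw [hbot] at this
  simpa using this

end Nakayama

section NormalSubgroups

variable {G : Type*} [Group G] [Finite G] {p q : ℕ} [Fact p.Prime] [Fact q.Prime]
  {V : Type*} [AddCommGroup V] [Module (ZMod q) V] (ρ : Representation (ZMod q) G V)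

theorem IsSylowGen.dvd_orderOf {y : G} (hH : ¬ H2Trivial ρ) (hy : IsSylowGen q y) :
    q ∣ orderOf y := by
  cases nonempty_fintype G
  have hq : q.Prime := Fact.out
  by_contra hdvd
  have hcard : ¬ q ∣ Fintype.card G := by
    intro h
    refine hdvd ?_
    rw [hy]
    rw [← Nat.card_eq_fintype_card] at h
    exact dvd_pow_self q (hq.factorization_pos_of_dvd Nat.card_pos.ne' h).ne'
  refine hH (h2Trivial_of_trace ρ ((Fintype.card G : ZMod q)⁻¹ • 1) ?_)
  have h1 : ∀ g : G, ρ g * ((Fintype.card G : ZMod q)⁻¹ • 1) * ρ g⁻¹ =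
      (Fintype.card G : ZMod q)⁻¹ • 1 := by
    intro g
    rw [mul_smul_comm, smul_mul_assoc, mul_one, ← map_mul, mul_inv_cancel, map_one]
  rw [Finset.sum_congr rfl fun g _ => h1 g, Finset.sum_const, Finset.card_univ,
    ← Nat.cast_smul_eq_nsmul (ZMod q), smul_smul,
    mul_inv_cancel₀ (natCast_zmod_ne_zero_of_not_dvd hcard), one_smul]

/-- Restricting to a subgroup containing a Sylow subgroup preserves nonvanishing of `H²`. -/
theorem IsSylowGen.not_h2Trivial_restrict {y : G} (hH : ¬ H2Trivial ρ) (hy : IsSylowGen q y)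
    {H : Subgroup G} (hyH : y ∈ H) : ¬ H2Trivial (ρ.comp H.subtype) := by
  refine fun h => hH (h2Trivial_of_subgroup ρ H ?_ h)
  refine IsUnit.mk0 _ (natCast_zmod_ne_zero_of_not_dvd fun h1 => hy.not_dvd_index (h1.trans ?_))
  exact Subgroup.index_dvd_of_le (by simpa using hyH)

theorem not_dvd_card_of_normal (hH : ¬ H2Trivial ρ)
    (fix : ∀ s : G, s ≠ 1 → (∃ a : ℕ, orderOf s = p ^ a) → ∀ v : V, ρ s v = v → v = 0)
    (N : Subgroup G) [N.Normal] (hN : ¬ q ∣ Nat.card N) : ¬ p ∣ Nat.card N := by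
  classical
  cases nonempty_fintype G
  have hp : p.Prime := Fact.out
  intro hdvd
  obtain ⟨s, hs⟩ := exists_prime_orderOf_dvd_card' p hdvd
  have hsum : ∀ {M : Type _} [AddCommMonoid M] (F : G → M),
      ∑ g, (if g ∈ N then F g else 0) = ∑ n : N, F n := by
    intro M _ F
    rw [← Finset.sum_filter]
    exact (Finset.sum_subtype _ (by simp) F)
  refine hH (h2Trivial_of_center_eq_zero ρ (fun g => if g ∈ N then 1 else 0) ?_ ?_ ?_)
  · intro a g
    refine if_congr ⟨fun h => ?_, fun h => Subgroup.Normal.conj_mem inferInstance g h a⟩ rfl rfl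
    have := Subgroup.Normal.conj_mem inferInstance _ h a⁻¹
    convert this using 1
    group
  · rw [← Finset.sum_filter, Finset.sum_const, Nat.smul_one_eq_cast]
    refine IsUnit.mk0 _ (natCast_zmod_ne_zero_of_not_dvd ?_)
    rwa [← Fintype.card_subtype, ← Nat.card_eq_fintype_card]
  · intro v
    have h1 : ∑ g, (if g ∈ N then (1 : ZMod q) else 0) • ρ g v = ∑ n : N, ρ n v := by
      rw [← hsum (fun g => ρ g v)]
      exact Finset.sum_congr rfl fun g _ => by split_ifs <;> simp
    rw [h1]
    refine fix s (fun h => hp.ne_one ?_) ⟨1, by rw [Subgroup.orderOf_coe, hs, pow_one]⟩ _ ?_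
    · rw [← hs, ← Subgroup.orderOf_coe, h, orderOf_one]
    · rw [map_sum]
      refine Fintype.sum_equiv (Equiv.mulLeft s) _ _ fun n => ?_
      rw [← Module.End.mul_apply, ← map_mul]
      rfl

theorem IsSylowGen.normal_eq_bot_of_orderOf_lt [Finite V] (hpq : p ≠ q) (hodd : Odd p)
    (hirr : ∀ W : Submodule (ZMod q) V, (∀ (s : G), ∀ v ∈ W, ρ s v ∈ W) → W = ⊥ ∨ W = ⊤)
    (hH : ¬ H2Trivial ρ) (faithful : ∀ s : G, (∀ v : V, ρ s v = v) → s = 1)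
    (no_pq : ∀ s : G, ¬ p * q ∣ orderOf s)
    (fix : ∀ s : G, s ≠ 1 → (∃ a : ℕ, orderOf s = p ^ a) → ∀ v : V, ρ s v = v → v = 0)
    {x y : G} (hx : IsSylowGen p x) (hpx : p ∣ orderOf x) (hy : IsSylowGen q y)
    (hlt : orderOf x < orderOf y) {H : Subgroup G} (hxH : x ∈ H) (hyH : y ∈ H)
    (N : Subgroup H) [N.Normal] (hN : ¬ q ∣ Nat.card N) : N = ⊥ := by
  classical
  cases nonempty_fintype G
  have hp : p.Prime := Fact.out
  have hq : q.Prime := Fact.out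
  have hqy : q ∣ orderOf y := hy.dvd_orderOf ρ hH
  have huq : orderOf (y ^ (orderOf y / q)) = q := orderOf_pow_div hq hqy
  set L := N.map H.subtype with hLdef
  have hconj : ∀ h ∈ H, ∀ l ∈ L, h * l * h⁻¹ ∈ L := by
    rintro h hh _ ⟨l, hl, rfl⟩
    exact ⟨⟨h, hh⟩ * l * ⟨h, hh⟩⁻¹, Subgroup.Normal.conj_mem inferInstance l hl _, rfl⟩
  have hLq : ¬ q ∣ Fintype.card L := by
    rw [← Nat.card_eq_fintype_card]
    rwa [hLdef, Subgroup.card_map_of_injective H.subtype_injective]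
  have hL0 : (Fintype.card L : ZMod q) ≠ 0 := natCast_zmod_ne_zero_of_not_dvd hLq
  obtain ⟨a, ha⟩ := hy.one_sub_average_eq_conjTrace ρ hirr hH rfl huq L
    (hconj _ (H.pow_mem hyH _)) hLq
  set e : Module.End (ZMod q) V := (Fintype.card L : ZMod q)⁻¹ • ∑ l : L, ρ (l : G) with he
  have hle : ∀ l ∈ L, ρ l * e = e := by
    intro l hl
    rw [he, mul_smul_comm, Finset.mul_sum]
    congr 1
    refine Fintype.sum_equiv (Equiv.mulLeft ⟨l, hl⟩) _ _ fun b => ?_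
    rw [← map_mul]
    rfl
  have hee : e * e = e := by
    conv_lhs => enter [1]; rw [he]
    rw [smul_mul_assoc, Finset.sum_mul, Finset.sum_congr rfl fun (l : L) _ => hle l l.2,
      Finset.sum_const, Finset.card_univ, ← Nat.cast_smul_eq_nsmul (ZMod q), smul_smul,
      inv_mul_cancel₀ hL0, one_smul]
  let τ : Representation (ZMod q) H V := ρ.comp H.subtype
  have hcomm : ∀ h : H, Commute (τ h) (1 - e) := by
    intro h
    refine (Commute.one_right _).sub_right (Commute.smul_right ?_ _)
    change ρ h * ∑ l : L, ρ (l : G) = (∑ l : L, ρ (l : G)) * ρ h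
    rw [Finset.mul_sum, Finset.sum_mul]
    refine Fintype.sum_equiv (conjPerm L h (hconj h h.2)) _ _ fun l => ?_
    rw [coe_conjPerm, ← map_mul, ← map_mul]
    congr 1
    group
  set y' : H := ⟨y, hyH⟩
  set x' : H := ⟨x, hxH⟩
  have hy' : IsSylowGen q y' := IsSylowGen.subgroup (x := y') hy
  have hx' : IsSylowGen p x' := IsSylowGen.subgroup (x := x') hx
  have hox : orderOf x' = orderOf x := Subgroup.orderOf_mk _ _
  have hoy : orderOf y' = orderOf y := Subgroup.orderOf_mk _ _
  have hid : (1 - e) * (1 - e) = 1 - e := by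
    rw [mul_sub, mul_one, sub_mul, one_mul, hee, sub_self, sub_zero]
  obtain ⟨φ, hφ⟩ := hy'.exists_sum_conj_of_conjTrace (τ : H →* Module.End (ZMod q) V)
    (by rwa [hoy]) (φ := a) hid hcomm (by rw [hoy]; exact ha)
  have hux : orderOf (x ^ (orderOf x / p)) = p := orderOf_pow_div hp hpx
  have h0 : (1 - e) = 0 := by
    refine eq_zero_of_trace_of_nil τ (powSum (ZMod q) (x' ^ (orderOf x' / p)) p) ?_ ?_ hid hcomm hφ
    · rw [powSum, map_sum, ← sum_zpowers_eq_zero ρ hux fix]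
      refine Finset.sum_congr rfl fun j _ => ?_
      rw [MonoidAlgebra.of_apply, Representation.asAlgebraHom_single, one_smul, hox]
      rfl
    · intro w hw
      refine hx'.isNilpotent_of_powSum_mul_eq_zero hpq hodd (by rwa [hox]) rfl ?_ ?_ hw
      · intro hdvd
        obtain ⟨n, hn⟩ := exists_prime_orderOf_dvd_card' q hdvd
        refine hy.notMem_normalizer ρ hpq hH no_pq fix hux (z := ((n : H) : G)) ?_ ?_
        · rw [Subgroup.orderOf_coe, Subgroup.orderOf_coe, hn]
        · refine mem_normalizer_zpowers ?_
          have h1 := conj_mem_zpowers n.2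
          obtain ⟨j, hj⟩ := Subgroup.mem_zpowers_iff.mp h1
          refine Subgroup.mem_zpowers_iff.mpr ⟨j, ?_⟩
          rw [← hox]
          simpa using congrArg Subtype.val hj
      · rw [hox, ← hy', hoy]
        exact hlt
  have he1 : e = 1 := (sub_eq_zero.mp h0).symm
  rw [Subgroup.eq_bot_iff_forall]
  intro n hn
  refine Subtype.ext (faithful n fun v => ?_)
  have h1 := hle n ⟨n, hn, rfl⟩
  rw [he1, mul_one] at h1
  rw [h1]; rfl

end NormalSubgroups

section CyclicSylow

variable {G : Type*} [Group G] [Finite G] {p : ℕ} [Fact p.Prime]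

omit [Finite G] in
theorem mem_zpowers_zpow_of_coprime {x : G} {m : ℤ} (h : IsCoprime m (orderOf x)) :
    x ∈ Subgroup.zpowers (x ^ m) := by
  obtain ⟨a, b, hab⟩ := h
  refine Subgroup.mem_zpowers_iff.mpr ⟨a, ?_⟩
  rw [← zpow_mul]
  have h1 : m * a = 1 - orderOf x * b := by linarith
  rw [h1, zpow_sub, zpow_mul, zpow_natCast, pow_orderOf_eq_one]
  simp

/-- If a normal subgroup does not contain a cyclic Sylow subgroup, then its `p`-regular elements
form a subgroup. -/
theorem IsSylowGen.exists_regular_normal {x : G} (hx : IsSylowGen p x) (N : Subgroup G) [N.Normal]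
    (hxN : x ∉ N) :
    ∃ M : Subgroup G, M.Normal ∧ ∀ g, g ∈ M ↔ g ∈ N ∧ ¬ p ∣ orderOf g := by
  have hp : p.Prime := Fact.out
  set L := Subgroup.zpowers x ⊔ N with hLdef
  have hxL : x ∈ L := (le_sup_left : _ ≤ L) (Subgroup.mem_zpowers x)
  have hcent : L ≤ (Subgroup.centralizer {(x : G ⧸ N)}).comap (QuotientGroup.mk' N) := by
    refine sup_le ?_ fun n hn => ?_
    · rw [Subgroup.zpowers_le]
      exact Subgroup.mem_centralizer_singleton_iff.mpr rfl
    · rw [Subgroup.mem_comap, Subgroup.mem_centralizer_singleton_iff, QuotientGroup.mk'_apply,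
        (QuotientGroup.eq_one_iff n).mpr hn, one_mul, mul_one]
  have hx' : IsSylowGen p (⟨x, hxL⟩ : L) := IsSylowGen.subgroup (x := (⟨x, hxL⟩ : L)) hx
  obtain ⟨π, -, hπ⟩ := hx'.exists_transfer (by
    rintro ⟨n, hn⟩ k hk
    have hk' : n * x * n⁻¹ = x ^ k := congrArg Subtype.val hk
    have h1 : (n : G ⧸ N) * x = x * n :=
      Subgroup.mem_centralizer_singleton_iff.mp (Subgroup.mem_comap.mp (hcent hn))
    have h2 : x ^ ((k : ℤ) - 1) ∈ N := by
      rw [← QuotientGroup.eq_one_iff, zpow_sub, zpow_natCast, zpow_one, ← hk']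
      simp only [QuotientGroup.mk_mul, QuotientGroup.mk_inv, h1]
      group
    by_contra hne
    have h3 : IsCoprime ((k : ℤ) - 1) (orderOf x) := by
      rw [hx, Nat.cast_pow]
      refine IsCoprime.pow_right (IsCoprime.symm ?_)
      rw [Prime.coprime_iff_not_dvd (Nat.prime_iff_prime_int.mp hp)]
      intro h4
      refine hne (Nat.ModEq.symm ?_)
      rw [← Int.natCast_modEq_iff]
      exact Int.modEq_iff_dvd.mpr (by simpa using h4)
    exact hxN ((Subgroup.zpowers_le.mpr h2) (mem_zpowers_zpow_of_coprime h3)))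
  have hmem : ∀ g, g ∈ π.ker.map L.subtype ⊓ N ↔ g ∈ N ∧ ¬ p ∣ orderOf g := by
    intro g
    constructor
    · rintro ⟨⟨g, hg, rfl⟩, hgN⟩
      refine ⟨hgN, ?_⟩
      have := (hπ g).mp hg
      rwa [← Subgroup.orderOf_coe] at this
    · rintro ⟨hg, h⟩
      refine ⟨⟨⟨g, (le_sup_right : _ ≤ L) hg⟩, (hπ _).mpr ?_, rfl⟩, hg⟩
      rwa [Subgroup.orderOf_mk]
  refine ⟨_, ⟨fun n hn g => ?_⟩, hmem⟩
  obtain ⟨h1, h2⟩ := (hmem n).mp hn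
  exact (hmem _).mpr ⟨Subgroup.Normal.conj_mem inferInstance n h1 g, by rwa [orderOf_conj]⟩

end CyclicSylow

attribute [instance] FrattiniTriple.addP FrattiniTriple.modP FrattiniTriple.finP
  FrattiniTriple.nontrivP FrattiniTriple.addQ FrattiniTriple.modQ FrattiniTriple.finQ
  FrattiniTriple.nontrivQ

namespace FrattiniTriple

variable {S : Type} [Group S] {p q : ℕ}

/-- Exchanging the two primes of a Frattini triple. -/
def swap (T : FrattiniTriple p q S) : FrattiniTriple q p S where
  P := T.Q
  ρP := T.ρQ
  Q := T.P
  ρQ := T.ρP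
  faithfulP := T.faithfulQ
  faithfulQ := T.faithfulP
  irredP := T.irredQ
  irredQ := T.irredP
  no_pq := fun s => by rw [mul_comm]; exact T.no_pq s
  h2P := T.h2Q
  h2Q := T.h2P
  fixP := T.fixQ
  fixQ := T.fixP

theorem not_h2Trivial_P (T : FrattiniTriple p q S) : ¬ H2Trivial T.ρP :=
  (nontrivial_H2_iff T.ρP).mp T.h2P

theorem not_h2Trivial_Q (T : FrattiniTriple p q S) : ¬ H2Trivial T.ρQ :=
  (nontrivial_H2_iff T.ρQ).mp T.h2Q

variable [Finite S] [Fact p.Prime] [Fact q.Prime] (T : FrattiniTriple p q S)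
  (hpq : p ≠ q) (hpodd : Odd p) (hqodd : Odd q)
  {x y : S} (hx : IsSylowGen p x) (hy : IsSylowGen q y) {H : Subgroup S} (hxH : x ∈ H) (hyH : y ∈ H)

omit [Fact q.Prime] in
include T hx in
theorem dvd_orderOf : p ∣ orderOf x := hx.dvd_orderOf T.ρP T.not_h2Trivial_P

include T hpq hpodd hqodd hx hy hxH hyH in
theorem normal_eq_bot (N : Subgroup H) [N.Normal] (hN : ¬ p ∣ Nat.card N) : N = ⊥ := by
  have hp : p.Prime := Fact.out
  have hq : q.Prime := Fact.out
  have hpx : p ∣ orderOf x := T.dvd_orderOf hx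
  have hqy : q ∣ orderOf y := T.swap.dvd_orderOf hy
  have hNq : ¬ q ∣ Nat.card N := by
    refine not_dvd_card_of_normal (T.ρP.comp H.subtype)
      (hx.not_h2Trivial_restrict T.ρP T.not_h2Trivial_P hxH) ?_ N hN
    rintro s hs ⟨b, hb⟩ v hv
    exact T.fixP s (by simpa using hs) ⟨b, by rw [Subgroup.orderOf_coe, hb]⟩ v hv
  rcases lt_trichotomy (orderOf x) (orderOf y) with h | h | h
  · exact hx.normal_eq_bot_of_orderOf_lt T.ρQ hpq hpodd T.irredQ T.not_h2Trivial_Q T.faithfulQ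
      T.no_pq T.fixQ hpx hy h hxH hyH N hNq
  · rw [h, hy] at hpx
    exact absurd ((Nat.prime_dvd_prime_iff_eq hp hq).mp (hp.dvd_of_dvd_pow hpx)) hpq
  · exact hy.normal_eq_bot_of_orderOf_lt T.ρP hpq.symm hqodd T.irredP T.not_h2Trivial_P T.faithfulP
      T.swap.no_pq T.fixP hqy hx h hyH hxH N hN

include T hpq hpodd hqodd hx hy hyH in
theorem mem_of_normal_ne_bot (N : Subgroup H) [N.Normal] (hN : N ≠ ⊥) : (⟨x, hxH⟩ : H) ∈ N := by
  have hp : p.Prime := Fact.out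
  have hq : q.Prime := Fact.out
  by_contra hxN
  have hx' : IsSylowGen p (⟨x, hxH⟩ : H) := IsSylowGen.subgroup (x := (⟨x, hxH⟩ : H)) hx
  obtain ⟨M, hM, hmem⟩ := hx'.exists_regular_normal N hxN
  have hMp : ¬ p ∣ Nat.card M := by
    intro hdvd
    obtain ⟨b, hb⟩ := exists_prime_orderOf_dvd_card' p hdvd
    exact ((hmem b).mp b.2).2 (by rw [Subgroup.orderOf_coe, hb])
  have hMbot : M = ⊥ := T.normal_eq_bot hpq hpodd hqodd hx hy hxH hyH M hMp
  have hNq : q ∣ Nat.card N := by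
    by_contra h
    exact hN (T.swap.normal_eq_bot hpq.symm hqodd hpodd hy hx hyH hxH N h)
  obtain ⟨b, hb⟩ := exists_prime_orderOf_dvd_card' q hNq
  have hbM : (b : H) ∈ M := (hmem b).mpr ⟨b.2, fun h => hpq <| by
    rw [Subgroup.orderOf_coe, hb] at h
    exact (Nat.prime_dvd_prime_iff_eq hp hq).mp h⟩
  rw [hMbot, Subgroup.mem_bot] at hbM
  refine hq.ne_one ?_
  rw [← hb, ← Subgroup.orderOf_coe, hbM, orderOf_one]

end FrattiniTriple

theorem exists_faithful_irreducible_restrict {G V : Type} [Group G] [Finite G] {p q : ℕ}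
    [Fact p.Prime] [Fact q.Prime] [AddCommGroup V] [Module (ZMod q) V] [Finite V]
    (ρ : Representation (ZMod q) G V) (hpq : p ≠ q) (hH : ¬ H2Trivial ρ)
    (fix : ∀ s : G, s ≠ 1 → (∃ a : ℕ, orderOf s = p ^ a) → ∀ v : V, ρ s v = v → v = 0)
    {y : G} (hy : IsSylowGen q y) {H : Subgroup G} (hyH : y ∈ H) [IsSimpleGroup H] {x : H}
    (hx1 : x ≠ 1) {n : ℕ} (hx : orderOf x = p ^ n) :
    ∃ (W : Type) (_ : AddCommGroup W) (_ : Module (ZMod q) W) (σ : Representation (ZMod q) H W),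
      Finite W ∧ Nontrivial W ∧ (∀ s, (∀ v, σ s v = v) → s = 1) ∧
      (∀ U : Submodule (ZMod q) W, (∀ (s : H), ∀ v ∈ U, σ s v ∈ U) → U = ⊥ ∨ U = ⊤) ∧
      ¬ H2Trivial σ ∧
      ∀ s : H, s ≠ 1 → (∃ a : ℕ, orderOf s = p ^ a) → ∀ v : W, σ s v = v → v = 0 := by
  obtain ⟨W, _, _, σ, hfin, hnt, hirr, hσ, hnorm⟩ := exists_irreducible_subquotient (Nat.card V) V
    (ρ.comp H.subtype) le_rfl (hy.not_h2Trivial_restrict ρ hH hyH)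
  have hfix : ∀ s : H, s ≠ 1 → (∃ a : ℕ, orderOf s = p ^ a) → ∀ v : W, σ s v = v → v = 0 := by
    rintro s hs ⟨a, ha⟩ v hv
    have hsa : s ^ p ^ a = 1 := by rw [← ha, pow_orderOf_eq_one]
    have h1 : NormZero ρ (s : G) (p ^ a) :=
      normZero_of_fixed ρ (by simpa using hs) (by exact_mod_cast congrArg Subtype.val hsa) fix
    refine NormZero.fixed_eq_zero (hnorm s (p ^ a) fun w => ?_) ?_ hv
    · exact h1 w
    · rw [Nat.cast_pow]
      exact pow_ne_zero _ (natCast_zmod_ne_zero hpq)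
  refine ⟨W, _, _, σ, hfin, hnt, ?_, hirr, hσ, hfix⟩
  intro s hs
  have hker : s ∈ (σ : H →* Module.End (ZMod q) W).ker := LinearMap.ext hs
  rcases IsSimpleGroup.eq_bot_or_eq_top_of_normal (σ : H →* Module.End (ZMod q) W).ker
    inferInstance with h | h
  · rwa [h, Subgroup.mem_bot] at hker
  · obtain ⟨w, hw⟩ := exists_ne (0 : W)
    refine absurd (hfix x hx1 ⟨n, hx⟩ w ?_) hw
    have hxk : x ∈ (σ : H →* Module.End (ZMod q) W).ker := h ▸ Subgroup.mem_top x
    exact LinearMap.congr_fun (MonoidHom.mem_ker.mp hxk) w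

namespace FrattiniTriple

variable {S : Type} [Group S] {p q : ℕ} [Finite S] [Fact p.Prime] [Fact q.Prime]
  (T : FrattiniTriple p q S)
  (hpq : p ≠ q) (hpodd : Odd p) (hqodd : Odd q)
  {x y : S} (hx : IsSylowGen p x) (hy : IsSylowGen q y) {H : Subgroup S} (hxH : x ∈ H) (hyH : y ∈ H)

omit [Fact q.Prime] in
include T hx in
theorem ne_one : x ≠ 1 := by
  intro h
  have h1 := T.dvd_orderOf hx
  rw [h, orderOf_one] at h1
  exact (Fact.out : p.Prime).one_lt.ne' (Nat.dvd_one.mp h1)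

include T hpq hx hy hxH hyH in
theorem admits_subgroup [IsSimpleGroup H] : AdmitsFrattiniTriple p q H := by
  have hx1 : (⟨x, hxH⟩ : H) ≠ 1 := fun h => T.ne_one hx (congrArg Subtype.val h)
  have hy1 : (⟨y, hyH⟩ : H) ≠ 1 := fun h => T.swap.ne_one hy (congrArg Subtype.val h)
  obtain ⟨Q, _, _, ρQ, hQfin, hQnt, hQfaith, hQirr, hQH, hQfix⟩ :=
    exists_faithful_irreducible_restrict T.ρQ hpq T.not_h2Trivial_Q T.fixQ hy hyH hx1
      ((Subgroup.orderOf_mk x hxH).trans hx)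
  obtain ⟨P, _, _, ρP, hPfin, hPnt, hPfaith, hPirr, hPH, hPfix⟩ :=
    exists_faithful_irreducible_restrict T.ρP hpq.symm T.not_h2Trivial_P T.fixP hx hxH hy1
      ((Subgroup.orderOf_mk y hyH).trans hy)
  exact ⟨{
    P := P
    ρP := ρP
    Q := Q
    ρQ := ρQ
    faithfulP := hPfaith
    faithfulQ := hQfaith
    irredP := hPirr
    irredQ := hQirr
    no_pq := fun s => by rw [← Subgroup.orderOf_coe]; exact T.no_pq s
    h2P := (nontrivial_H2_iff ρP).mpr hPH
    h2Q := (nontrivial_H2_iff ρQ).mpr hQH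
    fixP := hPfix
    fixQ := hQfix }⟩

include T hpq hx hy in
theorem not_commute : ¬ Commute x y := by
  have hp : p.Prime := Fact.out
  have hq : q.Prime := Fact.out
  intro h
  refine T.no_pq (x * y) ?_
  rw [h.orderOf_mul_eq_mul_orderOf_of_coprime ?_]
  · exact mul_dvd_mul (T.dvd_orderOf hx) (T.swap.dvd_orderOf hy)
  · rw [hx, hy]
    exact Nat.Coprime.pow _ _ ((Nat.coprime_primes hp hq).mpr hpq)

include T hpq hpodd hqodd hx hy in
theorem isSimpleGroup_closure : IsSimpleGroup (Subgroup.closure {x, y}) := by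
  have hxH : x ∈ Subgroup.closure {x, y} := Subgroup.subset_closure (by simp)
  have hyH : y ∈ Subgroup.closure {x, y} := Subgroup.subset_closure (by simp)
  have : Nontrivial (Subgroup.closure {x, y}) :=
    ⟨⟨x, hxH⟩, 1, fun h => T.ne_one hx (congrArg Subtype.val h)⟩
  refine ⟨fun N hN => or_iff_not_imp_left.mpr fun hbot => ?_⟩
  have hxN := T.mem_of_normal_ne_bot hpq hpodd hqodd hx hy hxH hyH N hbot
  have hyN := T.swap.mem_of_normal_ne_bot hpq.symm hqodd hpodd hy hx hyH hxH N hbot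
  have hle : Subgroup.closure {x, y} ≤ N.map (Subgroup.subtype _) := by
    rw [Subgroup.closure_le]
    rintro z (rfl | rfl)
    · exact ⟨_, hxN, rfl⟩
    · exact ⟨_, hyN, rfl⟩
  rw [eq_top_iff]
  rintro ⟨z, hz⟩ -
  obtain ⟨w, hw, hwz⟩ := hle hz
  have : w = ⟨z, hz⟩ := Subtype.ext hwz
  rwa [← this]

end FrattiniTriple

/-- Let `p, q` be distinct odd primes and `S` a finite nonabelian simple group admitting
a `(p,q)`-Frattini triple, such that no proper subgroup of `S` is (isomorphic to) a
finite nonabelian simple group admitting a `(p,q)`-Frattini triple.  Then there are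
`x, y ∈ S` such that `⟨x⟩` is a Sylow `p`-subgroup of `S`, `⟨y⟩` is a Sylow
`q`-subgroup of `S`, and `{x, y}` invariably generates `S`. -/
theorem frattini_triple_invariable_generation
    (S : Type) [Group S] [Finite S] (p q : ℕ)
    (hp : p.Prime) (hq : q.Prime) (hpodd : Odd p) (hqodd : Odd q) (hpq : p ≠ q)
    (hsimple : IsSimpleGroup S) (hnonab : ¬ ∀ a b : S, a * b = b * a)
    (ht : AdmitsFrattiniTriple p q S)
    (hmin : ∀ H : Subgroup S, H ≠ ⊤ →
      ¬ (IsSimpleGroup ↥H ∧ (¬ ∀ a b : ↥H, a * b = b * a) ∧ AdmitsFrattiniTriple p q ↥H)) :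
    ∃ x y : S,
      (∃ X : Sylow p S, (X : Subgroup S) = Subgroup.zpowers x) ∧
      (∃ Y : Sylow q S, (Y : Subgroup S) = Subgroup.zpowers y) ∧
      ∀ s t : S, Subgroup.closure {s⁻¹ * x * s, t⁻¹ * y * t} = ⊤ := by
  have : Fact p.Prime := ⟨hp⟩
  have : Fact q.Prime := ⟨hq⟩
  obtain ⟨T⟩ := ht
  obtain ⟨x, hx⟩ := exists_isSylowGen (p := p) T.ρQ hpq hpodd T.fixQ
  obtain ⟨y, hy⟩ := exists_isSylowGen (p := q) T.ρP hpq.symm hqodd T.fixP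
  refine ⟨x, y, hx.exists_sylow, hy.exists_sylow, fun s t => ?_⟩
  have hx' : IsSylowGen p (s⁻¹ * x * s) := by simpa using hx.conj s⁻¹
  have hy' : IsSylowGen q (t⁻¹ * y * t) := by simpa using hy.conj t⁻¹
  set a := s⁻¹ * x * s
  set b := t⁻¹ * y * t
  have ha : a ∈ Subgroup.closure {a, b} := Subgroup.subset_closure (by simp)
  have hb : b ∈ Subgroup.closure {a, b} := Subgroup.subset_closure (by simp)
  by_contra hne
  have hsimp := T.isSimpleGroup_closure hpq hpodd hqodd hx' hy'
  refine hmin _ hne ⟨hsimp, fun hcomm => T.not_commute hpq hx' hy' ?_,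
    T.admits_subgroup hpq hx' hy' ha hb⟩
  exact congrArg Subtype.val (hcomm ⟨a, ha⟩ ⟨b, hb⟩)
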